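/- Fix n ≥ 2 and 0 ≤ k < ⌊n/2⌋. For every ε > 0 there exists Q such that for every finite field F_q with q ≥ Q elements: (i) every irreducible finite-dimensional complex representation ρ of GL_n(F_q) of U-rank k satisfies (1 − ε)·q^{k(n−k)} ≤ dim(ρ) ≤ (1 + ε)·q^{k(n−k) + k(k−1)/2}; and (ii) both bounds are attained, i.e. there exist irreducible representations ρ₁, ρ₂ of GL_n(F_q) of U-rank k with dim(ρ₁) ≤ (1 + ε)·q^{k(n−k)} and dim(ρ₂) ≥ (1 − ε)·q^{k(n−k) + k(k−1)/2}. -/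

import Mathlib

open Matrix CategoryTheory
open scoped BigOperators

/-- The reindexing equivalence `Fin (n/2) ⊕ Fin (n − n/2) ≃ Fin n`. -/
def blockEquiv (n : ℕ) : (Fin (n / 2) ⊕ Fin (n - n / 2)) ≃ Fin n :=
  finSumFinEquiv.trans (finCongr (by omega))

/-- The block unipotent matrix `u(A) = [[I, A], [0, I]]`, viewed as an `n × n` matrix. -/
def uMat (F : Type) [Field F] (n : ℕ)
    (A : Matrix (Fin (n / 2)) (Fin (n - n / 2)) F) : Matrix (Fin n) (Fin n) F :=
  (Matrix.fromBlocks 1 A 0 1).submatrix (blockEquiv n).symm (blockEquiv n).symm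

lemma uMat_det (F : Type) [Field F] [Fintype F] (n : ℕ)
    (A : Matrix (Fin (n / 2)) (Fin (n - n / 2)) F) : (uMat F n A).det = 1 := by
  unfold uMat
  rw [Matrix.det_submatrix_equiv_self, Matrix.det_fromBlocks_zero₂₁]
  simp

/-- The block unipotent matrix `u(A)` as an element of `GL_n(F_q)`; these form the abelian
subgroup `U`. -/
noncomputable def uGL (F : Type) [Field F] [Fintype F] (n : ℕ)
    (A : Matrix (Fin (n / 2)) (Fin (n - n / 2)) F) : GL (Fin n) F :=
  Matrix.GeneralLinearGroup.mkOfDetNeZero (uMat F n A)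
    (by rw [uMat_det]; exact one_ne_zero)

/-- The character `ψ_B` of `U` occurs in `ρ|_U`, i.e. its multiplicity
`(1/#U)·Σ_A χ_ρ(u(A)) ψ(−trace(Bᵀ A))` is nonzero. -/
noncomputable def OccursInRes (n : ℕ) (F : Type) [Field F] [Fintype F] (ψ : AddChar F ℂ)
    (ρ : FDRep ℂ (GL (Fin n) F)) (B : Matrix (Fin (n / 2)) (Fin (n - n / 2)) F) : Prop :=
  (∑ A : Matrix (Fin (n / 2)) (Fin (n - n / 2)) F,
      ρ.character (uGL F n A) * ψ (-(Bᵀ * A).trace)) ≠ 0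

/-- `ρ` has `U`-rank `k`: some `ψ_B` with `rank B = k` occurs in `ρ|_U`, and no `ψ_B` with
`rank B > k` occurs. -/
noncomputable def HasURank (n : ℕ) (F : Type) [Field F] [Fintype F] (ψ : AddChar F ℂ)
    (ρ : FDRep ℂ (GL (Fin n) F)) (k : ℕ) : Prop :=
  (∃ B : Matrix (Fin (n / 2)) (Fin (n - n / 2)) F, B.rank = k ∧ OccursInRes n F ψ ρ B) ∧
  (∀ B : Matrix (Fin (n / 2)) (Fin (n - n / 2)) F, k < B.rank → ¬ OccursInRes n F ψ ρ B)

set_option linter.unusedSectionVars false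

namespace URank
open scoped Classical

section Fourier

variable {ι κ F V : Type*} [Fintype ι] [Fintype κ] [Field F] [Fintype F]
  [AddCommGroup V] [Module ℂ V]

/-- The trace pairing as a sum of products of entries. -/
lemma trace_transpose_mul (B x : Matrix ι κ F) :
    (Bᵀ * x).trace = ∑ a, ∑ b, B a b * x a b := by
  simp only [Matrix.trace, Matrix.diag, Matrix.mul_apply, Matrix.transpose_apply]
  exact Finset.sum_comm

lemma trace_transpose_mul_comm (B x : Matrix ι κ F) :
    (Bᵀ * x).trace = (xᵀ * B).trace := by
  simp only [trace_transpose_mul, mul_comm]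

lemma trace_transpose_mul_single [DecidableEq ι] [DecidableEq κ]
    (B : Matrix ι κ F) (a : ι) (b : κ) (t : F) :
    (Bᵀ * Matrix.single a b t).trace = B a b * t := by
  rw [trace_transpose_mul, Finset.sum_eq_single a, Finset.sum_eq_single b]
  · simp
  · intro j _ hj; simp [hj.symm]
  · simp
  · intro i _ hi
    exact Finset.sum_eq_zero fun j _ => by simp [hi.symm]
  · simp

lemma exists_addChar_ne_one {ψ : AddChar F ℂ} (hψ : ψ ≠ 1) : ∃ t, ψ t ≠ 1 := by
  by_contra! h
  exact hψ (by ext t; simpa using h t)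

lemma addChar_mul_injective {ψ : AddChar F ℂ} (hψ : ψ ≠ 1) {a b : F}
    (h : ∀ t, ψ (a * t) = ψ (b * t)) : a = b := by
  by_contra hab
  obtain ⟨t, ht⟩ := exists_addChar_ne_one hψ
  apply ht
  have hs : a - b ≠ 0 := sub_ne_zero.2 hab
  have := h ((a - b)⁻¹ * t)
  have e : t = a * ((a - b)⁻¹ * t) - b * ((a - b)⁻¹ * t) := by field_simp
  rw [e, AddChar.map_sub_eq_div, this,
    div_self (by rw [← this]; exact (AddChar.val_isUnit ψ _).ne_zero)]

/-- The character `x ↦ ψ (tr (Bᵀ x))`. -/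
def matChar (ψ : AddChar F ℂ) (B : Matrix ι κ F) : AddChar (Matrix ι κ F) ℂ where
  toFun x := ψ (Bᵀ * x).trace
  map_zero_eq_one' := by simp
  map_add_eq_mul' x y := by rw [Matrix.mul_add, Matrix.trace_add, AddChar.map_add_eq_mul]

@[simp] lemma matChar_apply (ψ : AddChar F ℂ) (B x : Matrix ι κ F) :
    matChar ψ B x = ψ (Bᵀ * x).trace := rfl

lemma matChar_injective [DecidableEq ι] [DecidableEq κ] {ψ : AddChar F ℂ} (hψ : ψ ≠ 1)
    {B C : Matrix ι κ F} (h : matChar ψ B = matChar ψ C) : B = C := by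
  ext a b
  refine addChar_mul_injective hψ fun t => ?_
  have := DFunLike.congr_fun h (Matrix.single a b t)
  simpa [trace_transpose_mul_single] using this

variable [DecidableEq ι] [DecidableEq κ]

lemma sum_matChar_left {ψ : AddChar F ℂ} (hψ : ψ ≠ 1) (x : Matrix ι κ F) :
    ∑ B : Matrix ι κ F, ψ (Bᵀ * x).trace =
      if x = 0 then (Fintype.card (Matrix ι κ F) : ℂ) else 0 := by
  have e : ∀ B : Matrix ι κ F, ψ (Bᵀ * x).trace = matChar ψ x B := fun B => by
    rw [matChar_apply, trace_transpose_mul_comm]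
  simp only [e]
  split_ifs with h
  · subst h; simp
  · apply AddChar.sum_eq_zero_of_ne_one
    intro h1
    exact h (matChar_injective hψ (h1.trans (by ext; simp)))

lemma sum_matChar_right {ψ : AddChar F ℂ} (hψ : ψ ≠ 1) (B : Matrix ι κ F) :
    ∑ x : Matrix ι κ F, ψ (Bᵀ * x).trace =
      if B = 0 then (Fintype.card (Matrix ι κ F) : ℂ) else 0 := by
  simpa only [trace_transpose_mul_comm B] using sum_matChar_left hψ B

/-- The projection onto the `ψ_B`-isotypic part of a representation of the additive group of
matrices. -/
noncomputable def proj (ψ : AddChar F ℂ) (α : AddChar (Matrix ι κ F) (Module.End ℂ V))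
    (B : Matrix ι κ F) : Module.End ℂ V :=
  (Fintype.card (Matrix ι κ F) : ℂ)⁻¹ • ∑ x, ψ (-(Bᵀ * x).trace) • α x

variable {ψ : AddChar F ℂ} (α : AddChar (Matrix ι κ F) (Module.End ℂ V))

lemma card_matrix_ne_zero : (Fintype.card (Matrix ι κ F) : ℂ) ≠ 0 :=
  Nat.cast_ne_zero.2 Fintype.card_ne_zero

lemma sum_proj (hψ : ψ ≠ 1) : ∑ B, proj ψ α B = 1 := by
  simp only [proj]
  rw [← Finset.smul_sum, Finset.sum_comm]
  have : ∀ x : Matrix ι κ F, ∑ B : Matrix ι κ F, ψ (-(Bᵀ * x).trace) • α x =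
      if x = 0 then (Fintype.card (Matrix ι κ F) : ℂ) • (1 : Module.End ℂ V) else 0 := by
    intro x
    rw [← Finset.sum_smul]
    have e : ∀ B : Matrix ι κ F, ψ (-(Bᵀ * x).trace) = ψ (Bᵀ * (-x)).trace := by
      intro B; simp
    simp only [e]
    rw [sum_matChar_left hψ]
    by_cases h : x = 0 <;> simp [h]
  simp only [this]
  rw [Finset.sum_ite_eq' Finset.univ (0 : Matrix ι κ F)]
  simp [smul_smul]

lemma apply_proj (B x : Matrix ι κ F) (v : V) :
    α x (proj ψ α B v) = ψ (Bᵀ * x).trace • proj ψ α B v := by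
  simp only [proj, LinearMap.smul_apply, LinearMap.sum_apply, map_smul, map_sum]
  rw [smul_comm (ψ (Bᵀ * x).trace)]
  rw [Finset.smul_sum (r := ψ (Bᵀ * x).trace)]
  congr 1
  rw [← Equiv.sum_comp (Equiv.addLeft x) (fun y => ψ (Bᵀ * x).trace • ψ (-(Bᵀ * y).trace) • α y v)]
  refine Finset.sum_congr rfl fun y _ => ?_
  simp only [Equiv.coe_addLeft, AddChar.map_add_eq_mul, Matrix.mul_add, Matrix.trace_add, neg_add,
    smul_smul, Module.End.mul_apply]
  rw [← mul_assoc, ← AddChar.map_add_eq_mul]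
  simp

lemma proj_of_weight (hψ : ψ ≠ 1) {B C : Matrix ι κ F} {v : V}
    (h : ∀ x, α x v = ψ (Cᵀ * x).trace • v) : proj ψ α B v = if C = B then v else 0 := by
  simp only [proj, LinearMap.smul_apply, LinearMap.sum_apply, h, smul_smul,
    ← AddChar.map_add_eq_mul]
  rw [← Finset.sum_smul]
  have e : ∀ x : Matrix ι κ F, ψ (-(Bᵀ * x).trace + (Cᵀ * x).trace) =
      ψ ((C - B)ᵀ * x).trace := by
    intro x
    rw [Matrix.transpose_sub, Matrix.sub_mul, Matrix.trace_sub]; congr 1; ring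
  simp only [e]
  rw [sum_matChar_right hψ]
  simp only [sub_eq_zero]
  split_ifs
  · rw [smul_smul, inv_mul_cancel₀ card_matrix_ne_zero, one_smul]
  · simp

lemma proj_comp_self (hψ : ψ ≠ 1) (B C : Matrix ι κ F) (v : V) :
    proj ψ α C (proj ψ α B v) = if B = C then proj ψ α B v else 0 :=
  proj_of_weight α hψ fun x => apply_proj α B x v

lemma exists_proj_ne_zero (hψ : ψ ≠ 1) {v : V} (hv : v ≠ 0) : ∃ B, proj ψ α B v ≠ 0 := by
  by_contra! h
  apply hv
  have := congrArg (fun T : Module.End ℂ V => T v) (sum_proj α hψ)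
  simpa [LinearMap.sum_apply, h] using this.symm

lemma proj_commute {T : Module.End ℂ V} (h : ∀ x v, T (α x v) = α x (T v)) (B : Matrix ι κ F)
    (v : V) : T (proj ψ α B v) = proj ψ α B (T v) := by
  simp [proj, LinearMap.sum_apply, h]

lemma proj_mem {S : Submodule ℂ V} (h : ∀ x, ∀ v ∈ S, α x v ∈ S) (B : Matrix ι κ F)
    {v : V} (hv : v ∈ S) : proj ψ α B v ∈ S := by
  simp only [proj, LinearMap.smul_apply, LinearMap.sum_apply]
  exact S.smul_mem _ (S.sum_mem fun x _ => S.smul_mem _ (h x v hv))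

end Fourier

section Unipotent

variable {I F V : Type*} [Fintype I] [DecidableEq I] [Field F] [Fintype F]
  [AddCommGroup V] [Module ℂ V]

/-- The unipotent element `1 + x` for `x` of square zero (and `1` otherwise). -/
noncomputable def un (x : Matrix I I F) : GL I F :=
  if h : x * x = 0 then
    ⟨1 + x, 1 - x, by rw [add_mul, mul_sub, mul_sub, h]; simp, by
      rw [sub_mul, mul_add, mul_add, h]; simp⟩
  else 1

lemma coe_un {x : Matrix I I F} (h : x * x = 0) : (un x : Matrix I I F) = 1 + x := by
  simp [un, h]

lemma un_zero : un (0 : Matrix I I F) = 1 := by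
  ext1; simp [coe_un]

lemma un_add {x y : Matrix I I F} (hx : x * x = 0) (hy : y * y = 0) (hxy : x * y = 0)
    (hyx : y * x = 0) : un (x + y) = un x * un y := by
  ext1
  rw [Units.val_mul, coe_un hx, coe_un hy, coe_un]
  · rw [add_mul, mul_add, mul_add, hxy]; simp; abel
  · rw [add_mul, mul_add, mul_add, hxy, hyx, hx, hy]; simp

lemma un_inv {x : Matrix I I F} (hx : x * x = 0) : (un x)⁻¹ = un (-x) := by
  rw [inv_eq_iff_mul_eq_one, ← un_add] <;> simp [hx, un_zero]

lemma conj_mul_self (g : GL I F) {x : Matrix I I F} (h : x * x = 0) :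
    ((g : Matrix I I F) * x * (↑g⁻¹ : Matrix I I F)) * (g * x * (↑g⁻¹ : Matrix I I F)) = 0 := by
  have : ((↑g⁻¹ : Matrix I I F)) * (g : Matrix I I F) = 1 := by
    rw [← Units.val_mul]; simp
  calc _ = (g : Matrix I I F) * x * ((↑g⁻¹ : Matrix I I F) * g) * x * (↑g⁻¹ : Matrix I I F) := by
        simp only [Matrix.mul_assoc]
    _ = (g : Matrix I I F) * (x * x) * (↑g⁻¹ : Matrix I I F) := by
        rw [this]; simp only [Matrix.mul_assoc, Matrix.one_mul]
    _ = 0 := by rw [h]; simp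

lemma conj_un (g : GL I F) {x : Matrix I I F} (h : x * x = 0) :
    g * un x * g⁻¹ = un ((g : Matrix I I F) * x * (↑g⁻¹ : Matrix I I F)) := by
  ext1
  rw [Units.val_mul, Units.val_mul, coe_un h, coe_un (conj_mul_self g h), mul_add, add_mul]
  congr 1
  rw [Matrix.mul_one, ← Units.val_mul]; simp

/-- Set the entries of a matrix outside `P` to zero. -/
def mask (P : Finset (I × I)) (x : Matrix I I F) : Matrix I I F :=
  Matrix.of fun a b => if (a, b) ∈ P then x a b else 0

lemma mask_apply (P : Finset (I × I)) (x : Matrix I I F) (a b : I) :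
    mask P x a b = if (a, b) ∈ P then x a b else 0 := rfl

lemma mask_eq_self {P : Finset (I × I)} {x : Matrix I I F} :
    mask P x = x ↔ ∀ a b, (a, b) ∉ P → x a b = 0 := by
  constructor
  · intro h a b hab
    rw [← h, mask_apply, if_neg hab]
  · intro h
    ext a b
    rw [mask_apply]
    split_ifs with hab
    · rfl
    · exact (h a b hab).symm

lemma mask_mask_of_subset {P Q : Finset (I × I)} (h : P ⊆ Q) (x : Matrix I I F) :
    mask Q (mask P x) = mask P x :=
  mask_eq_self.2 fun a b hab => by rw [mask_apply, if_neg fun h' => hab (h h')]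

lemma mask_zero (P : Finset (I × I)) : mask P (0 : Matrix I I F) = 0 := by
  ext; simp [mask_apply]

lemma mask_add (P : Finset (I × I)) (x y : Matrix I I F) :
    mask P (x + y) = mask P x + mask P y := by
  ext a b
  simp only [mask_apply, Matrix.add_apply]
  split_ifs <;> simp

lemma trace_mask (P : Finset (I × I)) (B x : Matrix I I F) :
    (Bᵀ * mask P x).trace = ((mask P B)ᵀ * x).trace := by
  simp only [trace_transpose_mul, mask_apply, mul_ite, mul_zero, ite_mul, zero_mul]

/-- No two composable pairs. -/
def Sq0 (P : Finset (I × I)) : Prop := ∀ a b c, (a, b) ∈ P → (b, c) ∉ P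

lemma mask_mul_mask {P : Finset (I × I)} (hP : Sq0 P) (x y : Matrix I I F) :
    mask P x * mask P y = 0 := by
  ext a c
  rw [Matrix.mul_apply]
  refine Finset.sum_eq_zero fun b _ => ?_
  rw [mask_apply, mask_apply]
  split_ifs with h1 h2
  · exact absurd h2 (hP a b c h1)
  all_goals simp

/-- The pairs in `R × Rᶜ`. -/
def blk (R : Finset I) : Finset (I × I) := R ×ˢ Rᶜ

lemma mem_blk {R : Finset I} {a b : I} : (a, b) ∈ blk R ↔ a ∈ R ∧ b ∉ R := by
  simp [blk]

lemma sq0_blk (R : Finset I) : Sq0 (blk R) := fun _ _ _ h h' =>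
  (mem_blk.1 h).2 (mem_blk.1 h').1

lemma Sq0.mono {P Q : Finset (I × I)} (hQ : Sq0 Q) (h : P ⊆ Q) : Sq0 P :=
  fun a b c hab hbc => hQ a b c (h hab) (h hbc)

variable (ρ : Representation ℂ (GL I F) V) (ψ : AddChar F ℂ)

/-- The action of the additive group of matrices through `x ↦ 1 + mask P x`. -/
noncomputable def uChar (P : Finset (I × I)) (hP : Sq0 P) :
    AddChar (Matrix I I F) (Module.End ℂ V) where
  toFun x := ρ (un (mask P x))
  map_zero_eq_one' := by rw [mask_zero, un_zero, map_one]
  map_add_eq_mul' x y := by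
    rw [mask_add, un_add (mask_mul_mask hP _ _) (mask_mul_mask hP _ _) (mask_mul_mask hP _ _)
      (mask_mul_mask hP _ _), map_mul]

@[simp] lemma uChar_apply (P : Finset (I × I)) (hP : Sq0 P) (x : Matrix I I F) :
    uChar ρ P hP x = ρ (un (mask P x)) := rfl

/-- `v` is a vector of weight `B` for the unipotents supported on `P`. -/
def Wt (P : Finset (I × I)) (B : Matrix I I F) (v : V) : Prop :=
  ∀ x, ρ (un (mask P x)) v = ψ (Bᵀ * mask P x).trace • v

variable {ρ ψ}

lemma Wt.apply {P : Finset (I × I)} {B : Matrix I I F} {v : V} (h : Wt ρ ψ P B v)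
    {x : Matrix I I F} (hx : ∀ a b, (a, b) ∉ P → x a b = 0) :
    ρ (un x) v = ψ (Bᵀ * x).trace • v := by
  have := h x
  rwa [mask_eq_self.2 hx] at this

lemma Wt.mono {P Q : Finset (I × I)} {B : Matrix I I F} {v : V} (h : Wt ρ ψ Q B v)
    (hPQ : P ⊆ Q) : Wt ρ ψ P B v := fun x => by
  have := h (mask P x)
  rwa [mask_mask_of_subset hPQ] at this

lemma Wt.congr {P : Finset (I × I)} {B C : Matrix I I F} {v : V} (h : Wt ρ ψ P B v)
    (hBC : ∀ a b, (a, b) ∈ P → B a b = C a b) : Wt ρ ψ P C v := fun x => by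
  rw [h x, trace_mask, trace_mask]
  have : mask P B = mask P C := by
    ext a b
    rw [mask_apply, mask_apply]
    split_ifs with h
    · exact hBC a b h
    · rfl
  rw [this]

lemma wt_proj {P : Finset (I × I)} (hP : Sq0 P) (B : Matrix I I F) (v : V) :
    Wt ρ ψ P B (proj ψ (uChar ρ P hP) B v) := fun x => by
  have := apply_proj (ψ := ψ) (uChar ρ P hP) B (mask P x) v
  rwa [uChar_apply, mask_mask_of_subset (Finset.Subset.refl P)] at this

lemma Wt.eq_on (hψ : ψ ≠ 1) {P : Finset (I × I)} {B C : Matrix I I F} {v : V} (hv : v ≠ 0)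
    (hB : Wt ρ ψ P B v) (hC : Wt ρ ψ P C v) {a b : I} (hab : (a, b) ∈ P) : B a b = C a b := by
  refine addChar_mul_injective hψ fun t => ?_
  have hs : ∀ a' b', (a', b') ∉ P → Matrix.single a b t a' b' = 0 := by
    intro a' b' h
    rw [Matrix.single_apply, if_neg]
    rintro ⟨rfl, rfl⟩
    exact h hab
  have h1 := hB.apply hs
  rw [hC.apply hs, trace_transpose_mul_single, trace_transpose_mul_single] at h1
  exact (smul_left_injective ℂ hv h1).symm

lemma un_mask_commute {P Q : Finset (I × I)} (hQ : Sq0 Q) (hPQ : P ⊆ Q) (x y : Matrix I I F)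
    (v : V) : ρ (un (mask P x)) (ρ (un (mask Q y)) v) =
      ρ (un (mask Q y)) (ρ (un (mask P x)) v) := by
  rw [← mask_mask_of_subset hPQ]
  have h := un_add (mask_mul_mask hQ (mask P x) _) (mask_mul_mask hQ y _)
    (mask_mul_mask hQ (mask P x) y) (mask_mul_mask hQ y (mask P x))
  have h' := un_add (mask_mul_mask hQ y _) (mask_mul_mask hQ (mask P x) _)
    (mask_mul_mask hQ y (mask P x)) (mask_mul_mask hQ (mask P x) y)
  rw [← Module.End.mul_apply, ← Module.End.mul_apply, ← map_mul, ← map_mul, ← h, ← h', add_comm]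

/-- A weight vector for a smaller set of pairs can be refined to one for a larger set. -/
lemma Wt.exists_extension (hψ : ψ ≠ 1) {P Q : Finset (I × I)} (hQ : Sq0 Q) (hPQ : P ⊆ Q)
    {B : Matrix I I F} {v : V} (hv : v ≠ 0) (h : Wt ρ ψ P B v) :
    ∃ B' v', v' ≠ 0 ∧ Wt ρ ψ Q B' v' ∧ ∀ a b, (a, b) ∈ P → B' a b = B a b := by
  obtain ⟨B', hB'⟩ := exists_proj_ne_zero (ψ := ψ) (uChar ρ Q hQ) hψ hv
  have hw := wt_proj (ρ := ρ) (ψ := ψ) hQ B' v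
  refine ⟨B', _, hB', hw, fun a b hab => ?_⟩
  refine Wt.eq_on hψ hB' (hw.mono hPQ) (fun x => ?_) hab
  rw [proj_commute (uChar ρ Q hQ) (T := ρ (un (mask P x)))
    (fun y u => un_mask_commute hQ hPQ x y u), h x, map_smul]

/-- Entrywise block diagonality with respect to `R`, `Rᶜ`. -/
def BlockDiag (R : Finset I) (g : Matrix I I F) : Prop :=
  ∀ a b, g a b ≠ 0 → (a ∈ R ↔ b ∈ R)

lemma blockDiag_iff {R : Finset I} {g : Matrix I I F} : BlockDiag R g ↔
    Matrix.diagonal (fun a => if a ∈ R then (1 : F) else 0) * g =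
      g * Matrix.diagonal (fun a => if a ∈ R then (1 : F) else 0) := by
  constructor
  · intro h
    ext a b
    rw [Matrix.diagonal_mul, Matrix.mul_diagonal]
    by_cases h0 : g a b = 0
    · simp [h0]
    · simp [h a b h0]
  · intro h a b h0
    have := congrFun (congrFun h a) b
    rw [Matrix.diagonal_mul, Matrix.mul_diagonal] at this
    by_cases ha : a ∈ R <;> by_cases hb : b ∈ R <;> simp_all

lemma BlockDiag.inv {R : Finset I} {g : GL I F} (h : BlockDiag R (g : Matrix I I F)) :
    BlockDiag R (↑g⁻¹ : Matrix I I F) := by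
  rw [blockDiag_iff] at h ⊢
  exact ((Commute.units_inv_right (u := g) h :) :)

lemma BlockDiag.mask_conj {R : Finset I} {g h : Matrix I I F} (hg : BlockDiag R g)
    (hh : BlockDiag R h) (x : Matrix I I F) (a b : I) (hab : (a, b) ∉ blk R) :
    (g * mask (blk R) x * h) a b = 0 := by
  rw [Matrix.mul_apply]
  refine Finset.sum_eq_zero fun c _ => ?_
  rw [Matrix.mul_apply, Finset.sum_mul]
  refine Finset.sum_eq_zero fun d _ => ?_
  by_contra hne
  have h1 : g a d ≠ 0 := fun h0 => hne (by rw [h0]; simp)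
  have h2 : h c b ≠ 0 := fun h0 => hne (by rw [h0]; simp)
  have h3 : (d, c) ∈ blk R := by
    by_contra h3; exact hne (by rw [mask_apply, if_neg h3]; simp)
  apply hab
  rw [mem_blk] at h3 ⊢
  exact ⟨(hg _ _ h1).2 h3.1, fun hb => h3.2 ((hh _ _ h2).2 hb)⟩

lemma Wt.conj {R : Finset I} {B : Matrix I I F} {v : V} (h : Wt ρ ψ (blk R) B v) {g : GL I F}
    (hg : BlockDiag R (g : Matrix I I F)) :
    Wt ρ ψ (blk R) ((↑g⁻¹ : Matrix I I F)ᵀ * B * (g : Matrix I I F)ᵀ) (ρ g v) := fun x => by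
  have e : un (mask (blk R) x) * g =
      g * un ((↑g⁻¹ : Matrix I I F) * mask (blk R) x * (g : Matrix I I F)) := by
    have := conj_un g⁻¹ (mask_mul_mask (sq0_blk R) x x)
    rw [inv_inv] at this
    rw [← this]; group
  rw [← Module.End.mul_apply, ← map_mul, e, map_mul, Module.End.mul_apply,
    h.apply (fun a b hab => hg.inv.mask_conj hg x a b hab), map_smul]
  congr 2
  rw [Matrix.transpose_mul, Matrix.transpose_mul, Matrix.transpose_transpose,
    Matrix.transpose_transpose]
  rw [← Matrix.mul_assoc, ← Matrix.mul_assoc, Matrix.trace_mul_comm]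
  simp only [Matrix.mul_assoc]

/-- The matrix with ones at the places `(X i, Y i)`. -/
def matching {r : ℕ} (X Y : Fin r → I) : Matrix I I F := ∑ i, Matrix.single (X i) (Y i) 1

lemma trace_matching {r : ℕ} (X Y : Fin r → I) (x : Matrix I I F) :
    ((matching X Y)ᵀ * x).trace = ∑ i, x (X i) (Y i) := by
  rw [trace_transpose_mul_comm, matching, Matrix.mul_sum, Matrix.trace_sum]
  simp [trace_transpose_mul_single]

lemma matching_apply {r : ℕ} {X Y : Fin r → I} (hY : Function.Injective Y) (a : I) (j : Fin r) :
    matching X Y a (Y j) = if a = X j then (1 : F) else 0 := by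
  rw [matching, Matrix.sum_apply, Finset.sum_eq_single j]
  · simp [Matrix.single_apply, eq_comm]
  · intro i _ hij
    rw [Matrix.single_apply, if_neg]
    rintro ⟨-, h⟩
    exact hij (hY h)
  · simp

variable (ρ ψ)

/-- A matching of size `r` occurs as a weight on the corresponding maximal block. -/
def HasRank (r : ℕ) : Prop :=
  ∃ X Y : Fin r → I, Function.Injective X ∧ Function.Injective Y ∧ (∀ i j, X i ≠ Y j) ∧
    ∃ v : V, v ≠ 0 ∧ Wt ρ ψ (blk (Finset.univ.image Y)ᶜ) (matching X Y) v

variable {ρ ψ}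

lemma submatrix_injective_of_det_ne_zero {r : ℕ} {B : Matrix I I F} {X Y : Fin r → I}
    (h : (B.submatrix X Y).det ≠ 0) : Function.Injective X ∧ Function.Injective Y := by
  constructor
  · intro i j hij
    by_contra hne
    exact h (Matrix.det_zero_of_row_eq hne (by ext; simp [hij]))
  · intro i j hij
    by_contra hne
    exact h (Matrix.det_zero_of_column_eq hne (by intro; simp [hij]))

/-- A weight with a nonsingular minor of size `r` forces `HasRank r`. -/
lemma Wt.hasRank (hψ : ψ ≠ 1) {R : Finset I} {B : Matrix I I F} {v : V} (hv : v ≠ 0)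
    (h : Wt ρ ψ (blk R) B v) {r : ℕ} {X Y : Fin r → I} (hX : ∀ i, X i ∈ R) (hY : ∀ i, Y i ∉ R)
    (hdet : (B.submatrix X Y).det ≠ 0) : HasRank ρ ψ r := by
  obtain ⟨hXi, hYi⟩ := submatrix_injective_of_det_ne_zero hdet
  have hXY : ∀ i j, X i ≠ Y j := fun i j e => hY j (e ▸ hX i)
  set R' : Finset I := (Finset.univ.image Y)ᶜ with hR'
  have hXR' : ∀ i, X i ∈ R' := fun i => by simpa [hR'] using fun j => (hXY i j).symm
  have hYR' : ∀ i, Y i ∉ R' := fun i => by simp [hR']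
  have hYR'' : ∀ a, a ∉ R' → ∃ j, Y j = a := fun a ha => by simpa [hR'] using ha
  have hsub1 : R ×ˢ Finset.univ.image Y ⊆ blk R := by
    rintro ⟨a, b⟩ hab
    obtain ⟨ha, hb⟩ := Finset.mem_product.1 hab
    obtain ⟨j, -, rfl⟩ := Finset.mem_image.1 hb
    exact mem_blk.2 ⟨ha, hY j⟩
  have hsub2 : R ×ˢ Finset.univ.image Y ⊆ blk R' := by
    rintro ⟨a, b⟩ hab
    obtain ⟨ha, hb⟩ := Finset.mem_product.1 hab
    refine mem_blk.2 ⟨?_, by simpa [hR'] using hb⟩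
    simp only [hR', Finset.mem_compl, Finset.mem_image, Finset.mem_univ, true_and]
    rintro ⟨j, rfl⟩
    exact hY j ha
  obtain ⟨B', v', hv', hw, hB'⟩ := (h.mono hsub1).exists_extension hψ (sq0_blk R') hsub2 hv
  have hB'XY : B'.submatrix X Y = B.submatrix X Y := by
    ext i j
    exact hB' _ _ (Finset.mem_product.2 ⟨hX i, Finset.mem_image_of_mem _ (Finset.mem_univ j)⟩)
  rw [← hB'XY] at hdet
  set N0 := B'.submatrix X Y with hN0
  let P : Matrix I (Fin r) F := Matrix.of fun a j => if a = X j then 1 else 0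
  let M : Matrix I (Fin r) F := Matrix.of fun a j => if a ∈ R' then B' a (Y j) else 0
  have hPT : ∀ {m : Type} (A : Matrix I m F) (i : Fin r) (j : m), (Pᵀ * A) i j = A (X i) j := by
    intro m A i j
    simp [Matrix.mul_apply, P]
  have hPM : Pᵀ * M = N0 := by
    ext i j
    rw [hPT]
    simp [M, hXR', hN0]
  have hPP : Pᵀ * P = 1 := by
    ext i j
    rw [hPT]
    simp [P, Matrix.one_apply, hXi.eq_iff]
  have hinv : N0⁻¹ * N0 = 1 := Matrix.nonsing_inv_mul _ (Ne.isUnit hdet)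
  set L : Matrix I I F := 1 + (P - M) * (N0⁻¹ * Pᵀ) with hL
  set L' : Matrix I I F := 1 + (M - P) * Pᵀ with hL'
  have hLL' : L * L' = 1 := by
    have e1 : (N0⁻¹ * Pᵀ) * ((M - P) * Pᵀ) = Pᵀ - N0⁻¹ * Pᵀ := by
      rw [Matrix.mul_assoc, ← Matrix.mul_assoc Pᵀ, Matrix.mul_sub, hPM, hPP, Matrix.sub_mul,
        Matrix.mul_sub, Matrix.one_mul, ← Matrix.mul_assoc, hinv, Matrix.one_mul]
    rw [hL, hL', add_mul, mul_add, mul_add, Matrix.mul_assoc (P - M) (N0⁻¹ * Pᵀ) ((M - P) * Pᵀ), e1,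
      Matrix.mul_sub,
      ← neg_sub P M, Matrix.neg_mul]
    simp
  have hL'L : L' * L = 1 := mul_eq_one_comm.1 hLL'
  have hLM : L * M = P := by
    rw [hL, Matrix.add_mul, Matrix.mul_assoc, Matrix.mul_assoc, hPM, hinv]; simp
  let g : GL I F := ⟨L'ᵀ, Lᵀ, by rw [← Matrix.transpose_mul, hLL', Matrix.transpose_one], by
    rw [← Matrix.transpose_mul, hL'L, Matrix.transpose_one]⟩
  have hL'row : ∀ a b, L' a b = (1 : Matrix I I F) a b + ∑ j, (M a j - P a j) * P b j := by
    intro a b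
    simp [hL', Matrix.mul_apply]
  have hPR : ∀ a j, a ∉ R' → P a j = 0 := by
    intro a j ha
    simp only [P, Matrix.of_apply, ite_eq_right_iff]
    rintro rfl
    exact absurd (hXR' j) ha
  have hMR : ∀ a j, a ∉ R' → M a j = 0 := by
    intro a j ha
    simp [M, ha]
  have hgR : BlockDiag R' (g : Matrix I I F) := by
    intro a b hab
    change L' b a ≠ 0 at hab
    by_contra hne
    apply hab
    have hne' : a ≠ b := fun e => hne (by rw [e])
    rw [hL'row, Matrix.one_apply_ne' hne', zero_add]
    refine Finset.sum_eq_zero fun j _ => ?_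
    by_cases hb : b ∈ R'
    · have ha : a ∉ R' := fun ha => hne ⟨fun _ => hb, fun _ => ha⟩
      rw [hPR a j ha, mul_zero]
    · rw [hMR b j hb, hPR b j hb]; simp
  refine ⟨X, Y, hXi, hYi, hXY, ρ g v', ?_, ?_⟩
  · intro h0
    apply hv'
    have := congrArg (ρ g⁻¹) h0
    rwa [← Module.End.mul_apply, ← map_mul, inv_mul_cancel, map_one, map_zero] at this
  · refine (hw.conj hgR).congr fun a b hab => ?_
    obtain ⟨ha, hb⟩ := mem_blk.1 hab
    obtain ⟨j, rfl⟩ := hYR'' b hb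
    rw [matching_apply hYi]
    have e1 : ((↑g⁻¹ : Matrix I I F)ᵀ * B' * (g : Matrix I I F)ᵀ) a (Y j) =
        ((↑g⁻¹ : Matrix I I F)ᵀ * B') a (Y j) := by
      have : ((g : Matrix I I F)ᵀ) = L' := rfl
      rw [this, hL', Matrix.mul_add, Matrix.mul_one, Matrix.add_apply, ← Matrix.mul_assoc,
        Matrix.mul_apply (N := Pᵀ)]
      simp [hPR _ _ hb]
    rw [e1]
    have e2 : ((↑g⁻¹ : Matrix I I F)ᵀ) = L := rfl
    rw [e2]
    have e3 : (L * M) a j = (L * B') a (Y j) := by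
      rw [Matrix.mul_apply, Matrix.mul_apply]
      refine Finset.sum_congr rfl fun c _ => ?_
      by_cases hc : c ∈ R'
      · simp [M, hc]
      · have : L a c = 0 := by
          by_contra hne
          have := hgR.inv c a (by exact hne)
          exact hc (this.2 ha)
        rw [this]; simp
    rw [← e3, hLM]
    simp [P]

end Unipotent

section Embedding

variable {I F : Type*} [Fintype I] [DecidableEq I] [Field F] [Fintype F]

/-- Extend a matrix indexed by `A` by the identity matrix. -/
def embMat (A : Finset I) (M : Matrix A A F) : Matrix I I F :=
  Matrix.of fun a b => if h : a ∈ A ∧ b ∈ A then M ⟨a, h.1⟩ ⟨b, h.2⟩ else (1 : Matrix I I F) a b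

lemma embMat_eq (A : Finset I) (M : Matrix A A F) : embMat A M =
    (Matrix.fromBlocks M 0 0 (1 : Matrix {a // a ∉ A} {a // a ∉ A} F)).submatrix
      (Equiv.sumCompl (· ∈ A)).symm (Equiv.sumCompl (· ∈ A)).symm := by
  ext a b
  rw [Matrix.submatrix_apply]
  by_cases ha : a ∈ A <;> by_cases hb : b ∈ A
  · simp [embMat, ha, hb]
  · simp [embMat, ha, hb, Matrix.one_apply]
    rintro rfl; exact hb ha
  · simp [embMat, ha, hb, Matrix.one_apply]
    rintro rfl; exact ha hb
  · simp [embMat, ha, hb, Matrix.one_apply]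

lemma embMat_mul (A : Finset I) (M N : Matrix A A F) :
    embMat A (M * N) = embMat A M * embMat A N := by
  simp only [embMat_eq]
  rw [Matrix.submatrix_mul_equiv, Matrix.fromBlocks_multiply]
  simp

lemma embMat_one (A : Finset I) : embMat A (1 : Matrix A A F) = 1 := by
  rw [embMat_eq, Matrix.fromBlocks_one, Matrix.submatrix_one_equiv]

lemma det_embMat (A : Finset I) (M : Matrix A A F) : (embMat A M).det = M.det := by
  rw [embMat_eq, Matrix.det_submatrix_equiv_self, Matrix.det_fromBlocks_zero₂₁]
  simp

/-- The block embedding of `GL A F` in `GL I F`. -/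
def emb (A : Finset I) : GL A F →* GL I F where
  toFun h := ⟨embMat A h, embMat A (↑h⁻¹ : Matrix A A F),
    by rw [← embMat_mul, ← Units.val_mul]; simp [embMat_one],
    by rw [← embMat_mul, ← Units.val_mul]; simp [embMat_one]⟩
  map_one' := by ext1; simp [embMat_one]
  map_mul' g h := by ext1; simp [embMat_mul]

lemma coe_emb (A : Finset I) (h : GL A F) : (emb A h : Matrix I I F) = embMat A h := rfl

lemma embMat_apply_mem {A : Finset I} (M : Matrix A A F) {a b : I} (ha : a ∈ A) (hb : b ∈ A) :
    embMat A M a b = M ⟨a, ha⟩ ⟨b, hb⟩ := by simp [embMat, ha, hb]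

lemma embMat_apply_left {A : Finset I} (M : Matrix A A F) {a : I} (b : I) (ha : a ∉ A) :
    embMat A M a b = (1 : Matrix I I F) a b := by simp [embMat, ha]

lemma embMat_apply_right {A : Finset I} (M : Matrix A A F) (a : I) {b : I} (hb : b ∉ A) :
    embMat A M a b = (1 : Matrix I I F) a b := by simp [embMat, hb]

lemma blockDiag_embMat (A : Finset I) (M : Matrix A A F) : BlockDiag A (embMat A M) := by
  intro a b h
  by_cases ha : a ∈ A
  · by_cases hb : b ∈ A
    · simp [ha, hb]
    · rw [embMat_apply_right _ _ hb] at h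
      have : a = b := by by_contra hab; exact h (Matrix.one_apply_ne hab)
      subst this; exact absurd ha hb
  · rw [embMat_apply_left _ _ ha] at h
    have : a = b := by by_contra hab; exact h (Matrix.one_apply_ne hab)
    subst this; rfl

/-- Extend a matrix indexed by `A` by zero. -/
def extMat (A : Finset I) (M : Matrix A A F) : Matrix I I F :=
  Matrix.of fun a b => if h : a ∈ A ∧ b ∈ A then M ⟨a, h.1⟩ ⟨b, h.2⟩ else 0

lemma embMat_one_add (A : Finset I) (M : Matrix A A F) : embMat A (1 + M) = 1 + extMat A M := by
  ext a b
  by_cases h : a ∈ A ∧ b ∈ A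
  · simp [embMat, extMat, h, Matrix.one_apply]
  · simp [embMat, extMat, h]

lemma extMat_mul (A : Finset I) (M N : Matrix A A F) :
    extMat A (M * N) = extMat A M * extMat A N := by
  ext a b
  rw [Matrix.mul_apply]
  rw [← Finset.sum_subset (Finset.subset_univ A) (fun c _ hc => by simp [extMat, hc])]
  by_cases h : a ∈ A ∧ b ∈ A
  · rw [← Finset.sum_coe_sort]
    simp [extMat, h, Matrix.mul_apply]
  · rw [Finset.sum_eq_zero]
    · simp [extMat, h]
    · intro c _
      rw [not_and_or] at h
      rcases h with h | h <;> simp [extMat, h]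

lemma extMat_zero (A : Finset I) : extMat A (0 : Matrix A A F) = 0 := by
  ext; simp [extMat]

lemma emb_un {A : Finset I} {x : Matrix A A F} (hx : x * x = 0) :
    emb A (un x) = un (extMat A x) := by
  ext1
  rw [coe_emb, coe_un hx, coe_un (by rw [← extMat_mul, hx, extMat_zero]), embMat_one_add]

end Embedding

section Elementary

variable {I F : Type*} [Fintype I] [DecidableEq I] [Field F] [Fintype F]

lemma single_mul_self {a b : I} (hab : a ≠ b) (t : F) :
    Matrix.single a b t * Matrix.single a b t = 0 :=
  Matrix.single_mul_single_of_ne _ _ _ _ hab.symm _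

/-- The elementary matrix `1 + t e_{ab}`. -/
noncomputable def E (a b : I) (t : F) : GL I F := un (Matrix.single a b t)

lemma coe_E {a b : I} (hab : a ≠ b) (t : F) :
    (E a b t : Matrix I I F) = 1 + Matrix.single a b t := coe_un (single_mul_self hab t)

lemma E_inv {a b : I} (hab : a ≠ b) (t : F) : (E a b t)⁻¹ = E a b (-t) := by
  rw [E, un_inv (single_mul_self hab t), E]
  congr 1; ext i j; simp [Matrix.single_apply]; split_ifs <;> simp

lemma E_commutator {a b c : I} (hab : a ≠ b) (hbc : b ≠ c) (hac : a ≠ c) (t : F) :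
    E a b 1 * E b c t * E a b (-1) * E b c (-t) = E a c t := by
  rw [← E_inv hab, ← E_inv hbc, mul_inv_eq_iff_eq_mul, mul_inv_eq_iff_eq_mul]
  ext1
  simp only [Units.val_mul, coe_E hab, coe_E hbc, coe_E hac]
  simp only [mul_add, add_mul, Matrix.mul_one, Matrix.single_mul_single_same,
    one_mul, Matrix.single_mul_single_of_ne _ _ _ _ hac.symm,
    Matrix.single_mul_single_of_ne _ _ _ _ hbc.symm,
    Matrix.zero_mul]
  abel

/-- Diagonal matrices as elements of `GL`. -/
def dg : (I → Fˣ) →* GL I F where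
  toFun D := ⟨Matrix.diagonal fun a => (D a : F), Matrix.diagonal fun a => (↑(D a)⁻¹ : F),
    by rw [Matrix.diagonal_mul_diagonal]; simp, by rw [Matrix.diagonal_mul_diagonal]; simp⟩
  map_one' := by ext1; simp
  map_mul' C D := by ext1; simp [Matrix.diagonal_mul_diagonal]

lemma coe_dg (D : I → Fˣ) : (dg D : Matrix I I F) = Matrix.diagonal fun a => (D a : F) := rfl

lemma coe_dg_inv (D : I → Fˣ) :
    ((dg D)⁻¹ : GL I F) = dg D⁻¹ := by rw [map_inv]

lemma det_dg (D : I → Fˣ) : Matrix.GeneralLinearGroup.det (dg D) = ∏ a, D a := by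
  ext1
  simp [coe_dg]

lemma dg_conj_E {a b : I} (hab : a ≠ b) (t : F) (D : I → Fˣ) :
    dg D * E a b t * (dg D)⁻¹ = E a b (D a * t * ↑(D b)⁻¹) := by
  rw [E, conj_un _ (single_mul_self hab t), E]
  congr 1
  rw [coe_dg_inv, coe_dg, coe_dg]
  ext i j
  rw [Matrix.mul_diagonal, Matrix.diagonal_mul, Matrix.single_apply, Matrix.single_apply]
  split_ifs with h
  · obtain ⟨rfl, rfl⟩ := h; simp
  · simp

lemma det_E {a b : I} (hab : a ≠ b) (t : F) :
    Matrix.GeneralLinearGroup.det (E a b t) = 1 := by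
  ext1
  simp only [Matrix.GeneralLinearGroup.val_det_apply, coe_E hab, Units.val_one]
  exact Matrix.det_transvection_of_ne a b hab t

/-- Elementary matrices move a diagonal matrix from position `a` to position `b`. -/
lemma weyl_conj_dg {a b : I} (hab : a ≠ b) (l : Fˣ) :
    (E a b 1 * E b a (-1) * E a b 1) * dg (Pi.mulSingle b l) =
      dg (Pi.mulSingle a l) * (E a b 1 * E b a (-1) * E a b (1 : F)) := by
  ext1
  have h1 : (1 + Matrix.single a b (1 : F)) * (1 + Matrix.single b a (-1 : F)) *
      (1 + Matrix.single a b (1 : F)) = 1 - Matrix.single a a 1 - Matrix.single b b 1 +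
        Matrix.single a b 1 + Matrix.single b a (-1) := by
    simp only [mul_add, add_mul, Matrix.one_mul, Matrix.single_mul_single_same,
      Matrix.single_mul_single_of_ne _ _ _ _ hab.symm, mul_neg, mul_one]
    have hn : ∀ i j : I, Matrix.single i j (-1 : F) = - Matrix.single i j 1 := by
      intro i j; ext; simp [Matrix.single_apply]; split_ifs <;> simp
    simp only [hn]
    abel
  simp only [Units.val_mul, coe_E hab, coe_E hab.symm, h1, coe_dg]
  ext i j
  rw [Matrix.mul_diagonal, Matrix.diagonal_mul]
  simp only [Matrix.add_apply, Matrix.sub_apply, Matrix.one_apply, Matrix.single_apply,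
    Pi.mulSingle_apply]
  by_cases hia : i = a <;> by_cases hja : j = a <;> by_cases hib : i = b <;>
    by_cases hjb : j = b <;> by_cases hij : i = j <;>
    simp_all <;> grind

end Elementary

section SubType

variable {I F V : Type*} [Fintype I] [DecidableEq I] [Field F] [Fintype F]
  [AddCommGroup V] [Module ℂ V]

/-- `v` is a `χ ∘ det` eigenvector for the group of matrices that agree with the identity in all
rows outside `W`. -/
def SubT (ρ : Representation ℂ (GL I F) V) (W : Finset I) (χ : Fˣ →* ℂ) (v : V) : Prop :=
  ∀ g : GL I F, (∀ a ∉ W, ∀ b, (g : Matrix I I F) a b = (1 : Matrix I I F) a b) →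
    ρ g v = χ (Matrix.GeneralLinearGroup.det g) • v

variable {ρ : Representation ℂ (GL I F) V}

lemma rho_inv_apply (g : GL I F) (v : V) : ρ g⁻¹ (ρ g v) = v := by
  rw [← Module.End.mul_apply, ← map_mul, inv_mul_cancel, map_one, Module.End.one_apply]

lemma rho_apply_inv (g : GL I F) (v : V) : ρ g (ρ g⁻¹ v) = v := by
  rw [← Module.End.mul_apply, ← map_mul, mul_inv_cancel, map_one, Module.End.one_apply]

lemma rho_mul_apply (g h : GL I F) (v : V) : ρ (g * h) v = ρ g (ρ h v) := by
  rw [map_mul, Module.End.mul_apply]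

lemma rho_ne_zero {v : V} (hv : v ≠ 0) (g : GL I F) : ρ g v ≠ 0 := fun h => hv <| by
  rw [← rho_inv_apply (ρ := ρ) g v, h, map_zero]

lemma chi_ne_zero (χ : Fˣ →* ℂ) (l : Fˣ) : χ l ≠ 0 := fun h => by
  have := map_mul χ l l⁻¹
  rw [h, zero_mul, mul_inv_cancel, map_one] at this
  exact one_ne_zero this

/-- The subgroup on which `v` is a `χ ∘ det` eigenvector. -/
def charStab (ρ : Representation ℂ (GL I F) V) (χ : Fˣ →* ℂ) (v : V) : Subgroup (GL I F) where
  carrier := {g | ρ g v = χ (Matrix.GeneralLinearGroup.det g) • v}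
  one_mem' := by simp
  mul_mem' {g h} hg hh := by
    simp only [Set.mem_ofPred_eq] at *
    rw [rho_mul_apply, hh, map_smul, hg, smul_smul, map_mul, map_mul, mul_comm]
  inv_mem' {g} hg := by
    simp only [Set.mem_ofPred_eq] at *
    have h1 := rho_inv_apply (ρ := ρ) g v
    rw [hg, map_smul] at h1
    have h2 : χ (Matrix.GeneralLinearGroup.det g⁻¹) * χ (Matrix.GeneralLinearGroup.det g) = 1 := by
      rw [← map_mul, ← map_mul, inv_mul_cancel, map_one, map_one]
    rw [← one_smul ℂ (ρ g⁻¹ v), ← h2, mul_smul, h1]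

lemma mem_charStab {χ : Fˣ →* ℂ} {v : V} {g : GL I F} : g ∈ charStab ρ χ v ↔
    ρ g v = χ (Matrix.GeneralLinearGroup.det g) • v := Iff.rfl

lemma un_mask_mem {P : Finset (I × I)} (hP : Sq0 P) (T : Subgroup (GL I F))
    (h : ∀ a b t, (a, b) ∈ P → E a b t ∈ T) (x : Matrix I I F) : un (mask P x) ∈ T := by
  induction x using Matrix.induction_on' with
  | h_zero => rw [mask_zero, un_zero]; exact T.one_mem
  | h_add p q hp hq =>
    rw [mask_add, un_add (mask_mul_mask hP _ _) (mask_mul_mask hP _ _) (mask_mul_mask hP _ _)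
      (mask_mul_mask hP _ _)]
    exact T.mul_mem hp hq
  | h_std_basis i j t =>
    by_cases hij : (i, j) ∈ P
    · have : mask P (Matrix.single i j t) = Matrix.single i j t := mask_eq_self.2 fun a b hab => by
        rw [Matrix.single_apply, if_neg]
        rintro ⟨rfl, rfl⟩; exact hab hij
      rw [this]; exact h i j t hij
    · have : mask P (Matrix.single i j t) = 0 := by
        ext a b
        rw [mask_apply, Matrix.single_apply]
        split_ifs with h1 h2
        · obtain ⟨rfl, rfl⟩ := h2; exact absurd h1 hij
        all_goals rfl
      rw [this, un_zero]; exact T.one_mem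

/-- A subgroup containing elementary and diagonal matrices in the rows `W` contains the block
embedding of `GL W`. -/
lemma emb_mem {W : Finset I} (T : Subgroup (GL I F))
    (h1 : ∀ a ∈ W, ∀ b ∈ W, a ≠ b → ∀ t, E a b t ∈ T)
    (h2 : ∀ a ∈ W, ∀ l, dg (Pi.mulSingle a l) ∈ T) (g : GL W F) : emb W g ∈ T := by
  suffices h : ∀ h : GL W F, (h : Matrix W W F) = g → emb W h ∈ T from h g rfl
  have hdet : (g : Matrix W W F).det ≠ 0 := by
    have := g.isUnit
    rw [Matrix.isUnit_iff_isUnit_det] at this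
    exact this.ne_zero
  refine Matrix.diagonal_transvection_induction_of_det_ne_zero
    (fun M => ∀ h : GL W F, (h : Matrix W W F) = M → emb W h ∈ T) g hdet ?_ ?_ ?_
  · intro D hD h hh
    rw [Matrix.det_diagonal] at hD
    have hD' : ∀ i, D i ≠ 0 := fun i => (Finset.prod_ne_zero_iff.1 hD) i (Finset.mem_univ i)
    let D' : I → Fˣ := fun a => if ha : a ∈ W then Units.mk0 (D ⟨a, ha⟩) (hD' _) else 1
    have e : emb W h = dg D' := by
      ext a b
      rw [coe_emb, hh, coe_dg]
      by_cases ha : a ∈ W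
      · by_cases hb : b ∈ W
        · rw [embMat_apply_mem _ ha hb, Matrix.diagonal_apply, Matrix.diagonal_apply]
          simp [D', ha]
        · rw [embMat_apply_right _ _ hb, Matrix.diagonal_apply, Matrix.one_apply]
          have : a ≠ b := fun e => hb (e ▸ ha)
          simp [this]
      · rw [embMat_apply_left _ _ ha, Matrix.diagonal_apply, Matrix.one_apply]
        simp [D', ha]
    rw [e]
    have : D' ∈ T.comap (dg (I := I) (F := F)) := by
      rw [← Finset.univ_prod_mulSingle D']
      refine Subgroup.prod_mem _ fun a _ => ?_
      by_cases ha : a ∈ W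
      · exact h2 a ha _
      · have : D' a = 1 := by simp [D', ha]
        rw [this, Pi.mulSingle_one]
        exact Subgroup.one_mem _
    exact this
  · intro t h hh
    have e : emb W h = E (t.i : I) (t.j : I) t.c := by
      have ht : (t.i : I) ≠ t.j := fun e => t.hij (Subtype.ext e)
      have : h = E t.i t.j t.c := by
        ext1; rw [hh, coe_E t.hij]; rfl
      rw [this, E, emb_un (single_mul_self t.hij _), E]
      congr 1
      ext a b
      by_cases hab : a ∈ W ∧ b ∈ W
      · simp only [extMat, Matrix.of_apply, hab, dif_pos, and_self]
        rw [Matrix.single_apply, Matrix.single_apply]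
        simp only [Subtype.ext_iff]
      · simp only [extMat, Matrix.of_apply, hab, dif_neg, not_false_eq_true]
        rw [Matrix.single_apply, if_neg]
        rintro ⟨rfl, rfl⟩
        exact hab ⟨t.i.2, t.j.2⟩
    rw [e]
    exact h1 _ t.i.2 _ t.j.2 (fun e => t.hij (Subtype.ext e)) _
  · intro M N hM hN ihM ihN h hh
    have e : h = Matrix.GeneralLinearGroup.mkOfDetNeZero M hM *
        Matrix.GeneralLinearGroup.mkOfDetNeZero N hN := by
      ext1; rw [hh]; rfl
    rw [e, map_mul]
    exact T.mul_mem (ihM _ rfl) (ihN _ rfl)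

/-- A matrix trivial in the rows outside `W` is a product of a unipotent and a block matrix. -/
lemma eq_un_mul_emb {W : Finset I} {g : GL I F}
    (hg : ∀ a ∉ W, ∀ b, (g : Matrix I I F) a b = (1 : Matrix I I F) a b) :
    ∃ h : GL W F, g = un (mask (blk W) g) * emb W h := by
  have hmul : (un (mask (blk W) (-(g : Matrix I I F))) * g : Matrix I I F) =
      embMat W ((g : Matrix I I F).submatrix (↑) (↑)) := by
    rw [coe_un (mask_mul_mask (sq0_blk W) _ _), add_mul, Matrix.one_mul]
    ext a b
    rw [Matrix.add_apply, Matrix.mul_apply]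
    by_cases ha : a ∈ W
    · have : ∀ c, mask (blk W) (-(g : Matrix I I F)) a c * (g : Matrix I I F) c b =
          if b = c ∧ b ∉ W then - (g : Matrix I I F) a b else 0 := by
        intro c
        rw [mask_apply]
        by_cases hc : c ∈ W
        · rw [if_neg (fun h => (mem_blk.1 h).2 hc), zero_mul, if_neg]
          rintro ⟨rfl, h⟩; exact h hc
        · rw [if_pos (mem_blk.2 ⟨ha, hc⟩), hg c hc b, Matrix.one_apply]
          by_cases hbc : c = b
          · subst hbc; simp [hc]
          · rw [if_neg hbc, if_neg fun h => hbc h.1.symm]; simp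
      simp only [this]
      by_cases hb : b ∈ W
      · simp [hb, embMat_apply_mem _ ha hb]
      · rw [embMat_apply_right _ _ hb]
        simp only [hb, not_false_eq_true, and_true, Finset.sum_ite_eq, Finset.mem_univ, if_true]
        rw [Matrix.one_apply_ne (fun e : a = b => hb (e ▸ ha))]; ring
    · rw [embMat_apply_left _ _ ha, hg a ha b, Finset.sum_eq_zero]
      · simp
      · intro c _; simp [mask_apply, mem_blk, ha]
  have hdet : ((g : Matrix I I F).submatrix ((↑) : W → I) (↑)).det ≠ 0 := by
    rw [← det_embMat, ← hmul, ← Units.val_mul]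
    have := (un (mask (blk W) (-(g : Matrix I I F))) * g).isUnit
    rw [Matrix.isUnit_iff_isUnit_det] at this
    exact this.ne_zero
  refine ⟨Matrix.GeneralLinearGroup.mkOfDetNeZero _ hdet, ?_⟩
  rw [← inv_mul_eq_iff_eq_mul, un_inv (mask_mul_mask (sq0_blk W) _ _)]
  ext1
  have : -mask (blk W) (g : Matrix I I F) = mask (blk W) (-(g : Matrix I I F)) := by
    ext a b; simp only [mask_apply, Matrix.neg_apply]; split_ifs <;> simp
  rw [this, Units.val_mul, hmul]
  rfl

lemma subT_of_generators {W : Finset I} {χ : Fˣ →* ℂ} {v : V}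
    (h1 : ∀ a ∈ W, ∀ b, a ≠ b → ∀ t, ρ (E a b t) v = v)
    (h2 : ∀ a ∈ W, ∀ l, ρ (dg (Pi.mulSingle a l)) v = χ l • v) : SubT ρ W χ v := by
  intro g hg
  obtain ⟨h, e⟩ := eq_un_mul_emb hg
  have hE : ∀ a ∈ W, ∀ b, a ≠ b → ∀ t, E a b t ∈ charStab ρ χ v := by
    intro a ha b hab t
    rw [mem_charStab, h1 a ha b hab t, det_E hab, map_one, one_smul]
  suffices hm : g ∈ charStab ρ χ v from hm
  rw [e]
  refine Subgroup.mul_mem _ ?_ ?_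
  · refine un_mask_mem (sq0_blk W) _ (fun a b t hab => ?_) _
    obtain ⟨ha, hb⟩ := mem_blk.1 hab
    exact hE a ha b (fun e => hb (e ▸ ha)) t
  · refine emb_mem _ (fun a ha b _ hab t => hE a ha b hab t) (fun a ha l => ?_) h
    rw [mem_charStab, h2 a ha l, det_dg, Finset.prod_pi_mulSingle']
    simp

/-- Vectors fixed by all elementary matrices in the rows `W` contain a determinant eigenvector. -/
lemma exists_subT_of_fixed [FiniteDimensional ℂ V] {W : Finset I} (hW : W.Nonempty) {v : V}
    (hv : v ≠ 0) (h1 : ∀ a ∈ W, ∀ b, a ≠ b → ∀ t, ρ (E a b t) v = v) :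
    ∃ χ u, u ≠ 0 ∧ SubT ρ W χ u := by
  obtain ⟨a0, ha0⟩ := hW
  let S : Submodule ℂ V := ⨅ a ∈ W, ⨅ b, ⨅ (_ : a ≠ b), ⨅ t : F, LinearMap.ker (ρ (E a b t) - 1)
  have hS : ∀ u, u ∈ S ↔ ∀ a ∈ W, ∀ b, a ≠ b → ∀ t, ρ (E a b t) u = u := by
    intro u; simp [S, Submodule.mem_iInf, sub_eq_zero]
  obtain ⟨γ, hγ⟩ := IsCyclic.exists_generator (α := Fˣ)
  let d : Fˣ →* GL I F := dg.comp (MonoidHom.mulSingle (fun _ => Fˣ) a0)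
  have hd : ∀ l, d l = dg (Pi.mulSingle a0 l) := fun l => rfl
  have hdS : ∀ l, ∀ u ∈ S, ρ (d l) u ∈ S := by
    intro l u hu
    rw [hS] at hu ⊢
    intro a ha b hab t
    have e := dg_conj_E hab t (Pi.mulSingle a0 l)⁻¹
    rw [map_inv, inv_inv, ← hd] at e
    have : E a b t * d l = d l * ((d l)⁻¹ * E a b t * d l) := by group
    rw [← rho_mul_apply, this, rho_mul_apply, e, hu a ha b hab]
  have : Nontrivial S := ⟨⟨⟨v, (hS v).2 h1⟩, 0, fun e => hv (congrArg Subtype.val e)⟩⟩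
  obtain ⟨μ, hμ⟩ := Module.End.exists_eigenvalue ((ρ (d γ)).restrict (hdS γ))
  obtain ⟨u, hu⟩ := hμ.exists_hasEigenvector
  have hu0 : (u : V) ≠ 0 := fun e => hu.2 (Subtype.ext e)
  have huγ : ρ (d γ) (u : V) = μ • (u : V) := congrArg Subtype.val hu.apply_eq_smul
  have huS := (hS u).1 u.2
  have hex : ∀ l, ∃ c : ℂ, ρ (d l) (u : V) = c • (u : V) := by
    intro l
    obtain ⟨m, rfl⟩ := (mem_powers_iff_mem_zpowers (x := γ)).2 (hγ l)
    refine ⟨μ ^ m, ?_⟩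
    change ρ (d (γ ^ m)) (u : V) = _
    induction m with
    | zero => simp
    | succ m ih => rw [pow_succ γ, map_mul, rho_mul_apply, huγ, map_smul, ih, smul_smul, pow_succ']
  choose c hc using hex
  let χ : Fˣ →* ℂ :=
    { toFun := c
      map_one' := smul_left_injective ℂ hu0 (by simp only; rw [← hc]; simp)
      map_mul' := fun x y => smul_left_injective ℂ hu0 (by
        simp only
        rw [← hc, map_mul, rho_mul_apply, hc, map_smul, hc, smul_smul, mul_comm]) }
  refine ⟨χ, u, hu0, subT_of_generators huS fun a ha l => ?_⟩
  by_cases haa : a = a0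
  · subst haa; exact hc l
  · have e := weyl_conj_dg haa l
    have hw : ρ (E a a0 1 * E a0 a (-1) * E a a0 (1 : F)) (u : V) = u := by
      rw [rho_mul_apply, rho_mul_apply, huS a ha a0 haa, huS a0 ha0 a (Ne.symm haa),
        huS a ha a0 haa]
    have h2 := congrArg (fun g => ρ g (u : V)) e
    rw [rho_mul_apply, rho_mul_apply (dg _), hw, ← hd, hc, map_smul, hw] at h2
    exact h2.symm

end SubType

section LemmaA

variable {I F V : Type*} [Fintype I] [DecidableEq I] [Field F] [Fintype F]
  [AddCommGroup V] [Module ℂ V] {ρ : Representation ℂ (GL I F) V} {ψ : AddChar F ℂ}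

lemma Wt.union {P Q : Finset (I × I)} (hPQ : Sq0 (P ∪ Q)) {B : Matrix I I F} {v : V}
    (hP : Wt ρ ψ P B v) (hQ : Wt ρ ψ Q B v) : Wt ρ ψ (P ∪ Q) B v := fun x => by
  have e : mask (P ∪ Q) x = mask P x + mask (Q \ P) x := by
    ext a b
    simp only [mask_apply, Matrix.add_apply, Finset.mem_union, Finset.mem_sdiff]
    by_cases h1 : (a, b) ∈ P <;> by_cases h2 : (a, b) ∈ Q <;> simp [h1, h2]
  have s1 : P ⊆ P ∪ Q := Finset.subset_union_left
  have s2 : Q \ P ⊆ P ∪ Q := Finset.sdiff_subset.trans Finset.subset_union_right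
  have hz : ∀ {P' Q' : Finset (I × I)}, P' ⊆ P ∪ Q → Q' ⊆ P ∪ Q → mask P' x * mask Q' x = 0 := by
    intro P' Q' h1 h2
    rw [← mask_mask_of_subset h1, ← mask_mask_of_subset h2]
    exact mask_mul_mask hPQ _ _
  rw [e, un_add (hz s1 s1) (hz s2 s2) (hz s1 s2) (hz s2 s1), rho_mul_apply,
    (hQ.mono Finset.sdiff_subset) x, map_smul, hP x, smul_smul, ← AddChar.map_add_eq_mul,
    ← Matrix.trace_add, ← Matrix.mul_add, add_comm]

lemma single_support {a b : I} {P : Finset (I × I)} (hab : (a, b) ∈ P) (t : F) (a' b' : I)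
    (h : (a', b') ∉ P) : Matrix.single a b t a' b' = 0 := by
  rw [Matrix.single_apply, if_neg]
  rintro ⟨rfl, rfl⟩
  exact h hab

lemma Wt.E_apply {P : Finset (I × I)} {B : Matrix I I F} {v : V} (h : Wt ρ ψ P B v) {a b : I}
    (hab : (a, b) ∈ P) (t : F) : ρ (E a b t) v = ψ (B a b * t) • v := by
  have := h.apply (single_support hab t)
  rwa [trace_transpose_mul_single] at this

lemma hasRank_zero {v : V} (hv : v ≠ 0) : HasRank ρ ψ 0 := by
  refine ⟨Fin.elim0, Fin.elim0, fun i => i.elim0, fun i => i.elim0, fun i => i.elim0, v, hv, ?_⟩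
  intro x
  have : mask (blk (Finset.univ.image (Fin.elim0 : Fin 0 → I))ᶜ) x = 0 := by
    ext a b; simp [mask_apply, mem_blk]
  rw [this, un_zero]
  simp

lemma blockDiag_E {R : Finset I} {a b : I} (ha : a ∈ R) (hb : b ∈ R) (hab : a ≠ b) (t : F) :
    BlockDiag R (E a b t : Matrix I I F) := by
  intro i j h
  rw [coe_E hab, Matrix.add_apply, Matrix.single_apply] at h
  by_cases hij : i = j
  · rw [hij]
  · rw [Matrix.one_apply_ne hij, zero_add] at h
    have h' : a = i ∧ b = j := by by_contra hne; exact h (if_neg hne)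
    obtain ⟨rfl, rfl⟩ := h'
    simp [ha, hb]

/-- If row `a` and column `b` of `B` vanish, the elementary matrix `1 + t e_{ab}` preserves weight
vectors. -/
lemma Wt.E_stable {R : Finset I} {B : Matrix I I F} {v : V} (h : Wt ρ ψ (blk R) B v) {a b : I}
    (ha : a ∈ R) (hb : b ∈ R) (hab : a ≠ b) (hrow : ∀ c, B a c = 0) (hcol : ∀ c, B c b = 0)
    (t : F) : Wt ρ ψ (blk R) B (ρ (E a b t) v) := by
  have := h.conj (blockDiag_E ha hb hab t)
  rw [E_inv hab, coe_E hab, coe_E hab, Matrix.transpose_add, Matrix.transpose_add,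
    Matrix.transpose_one, Matrix.transpose_single, Matrix.transpose_single, add_mul, Matrix.one_mul,
    mul_add, Matrix.mul_one] at this
  have e1 : Matrix.single b a (-t) * B = 0 := by
    ext i j
    rw [Matrix.mul_apply]
    refine Finset.sum_eq_zero fun c _ => ?_
    rw [Matrix.single_apply]
    split_ifs with h
    · rw [← h.2, hrow, mul_zero]
    · rw [zero_mul]
  have e2 : B * Matrix.single b a t = 0 := by
    ext i j
    rw [Matrix.mul_apply]
    refine Finset.sum_eq_zero fun c _ => ?_
    rw [Matrix.single_apply]
    split_ifs with h
    · rw [← h.1, hcol, zero_mul]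
    · rw [mul_zero]
  rwa [e1, add_zero, e2, add_zero] at this

lemma matching_row_eq_zero {r : ℕ} {X Y : Fin r → I} {a : I} (ha : ∀ i, X i ≠ a) (c : I) :
    (matching X Y : Matrix I I F) a c = 0 := by
  rw [matching, Matrix.sum_apply]
  exact Finset.sum_eq_zero fun i _ => by
    rw [Matrix.single_apply, if_neg fun h => ha i h.1]

lemma matching_col_eq_zero {r : ℕ} {X Y : Fin r → I} {b : I} (hb : ∀ i, Y i ≠ b) (c : I) :
    (matching X Y : Matrix I I F) c b = 0 := by
  rw [matching, Matrix.sum_apply]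
  exact Finset.sum_eq_zero fun i _ => by
    rw [Matrix.single_apply, if_neg fun h => hb i h.2]

/-- A weight vector of a matching on which a further elementary matrix acts nontrivially gives a
larger rank. -/
lemma hasRank_succ_of_ne (hψ : ψ ≠ 1) {r : ℕ} {X Y : Fin r → I} (hX : Function.Injective X)
    (hY : Function.Injective Y) (hXY : ∀ i j, X i ≠ Y j) {v : V}
    (hv : Wt ρ ψ (blk (Finset.univ.image Y)ᶜ) (matching X Y) v) {a b : I} (hab : a ≠ b)
    (haX : ∀ i, X i ≠ a) (haY : ∀ i, Y i ≠ a) (hbX : ∀ i, X i ≠ b) (hbY : ∀ i, Y i ≠ b) (t : F)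
    (hne : ρ (E a b t) v ≠ v) : HasRank ρ ψ (r + 1) := by
  set R : Finset I := (Finset.univ.image Y)ᶜ with hR
  have memR : ∀ c, c ∈ R ↔ ∀ i, Y i ≠ c := fun c => by simp [hR]
  have hP1 : Sq0 ({(a, b)} : Finset (I × I)) := by
    intro i j k h1 h2
    simp only [Finset.mem_singleton, Prod.mk.injEq] at h1 h2
    exact hab (h2.1.symm.trans h1.2)
  obtain ⟨D, hD0, hu0⟩ : ∃ D : Matrix I I F, D a b ≠ 0 ∧ proj ψ (uChar ρ _ hP1) D v ≠ 0 := by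
    by_contra! hcon
    apply hne
    have hsum := congrArg (fun T : Module.End ℂ V => T v) (sum_proj (uChar ρ _ hP1) hψ)
    simp only [LinearMap.sum_apply, Module.End.one_apply] at hsum
    have : ∀ D : Matrix I I F, ρ (E a b t) (proj ψ (uChar ρ _ hP1) D v) =
        proj ψ (uChar ρ _ hP1) D v := by
      intro D
      by_cases hD : D a b = 0
      · rw [(wt_proj hP1 D v).E_apply (by simp), hD]; simp
      · rw [hcon D hD, map_zero]
    rw [← hsum, map_sum]
    exact Finset.sum_congr rfl fun D _ => this D
  set u := proj ψ (uChar ρ _ hP1) D v with hu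
  have huR : Wt ρ ψ (blk R) (matching X Y) u := by
    let S : Submodule ℂ V := ⨅ x, LinearMap.ker (ρ (un (mask (blk R) x)) -
      ψ ((matching X Y)ᵀ * mask (blk R) x).trace • (1 : Module.End ℂ V))
    have hS : ∀ w, w ∈ S ↔ Wt ρ ψ (blk R) (matching X Y) w := by
      intro w; simp [S, Submodule.mem_iInf, sub_eq_zero, Wt]
    rw [← hS]
    refine proj_mem _ (fun x w hw => ?_) D ((hS v).2 hv)
    rw [hS] at hw ⊢
    have : mask {(a, b)} x = Matrix.single a b (x a b) := by
      ext i j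
      simp only [mask_apply, Finset.mem_singleton, Prod.mk.injEq, Matrix.single_apply]
      by_cases h : i = a ∧ j = b
      · obtain ⟨rfl, rfl⟩ := h; simp
      · rw [if_neg h, if_neg fun h' => h ⟨h'.1.symm, h'.2.symm⟩]
    rw [uChar_apply, this]
    exact hw.E_stable ((memR a).2 haY) ((memR b).2 hbY) hab (matching_row_eq_zero haX)
      (matching_col_eq_zero hbY) _
  set R2 : Finset I := R.erase b with hR2
  set B3 : Matrix I I F := Matrix.of fun i j => if (i, j) = (a, b) then D a b else
    matching X Y i j with hB3
  have s1 : R2 ×ˢ Finset.univ.image Y ⊆ blk R := by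
    rintro ⟨i, j⟩ h
    obtain ⟨h1, h2⟩ := Finset.mem_product.1 h
    exact mem_blk.2 ⟨Finset.mem_of_mem_erase h1, by simpa [hR] using h2⟩
  have s2 : R2 ×ˢ Finset.univ.image Y ∪ {(a, b)} ⊆ blk R2 := by
    rintro ⟨i, j⟩ h
    rcases Finset.mem_union.1 h with h | h
    · obtain ⟨h1, h2⟩ := Finset.mem_product.1 h
      exact mem_blk.2 ⟨h1, fun h3 => by
        have := Finset.mem_of_mem_erase h3
        simp [hR] at this h2
        obtain ⟨y, hy⟩ := h2
        exact this y hy⟩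
    · simp only [Finset.mem_singleton, Prod.mk.injEq] at h
      obtain ⟨rfl, rfl⟩ := h
      exact mem_blk.2 ⟨Finset.mem_erase.2 ⟨hab, (memR _).2 haY⟩, by simp [hR2]⟩
  have w1 : Wt ρ ψ (R2 ×ˢ Finset.univ.image Y) B3 u := (huR.mono s1).congr fun i j hij => by
    have : (i, j) ≠ (a, b) := by
      rintro h
      obtain ⟨rfl, rfl⟩ := Prod.mk.inj h
      have := (Finset.mem_product.1 hij).2
      simp at this
      obtain ⟨y, hy⟩ := this
      exact hbY y hy
    simp only [hB3, Matrix.of_apply, if_neg this]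
  have w2 : Wt ρ ψ {(a, b)} B3 u := (wt_proj hP1 D v).congr fun i j hij => by
    rw [Finset.mem_singleton] at hij
    simp only [hB3, Matrix.of_apply, if_pos hij]
    obtain ⟨rfl, rfl⟩ := Prod.mk.inj hij; rfl
  have w3 := Wt.union ((sq0_blk R2).mono s2) w1 w2
  obtain ⟨B4, v4, hv4, hw4, hB4⟩ := w3.exists_extension hψ (sq0_blk R2) s2 hu0
  refine hw4.hasRank hψ hv4 (X := Fin.cons a X) (Y := Fin.cons b Y) ?_ ?_ ?_
  · refine Fin.cases ?_ fun i => ?_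
    · exact Finset.mem_erase.2 ⟨hab, (memR a).2 haY⟩
    · exact Finset.mem_erase.2 ⟨hbX i, (memR _).2 fun j => (hXY i j).symm⟩
  · refine Fin.cases ?_ fun i => ?_
    · simp [hR2]
    · simp [hR2, hR]
  · have e1 : B4 a b = D a b := by
      rw [hB4 a b (by simp)]; simp [hB3]
    have e2 : ∀ i j, i ∈ R2 → B4 i (Y j) = if i = X j then 1 else 0 := by
      intro i j hi
      rw [hB4 i (Y j) (by simp [hi]), hB3, Matrix.of_apply, if_neg, matching_apply hY]
      intro h
      exact hbY j (Prod.mk.inj h).2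
    have haR2 : a ∈ R2 := Finset.mem_erase.2 ⟨hab, (memR a).2 haY⟩
    have hXR2 : ∀ i, X i ∈ R2 := fun i =>
      Finset.mem_erase.2 ⟨hbX i, (memR _).2 fun j => (hXY i j).symm⟩
    rw [Matrix.det_succ_row_zero, Finset.sum_eq_single 0]
    · have : (B4.submatrix (Fin.cons a X) (Fin.cons b Y)).submatrix Fin.succ
          (Fin.succAbove 0) = (1 : Matrix (Fin r) (Fin r) F) := by
        ext i j
        simp only [Matrix.submatrix_apply, Fin.cons_succ, Fin.zero_succAbove]
        rw [e2 _ _ (hXR2 i), Matrix.one_apply]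
        simp [hX.eq_iff]
      rw [this]
      simpa [e1] using hD0
    · intro j _ hj
      obtain ⟨j', rfl⟩ := Fin.exists_succ_eq.2 hj
      have : B4 a (Y j') = 0 := by
        rw [e2 _ _ haR2, if_neg]; exact fun h => haX j' h.symm
      simp [this]
    · simp

/-- A representation of small rank has a vector fixed, up to a character of the determinant, by
all matrices supported in a large set of rows. -/
theorem exists_subT_of_not_hasRank [FiniteDimensional ℂ V] [Nontrivial V] (hψ : ψ ≠ 1) {k : ℕ}
    (hk : ¬ HasRank ρ ψ (k + 1)) (hcard : 2 * k + 2 ≤ Fintype.card I) :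
    ∃ (W : Finset I) (χ : Fˣ →* ℂ) (v : V), Fintype.card I - 2 * k ≤ W.card ∧ v ≠ 0 ∧
      SubT ρ W χ v := by
  obtain ⟨v0, hv0⟩ := exists_ne (0 : V)
  have hex : ∃ r, ¬ HasRank ρ ψ (r + 1) := ⟨k, hk⟩
  set r := Nat.find hex with hr
  have hr1 : ¬ HasRank ρ ψ (r + 1) := Nat.find_spec hex
  have hrk : r ≤ k := Nat.find_min' hex hk
  have hr0 : HasRank ρ ψ r := by
    rcases Nat.eq_zero_or_eq_succ_pred r with h | h
    · rw [h]; exact hasRank_zero hv0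
    · have := Nat.find_min hex (m := r.pred) (by rw [← hr]; omega)
      rw [not_not] at this
      rw [h]; exact this
  obtain ⟨X, Y, hX, hY, hXY, v, hv, hw⟩ := hr0
  set W : Finset I := (Finset.univ.image X ∪ Finset.univ.image Y)ᶜ with hWdef
  have memW : ∀ a, a ∈ W → (∀ i, X i ≠ a) ∧ ∀ i, Y i ≠ a := by
    intro a ha
    simp only [hWdef, Finset.mem_compl, Finset.mem_union, Finset.mem_image, Finset.mem_univ,
      true_and, not_or, not_exists] at ha
    exact ha
  have hWcard : Fintype.card I - 2 * r ≤ W.card := by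
    rw [hWdef, Finset.card_compl]
    have h1 := Finset.card_union_le (Finset.univ.image X) (Finset.univ.image Y)
    have h2 := Finset.card_image_le (s := Finset.univ) (f := X)
    have h3 := Finset.card_image_le (s := Finset.univ) (f := Y)
    rw [Finset.card_univ, Fintype.card_fin] at h2 h3
    omega
  have hW2 : 1 < W.card := by omega
  have memR : ∀ c, c ∈ (Finset.univ.image Y)ᶜ ↔ ∀ i, Y i ≠ c := fun c => by simp
  have claim1 : ∀ a ∈ W, ∀ b ∈ W, a ≠ b → ∀ t u,
      Wt ρ ψ (blk (Finset.univ.image Y)ᶜ) (matching X Y) u → ρ (E a b t) u = u := by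
    intro a ha b hb hab t u hu
    by_contra hne
    exact hr1 (hasRank_succ_of_ne hψ hX hY hXY hu hab (memW a ha).1 (memW a ha).2 (memW b hb).1
      (memW b hb).2 t hne)
  have claim : ∀ a ∈ W, ∀ b, a ≠ b → ∀ t, ρ (E a b t) v = v := by
    intro a ha c hac t
    by_cases hcY : ∃ j, Y j = c
    · obtain ⟨j, rfl⟩ := hcY
      rw [hw.E_apply (mem_blk.2 ⟨(memR a).2 (memW a ha).2, by simp⟩), matching_row_eq_zero
        (memW a ha).1]
      simp
    · by_cases hcX : ∃ i, X i = c
      · obtain ⟨i, rfl⟩ := hcX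
        obtain ⟨b, hb, hba⟩ := Finset.exists_mem_ne hW2 a
        have hbx : b ≠ X i := fun e => (memW b hb).1 i e.symm
        have hst : ∀ s, Wt ρ ψ (blk (Finset.univ.image Y)ᶜ) (matching X Y)
            (ρ (E b (X i) s) v) := fun s =>
          hw.E_stable ((memR b).2 (memW b hb).2) ((memR _).2 fun j => (hXY i j).symm) hbx
            (matching_row_eq_zero (memW b hb).1) (matching_col_eq_zero fun j => (hXY i j).symm) s
        rw [← E_commutator hba.symm hbx hac t, rho_mul_apply, rho_mul_apply, rho_mul_apply,
          claim1 a ha b hb hba.symm (-1) _ (hst (-t)), ← E_inv hbx, rho_apply_inv,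
          claim1 a ha b hb hba.symm 1 _ hw]
      · refine claim1 a ha c ?_ hac t v hw
        simp only [hWdef, Finset.mem_compl, Finset.mem_union, Finset.mem_image, Finset.mem_univ,
          true_and, not_or]
        exact ⟨hcX, hcY⟩
  obtain ⟨χ, u, hu, hu'⟩ := exists_subT_of_fixed (Finset.card_pos.1 (by omega)) hv claim
  exact ⟨W, χ, u, by omega, hu, hu'⟩

end LemmaA

section RowGroup

variable {I F : Type*} [Fintype I] [DecidableEq I] [Field F] [Fintype F]

/-- The group of matrices that agree with the identity in all rows outside `T`. -/
def rowGroup (T : Finset I) : Subgroup (GL I F) where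
  carrier := {g | ∀ a ∉ T, ∀ b, (g : Matrix I I F) a b = (1 : Matrix I I F) a b}
  one_mem' _ _ _ := rfl
  mul_mem' {g h} hg hh a ha b := by
    rw [Units.val_mul, Matrix.mul_apply, ← hh a ha b]
    simp only [hg a ha]
    rw [← Matrix.mul_apply, Matrix.one_mul]
  inv_mem' {g} hg a ha b := by
    have h : ((g : Matrix I I F) * (↑g⁻¹ : Matrix I I F)) a b = (1 : Matrix I I F) a b := by
      rw [← Units.val_mul]; simp
    rw [Matrix.mul_apply] at h
    simp only [hg a ha] at h
    rwa [← Matrix.mul_apply, Matrix.one_mul] at h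

lemma rowGroup_mono {T T' : Finset I} (h : T ⊆ T') : rowGroup (F := F) T ≤ rowGroup T' :=
  fun _ hg a ha b => hg a (fun h' => ha (h h')) b

lemma E_mem_rowGroup {T : Finset I} {a b : I} (hab : a ≠ b) (ha : a ∈ T) (t : F) :
    E a b t ∈ rowGroup T := fun c hc d => by
  rw [coe_E hab, Matrix.add_apply, Matrix.single_apply, if_neg, add_zero]
  rintro ⟨rfl, -⟩; exact hc ha

/-- The identity matrix with row `b` replaced by `z`, as an invertible matrix. -/
lemma exists_row {b : I} {z : I → F} (hz : z b ≠ 0) : ∃ s : GL I F,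
    (s : Matrix I I F) = (1 : Matrix I I F).updateRow b z := by
  refine ⟨Matrix.GeneralLinearGroup.mkOfDetNeZero ((1 : Matrix I I F).updateRow b z) ?_, rfl⟩
  have h := Matrix.det_updateRow_sum (1 : Matrix I I F) b z
  have e : (∑ k, z k • (1 : Matrix I I F) k) = z := by
    ext j
    simp [Finset.sum_apply, Matrix.one_apply]
  rw [e, Matrix.det_one, smul_eq_mul, mul_one] at h
  rw [h]; exact hz

lemma exists_rowGroup_mul_E_mul {W : Finset I} {l b : I} (hl : l ∉ W) (hb : b ∈ W) {g : GL I F}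
    (hg : g ∈ rowGroup (insert l W)) (hgb : (g : Matrix I I F) l b ≠ 0) :
    ∃ s₁ ∈ rowGroup W, ∃ s₂ ∈ rowGroup W, g = s₁ * E l b 1 * s₂ := by
  have hlb : l ≠ b := fun h => hl (h ▸ hb)
  obtain ⟨s, hs⟩ := exists_row (b := b)
    (z := fun c => (g : Matrix I I F) l c - (1 : Matrix I I F) l c)
    (by simpa [Matrix.one_apply, hlb] using hgb)
  have hsW : s ∈ rowGroup W := fun a ha c => by
    rw [hs, Matrix.updateRow_ne]
    rintro rfl; exact ha hb
  have hrow : ∀ c, ((E l b 1 * s : GL I F) : Matrix I I F) l c = (g : Matrix I I F) l c := fun c => by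
    rw [Units.val_mul, coe_E hlb, add_mul, one_mul, Matrix.add_apply, Matrix.single_mul_apply_same,
      hs, Matrix.updateRow_self, Matrix.updateRow_ne hlb]
    ring
  refine ⟨g * (E l b 1 * s)⁻¹, ?_, s, hsW, by group⟩
  have h1 : g * (E l b 1 * s)⁻¹ ∈ rowGroup (insert l W) :=
    mul_mem hg (inv_mem (mul_mem (E_mem_rowGroup hlb (Finset.mem_insert_self l W) 1)
      (rowGroup_mono (Finset.subset_insert l W) hsW)))
  intro a ha c
  by_cases hal : a = l
  · subst hal
    rw [Units.val_mul, Matrix.mul_apply]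
    simp only [← hrow]
    rw [← Matrix.mul_apply, ← Units.val_mul, mul_inv_cancel, Units.val_one]
  · exact h1 a (by simp [hal, ha]) c

end RowGroup

section Unitary

variable {I F V : Type*} [Fintype I] [DecidableEq I] [Field F] [Fintype F]
  [NormedAddCommGroup V] [InnerProductSpace ℂ V] {ρ : Representation ℂ (GL I F) V}

lemma norm_chi (χ : Fˣ →* ℂ) (x : Fˣ) : ‖χ x‖ = 1 := by
  refine (pow_eq_one_iff_of_nonneg (norm_nonneg _) (Fintype.card_ne_zero (α := Fˣ))).1 ?_
  rw [← norm_pow, ← map_pow, pow_card_eq_one, map_one, norm_one]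

lemma chi_inv (χ : Fˣ →* ℂ) (x : Fˣ) : χ x⁻¹ = (χ x)⁻¹ := by
  refine eq_inv_of_mul_eq_one_left ?_
  rw [← map_mul, inv_mul_cancel, map_one]

lemma conj_chi (χ : Fˣ →* ℂ) (x : Fˣ) : (starRingEnd ℂ) (χ x) = (χ x)⁻¹ := by
  rw [Complex.inv_def, Complex.normSq_eq_norm_sq, norm_chi]; simp

lemma inner_rho_left (hρ : ∀ g u v, inner ℂ (ρ g u) (ρ g v) = inner ℂ u v) (g : GL I F) (u v : V) :
    inner ℂ (ρ g u) v = inner ℂ u (ρ g⁻¹ v) := by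
  rw [← hρ g u (ρ g⁻¹ v), rho_apply_inv]

/-- The matrix coefficient of `t`, twisted by `χ`. -/
noncomputable def coeff (ρ : Representation ℂ (GL I F) V) (χ : Fˣ →* ℂ) (t : V) (g : GL I F) : ℂ :=
  (χ (Matrix.GeneralLinearGroup.det g))⁻¹ * inner ℂ t (ρ g t)

lemma norm_coeff_le (hρ : ∀ g u v, inner ℂ (ρ g u) (ρ g v) = inner ℂ u v) (χ : Fˣ →* ℂ) (t : V)
    (g : GL I F) : ‖coeff ρ χ t g‖ ≤ ‖t‖ ^ 2 := by
  rw [coeff, norm_mul, norm_inv, norm_chi, inv_one, one_mul, sq]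
  refine (norm_inner_le_norm _ _).trans_eq ?_
  congr 1
  rw [@norm_eq_sqrt_re_inner ℂ, hρ, ← @norm_eq_sqrt_re_inner ℂ]

variable {W : Finset I} {χ : Fˣ →* ℂ} {t : V}

lemma coeff_mul_mul (hρ : ∀ g u v, inner ℂ (ρ g u) (ρ g v) = inner ℂ u v) (ht : SubT ρ W χ t)
    {s₁ s₂ : GL I F} (h₁ : s₁ ∈ rowGroup W) (h₂ : s₂ ∈ rowGroup W) (g : GL I F) :
    coeff ρ χ t (s₁ * g * s₂) = coeff ρ χ t g := by
  have e : inner ℂ t (ρ (s₁ * g * s₂) t) = χ (Matrix.GeneralLinearGroup.det s₂) *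
      (χ (Matrix.GeneralLinearGroup.det s₁) * inner ℂ t (ρ g t)) := by
    rw [rho_mul_apply, rho_mul_apply, ht s₂ h₂, map_smul, map_smul, inner_smul_right]
    congr 1
    have := inner_rho_left hρ s₁⁻¹ t (ρ g t)
    rw [inv_inv, ht s₁⁻¹ (inv_mem h₁), inner_smul_left, map_inv, conj_chi, chi_inv, inv_inv] at this
    exact this.symm
  rw [coeff, coeff, e, map_mul, map_mul, map_mul, map_mul]
  have h1 := chi_ne_zero χ (Matrix.GeneralLinearGroup.det s₁)
  have h2 := chi_ne_zero χ (Matrix.GeneralLinearGroup.det s₂)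
  have h3 := chi_ne_zero χ (Matrix.GeneralLinearGroup.det g)
  field_simp

lemma sum_coeff_eq_zero {l : I} (hmax : ∀ u : V, SubT ρ (insert l W) χ u → u = 0) :
    ∑ g : rowGroup (F := F) (insert l W), coeff ρ χ t g = 0 := by
  have h : SubT ρ (insert l W) χ (∑ g : rowGroup (F := F) (insert l W),
      (χ (Matrix.GeneralLinearGroup.det (g : GL I F)))⁻¹ • ρ g t) := fun h hh => by
    rw [map_sum, Finset.smul_sum]
    refine Fintype.sum_equiv (Equiv.mulLeft (⟨h, hh⟩ : rowGroup (F := F) (insert l W))) _ _ fun g => ?_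
    have h1 := chi_ne_zero χ (Matrix.GeneralLinearGroup.det h)
    rw [map_smul, ← rho_mul_apply, smul_smul]
    simp only [Equiv.coe_mulLeft, Subgroup.coe_mul, map_mul]
    congr 1
    rw [mul_inv, mul_inv_cancel_left₀ h1]
  have := congrArg (inner ℂ t) (hmax _ h)
  rw [inner_zero_right, inner_sum] at this
  simpa only [inner_smul_right, coeff] using this

lemma coeff_eq_coeff_E (hρ : ∀ g u v, inner ℂ (ρ g u) (ρ g v) = inner ℂ u v)
    (ht : SubT ρ W χ t) {l b : I} (hl : l ∉ W) (hb : b ∈ W) {g : GL I F}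
    (hg : g ∈ rowGroup (insert l W)) (hgb : (g : Matrix I I F) l b ≠ 0) :
    coeff ρ χ t g = coeff ρ χ t (E l b 1) := by
  obtain ⟨s₁, h₁, s₂, h₂, e⟩ := exists_rowGroup_mul_E_mul hl hb hg hgb
  rw [e, coeff_mul_mul hρ ht h₁ h₂]

lemma coeff_E_eq (hρ : ∀ g u v, inner ℂ (ρ g u) (ρ g v) = inner ℂ u v)
    (ht : SubT ρ W χ t) {l b c : I} (hl : l ∉ W) (hb : b ∈ W) (hc : c ∈ W) :
    coeff ρ χ t (E l b 1) = coeff ρ χ t (E l c 1) := by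
  have hlb : l ≠ b := fun h => hl (h ▸ hb)
  have hlc : l ≠ c := fun h => hl (h ▸ hc)
  by_cases hbc : b = c
  · rw [hbc]
  have hg : E l b 1 * E l c (1 : F) ∈ rowGroup (insert l W) :=
    mul_mem (E_mem_rowGroup hlb (Finset.mem_insert_self l W) 1)
      (E_mem_rowGroup hlc (Finset.mem_insert_self l W) 1)
  have e : ((E l b 1 * E l c (1 : F) : GL I F) : Matrix I I F) =
      1 + Matrix.single l b 1 + Matrix.single l c 1 := by
    rw [Units.val_mul, coe_E hlb, coe_E hlc, mul_add, mul_one, add_mul, one_mul,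
      Matrix.single_mul_single_of_ne _ _ _ _ (Ne.symm hlb), add_zero]
  rw [← coeff_eq_coeff_E hρ ht hl hb hg, ← coeff_eq_coeff_E hρ ht hl hc hg]
  · rw [e]; simp [hlc, hbc]
  · rw [e]; simp [hlb, Ne.symm hbc]

/-- The matrix whose row `l` is `y` on `W` and whose other entries vanish. -/
def rowMat (l : I) (W : Finset I) (y : W → F) : Matrix I I F :=
  Matrix.of fun a b => if h : a = l ∧ b ∈ W then y ⟨b, h.2⟩ else 0

lemma rowMat_mul_self {l : I} (hl : l ∉ W) (y : W → F) : rowMat l W y * rowMat l W y = 0 := by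
  ext a b
  rw [Matrix.mul_apply]
  refine Finset.sum_eq_zero fun c _ => ?_
  by_cases hc : c = l
  · subst hc; simp [rowMat, hl]
  · simp [rowMat, hc]

lemma un_rowMat_mem {l : I} (hl : l ∉ W) (y : W → F) :
    un (rowMat l W y) ∈ rowGroup (insert l W) := fun a ha b => by
  rw [coe_un (rowMat_mul_self hl y), Matrix.add_apply]
  have : a ≠ l := by rintro rfl; exact ha (Finset.mem_insert_self _ _)
  simp [rowMat, this]

/-- The elements of the row group of `insert l W` whose row `l` vanishes on `W`. -/
noncomputable def zeroRow (F : Type*) [Field F] [Fintype F] (l : I) (W : Finset I) :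
    Finset (rowGroup (F := F) (insert l W)) :=
  Finset.univ.filter fun g => ∀ b ∈ W, (g.1 : Matrix I I F) l b = 0

lemma zeroRow_apply_ne_zero {l : I} {g : rowGroup (F := F) (insert l W)}
    (hg : g ∈ zeroRow F l W) : (g.1 : Matrix I I F) l l ≠ 0 := fun h0 => by
  have hg' : ∀ b ∈ W, (g.1 : Matrix I I F) l b = 0 := by simpa [zeroRow] using hg
  set z : I → F := fun b => (1 : Matrix I I F) l b - (g.1 : Matrix I I F) l b with hz
  have hz1 : z ᵥ* (g.1 : Matrix I I F) = 0 := by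
    have hgl : (1 : Matrix I I F) l ᵥ* (g.1 : Matrix I I F) = (g.1 : Matrix I I F) l := by
      ext b; simp [Matrix.vecMul, dotProduct, Matrix.one_apply]
    have h2 : (g.1 : Matrix I I F) l ᵥ* (g.1 : Matrix I I F) = (g.1 : Matrix I I F) l := by
      ext b
      simp only [Matrix.vecMul, dotProduct]
      have : ∀ a, (g.1 : Matrix I I F) l a * (g.1 : Matrix I I F) a b =
          (g.1 : Matrix I I F) l a * (1 : Matrix I I F) a b := fun a => by
        by_cases ha : a ∈ insert l W
        · rcases Finset.mem_insert.1 ha with rfl | ha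
          · rw [h0, zero_mul, zero_mul]
          · rw [hg' a ha, zero_mul, zero_mul]
        · rw [g.2 a ha b]
      simp only [this]
      rw [← Matrix.mul_apply, Matrix.mul_one]
    have : z = (1 : Matrix I I F) l - (g.1 : Matrix I I F) l := rfl
    rw [this, Matrix.sub_vecMul, hgl, h2, sub_self]
  have hz0 : z = 0 := by
    have h3 := congrArg (fun v => v ᵥ* (↑(g : GL I F)⁻¹ : Matrix I I F)) hz1
    simp only [Matrix.vecMul_vecMul, Matrix.zero_vecMul] at h3
    rwa [← Units.val_mul, mul_inv_cancel, Units.val_one, Matrix.vecMul_one] at h3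
  have := congrFun hz0 l
  simp [hz, h0] at this

lemma card_zeroRow_mul_le {l : I} (hl : l ∉ W) :
    (zeroRow F l W).card * Fintype.card F ^ W.card ≤
      Fintype.card (rowGroup (F := F) (insert l W)) := by
  have hc : Fintype.card F ^ W.card = (Finset.univ : Finset (W → F)).card := by simp
  rw [hc, ← Finset.card_product, ← Finset.card_univ]
  refine Finset.card_le_card_of_injOn
    (fun p => p.1 * ⟨un (rowMat l W p.2), un_rowMat_mem hl p.2⟩) (fun _ _ => by simp) ?_
  rintro ⟨g, y⟩ h ⟨g', y'⟩ h' e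
  have hg : g ∈ zeroRow F l W := by simpa using h
  have hg' : g' ∈ zeroRow F l W := by simpa using h'
  simp only at e
  have hrow : ∀ (g : rowGroup (F := F) (insert l W)) (y : W → F) (b : I),
      ((g * ⟨un (rowMat l W y), un_rowMat_mem hl y⟩ : rowGroup (F := F) (insert l W)).1 :
        Matrix I I F) l b = (g.1 : Matrix I I F) l b +
          if h : b ∈ W then (g.1 : Matrix I I F) l l * y ⟨b, h⟩ else 0 := fun g y b => by
    rw [Subgroup.coe_mul, Units.val_mul, coe_un (rowMat_mul_self hl y), mul_add, mul_one,
      Matrix.add_apply, Matrix.mul_apply, Finset.sum_eq_single l]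
    · simp only [rowMat, Matrix.of_apply, true_and]
      split_ifs <;> simp
    · intro c _ hc; simp [rowMat, hc]
    · simp
  have hl1 := hrow g y l
  rw [e, hrow g' y' l, dif_neg hl, dif_neg hl, add_zero, add_zero] at hl1
  have hy : y = y' := by
    ext ⟨b, hb⟩
    have hb1 := hrow g y b
    rw [e, hrow g' y' b, dif_pos hb, dif_pos hb, hl1,
      show (g.1 : Matrix I I F) l b = 0 by simpa [zeroRow] using (Finset.mem_filter.1 hg).2 b hb,
      show (g'.1 : Matrix I I F) l b = 0 by simpa [zeroRow] using (Finset.mem_filter.1 hg').2 b hb,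
      zero_add, zero_add] at hb1
    exact (mul_left_cancel₀ (zeroRow_apply_ne_zero hg) hb1).symm
  subst hy
  rw [mul_right_cancel e]

lemma norm_coeff_E_mul_le (hρ : ∀ g u v, inner ℂ (ρ g u) (ρ g v) = inner ℂ u v)
    (ht : SubT ρ W χ t) {l b : I} (hl : l ∉ W) (hb : b ∈ W)
    (hmax : ∀ u : V, SubT ρ (insert l W) χ u → u = 0) :
    ‖coeff ρ χ t (E l b 1)‖ * ((Fintype.card F : ℝ) ^ W.card - 1) ≤ ‖t‖ ^ 2 := by
  set κ := coeff ρ χ t (E l b 1) with hκ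
  have h0 := sum_coeff_eq_zero (t := t) hmax
  rw [← Finset.sum_add_sum_compl (zeroRow F l W)] at h0
  have h1 : ∑ g ∈ (zeroRow F l W)ᶜ, coeff ρ χ t g = ((zeroRow F l W)ᶜ.card : ℂ) * κ := by
    rw [← nsmul_eq_mul, ← Finset.sum_const]
    refine Finset.sum_congr rfl fun g hg => ?_
    have : ∃ c ∈ W, (g.1 : Matrix I I F) l c ≠ 0 := by simpa [zeroRow] using hg
    obtain ⟨c, hc, hgc⟩ := this
    rw [coeff_eq_coeff_E hρ ht hl hc g.2 hgc, hκ, coeff_E_eq hρ ht hl hc hb]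
  have h2 : ‖∑ g ∈ zeroRow F l W, coeff ρ χ t g‖ ≤ (zeroRow F l W).card * ‖t‖ ^ 2 := by
    refine (norm_sum_le _ _).trans ?_
    rw [← nsmul_eq_mul]
    exact Finset.sum_le_card_nsmul _ _ _ fun g _ => norm_coeff_le hρ χ t g
  have h3 : ((zeroRow F l W)ᶜ.card : ℝ) * ‖κ‖ ≤ (zeroRow F l W).card * ‖t‖ ^ 2 := by
    have h4 := congrArg norm (eq_neg_of_add_eq_zero_left h0)
    rw [norm_neg, h1, norm_mul, Complex.norm_natCast] at h4
    rwa [← h4]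
  have hpos : 0 < (zeroRow F l W).card := Finset.card_pos.2 ⟨1, by
    simp only [zeroRow, Finset.mem_filter, Finset.mem_univ, true_and]
    rintro c hc
    have : l ≠ c := fun h => hl (h ▸ hc)
    simp [this]⟩
  have hcard : ((zeroRow F l W).card : ℝ) * ((Fintype.card F : ℝ) ^ W.card - 1) ≤
      (zeroRow F l W)ᶜ.card := by
    have h5 : ((zeroRow F l W).card : ℝ) * (Fintype.card F : ℝ) ^ W.card ≤
        Fintype.card (rowGroup (F := F) (insert l W)) := by
      exact_mod_cast card_zeroRow_mul_le (F := F) hl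
    have h6 : ((zeroRow F l W).card : ℝ) + ((zeroRow F l W)ᶜ.card : ℝ) =
        Fintype.card (rowGroup (F := F) (insert l W)) := by
      exact_mod_cast Finset.card_add_card_compl (zeroRow F l W)
    linarith
  have hpos' : (0 : ℝ) < (zeroRow F l W).card := by exact_mod_cast hpos
  refine le_of_mul_le_mul_left ?_ hpos'
  calc _ = ((zeroRow F l W).card * ((Fintype.card F : ℝ) ^ W.card - 1)) * ‖κ‖ := by ring
    _ ≤ ((zeroRow F l W)ᶜ.card : ℝ) * ‖κ‖ := by gcongr
    _ ≤ _ := h3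

end Unitary

section Parabolic

variable {I F : Type*} [Fintype I] [DecidableEq I] [Field F] [Fintype F]

/-- The matrices whose entries with row outside `W` and column in `W` vanish. -/
def par (W : Finset I) : Subgroup (GL I F) where
  carrier := {g | ∀ a ∉ W, ∀ b ∈ W, (g : Matrix I I F) a b = 0}
  one_mem' a ha b hb := by
    rw [Units.val_one, Matrix.one_apply_ne]
    rintro rfl; exact ha hb
  mul_mem' {g h} hg hh a ha b hb := by
    rw [Units.val_mul, Matrix.mul_apply]
    refine Finset.sum_eq_zero fun c _ => ?_
    by_cases hc : c ∈ W
    · rw [hg a ha c hc, zero_mul]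
    · rw [hh c hc b hb, mul_zero]
  inv_mem' {g} hg := by
    have hm : ∀ m : ℕ, ∀ a ∉ W, ∀ b ∈ W, ((g ^ m : GL I F) : Matrix I I F) a b = 0 := by
      intro m
      induction m with
      | zero =>
        intro a ha b hb
        rw [pow_zero, Units.val_one, Matrix.one_apply_ne]
        rintro rfl; exact ha hb
      | succ m ih =>
        intro a ha b hb
        rw [pow_succ, Units.val_mul, Matrix.mul_apply]
        refine Finset.sum_eq_zero fun c _ => ?_
        by_cases hc : c ∈ W
        · rw [ih a ha c hc, zero_mul]
        · rw [hg c hc b hb, mul_zero]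
    have : g⁻¹ = g ^ (Fintype.card (GL I F) - 1) := by
      rw [inv_eq_iff_mul_eq_one, ← pow_succ', Nat.sub_add_cancel Fintype.card_pos, pow_card_eq_one]
    rw [this]
    exact hm _

lemma mem_par {W : Finset I} {g : GL I F} : g ∈ par W ↔
    ∀ a ∉ W, ∀ b ∈ W, (g : Matrix I I F) a b = 0 := Iff.rfl

lemma conj_mem_rowGroup {W : Finset I} {g h : GL I F} (hg : g ∈ par W) (hh : h ∈ rowGroup W) :
    g * h * g⁻¹ ∈ rowGroup W := by
  have key : ∀ a ∉ W, ∀ b, ((g * h : GL I F) : Matrix I I F) a b = (g : Matrix I I F) a b := by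
    intro a ha b
    rw [Units.val_mul, Matrix.mul_apply]
    have : ∀ c, (g : Matrix I I F) a c * (h : Matrix I I F) c b =
        (g : Matrix I I F) a c * (1 : Matrix I I F) c b := fun c => by
      by_cases hc : c ∈ W
      · rw [hg a ha c hc, zero_mul, zero_mul]
      · rw [hh c hc b]
    simp only [this]
    rw [← Matrix.mul_apply, Matrix.mul_one]
  intro a ha b
  rw [Units.val_mul, Matrix.mul_apply]
  simp only [key a ha]
  rw [← Matrix.mul_apply, ← Units.val_mul, mul_inv_cancel, Units.val_one]

variable {V : Type*} [AddCommGroup V] [Module ℂ V] {ρ : Representation ℂ (GL I F) V}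

lemma SubT.par_smul {W : Finset I} {χ : Fˣ →* ℂ} {v : V} (h : SubT ρ W χ v) {g : GL I F}
    (hg : g ∈ par W) : SubT ρ W χ (ρ g v) := fun k hk => by
  have h1 := conj_mem_rowGroup (inv_mem hg) (h := k) hk
  rw [inv_inv] at h1
  have h2 : k * g = g * (g⁻¹ * k * g) := by group
  rw [← rho_mul_apply, h2, rho_mul_apply, h _ h1, map_smul]
  congr 2
  rw [map_mul, map_mul, map_inv, mul_right_comm, inv_mul_cancel, one_mul]

/-- The identity matrix with column `b` replaced by `z`, as an invertible matrix. -/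
lemma exists_col {b : I} {z : I → F} (hz : z b ≠ 0) : ∃ s : GL I F,
    (s : Matrix I I F) = (1 : Matrix I I F).updateCol b z := by
  obtain ⟨s, hs⟩ := exists_row hz
  refine ⟨Matrix.GeneralLinearGroup.mkOfDetNeZero ((1 : Matrix I I F).updateCol b z) ?_, rfl⟩
  rw [← Matrix.det_transpose, ← Matrix.updateRow_transpose, Matrix.transpose_one, ← hs]
  exact ((Matrix.isUnit_iff_isUnit_det _).1 s.isUnit).ne_zero

lemma vecMulVec_mul_self {W : Finset I} {p y : I → F} (hp : ∀ a ∈ W, p a = 0)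
    (hy : ∀ a ∉ W, y a = 0) : Matrix.vecMulVec p y * Matrix.vecMulVec p y = 0 := by
  ext a b
  rw [Matrix.mul_apply]
  refine Finset.sum_eq_zero fun c _ => ?_
  simp only [Matrix.vecMulVec_apply]
  by_cases hc : c ∈ W
  · rw [hp c hc]; ring
  · rw [hy c hc]; ring

lemma exists_conj_vecMulVec {W : Finset I} {p y : I → F} (hp : ∀ a ∈ W, p a = 0)
    (hy : ∀ a ∉ W, y a = 0) {l : I} (hl : l ∉ W) (hpl : p l ≠ 0) : ∃ D ∈ par (F := F) W,
    un (Matrix.vecMulVec p y) = D * un (rowMat l W fun b => y b) * D⁻¹ := by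
  obtain ⟨D, hD⟩ := exists_col hpl
  refine ⟨D, fun a ha b hb => ?_, ?_⟩
  · rw [hD, Matrix.updateCol_ne, Matrix.one_apply_ne]
    · rintro rfl; exact ha hb
    · rintro rfl; exact hl hb
  · rw [eq_mul_inv_iff_mul_eq]
    ext1
    rw [Units.val_mul, Units.val_mul, coe_un (vecMulVec_mul_self hp hy),
      coe_un (rowMat_mul_self hl _), add_mul, one_mul, mul_add, mul_one, Matrix.vecMulVec_mul]
    congr 1
    have h1 : y ᵥ* (D : Matrix I I F) = y := by
      ext b
      simp only [Matrix.vecMul, dotProduct]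
      have : ∀ a, y a * (D : Matrix I I F) a b = y a * (1 : Matrix I I F) a b := fun a => by
        by_cases ha : a ∈ W
        · by_cases hbl : b = l
          · subst hbl
            rw [hD, Matrix.updateCol_self, hp a ha, Matrix.one_apply_ne]
            rintro rfl; exact hl ha
          · rw [hD, Matrix.updateCol_ne hbl]
        · rw [hy a ha, zero_mul, zero_mul]
      simp only [this]
      simp [Matrix.one_apply]
    rw [h1]
    ext a b
    rw [Matrix.vecMulVec_apply, Matrix.mul_apply, Finset.sum_eq_single l]
    · rw [hD, Matrix.updateCol_self]
      by_cases hb : b ∈ W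
      · simp [rowMat, hb]
      · simp [rowMat, hb, hy b hb]
    · intro c _ hc; simp [rowMat, hc]
    · simp

end Parabolic

section Unitary

variable {I F V : Type*} [Fintype I] [DecidableEq I] [Field F] [Fintype F]
  [NormedAddCommGroup V] [InnerProductSpace ℂ V] {ρ : Representation ℂ (GL I F) V}
  {W : Finset I} {χ : Fˣ →* ℂ} {t : V}

lemma norm_inner_vecMulVec_le (hρ : ∀ g u v, inner ℂ (ρ g u) (ρ g v) = inner ℂ u v)
    (ht : SubT ρ W χ t) (hmax : ∀ l ∉ W, ∀ u : V, SubT ρ (insert l W) χ u → u = 0)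
    {p y : I → F} (hp : ∀ a ∈ W, p a = 0) (hy : ∀ a ∉ W, y a = 0) (hp0 : p ≠ 0) (hy0 : y ≠ 0) :
    ‖inner ℂ t (ρ (un (Matrix.vecMulVec p y)) t)‖ * ((Fintype.card F : ℝ) ^ W.card - 1) ≤
      ‖t‖ ^ 2 := by
  obtain ⟨l, hpl⟩ := Function.ne_iff.1 hp0
  obtain ⟨b, hyb⟩ := Function.ne_iff.1 hy0
  have hl : l ∉ W := fun h => hpl (hp l h)
  have hb : b ∈ W := by by_contra h; exact hyb (hy b h)
  have hlb : l ≠ b := fun h => hl (h ▸ hb)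
  obtain ⟨D, hD, e⟩ := exists_conj_vecMulVec hp hy hl hpl
  set u : GL I F := un (rowMat l W fun b => y b) with hu
  have h1 : inner ℂ t (ρ (un (Matrix.vecMulVec p y)) t) =
      inner ℂ (ρ D⁻¹ t) (ρ u (ρ D⁻¹ t)) := by
    rw [inner_rho_left hρ, inv_inv, e, rho_mul_apply, rho_mul_apply]
  have h2 : ‖ρ D⁻¹ t‖ = ‖t‖ := by
    rw [@norm_eq_sqrt_re_inner ℂ, hρ, ← @norm_eq_sqrt_re_inner ℂ]
  have h3 : ‖inner ℂ (ρ D⁻¹ t) (ρ u (ρ D⁻¹ t))‖ = ‖coeff ρ χ (ρ D⁻¹ t) u‖ := by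
    rw [coeff, norm_mul, norm_inv, norm_chi, inv_one, one_mul]
  have ht' := ht.par_smul (inv_mem hD)
  have hub : (u : Matrix I I F) l b ≠ 0 := by
    rw [hu, coe_un (rowMat_mul_self hl _), Matrix.add_apply, Matrix.one_apply_ne hlb, zero_add]
    simpa [rowMat, hb] using hyb
  rw [h1, h3, coeff_eq_coeff_E hρ ht' hl hb (un_rowMat_mem hl _) hub, ← h2]
  exact norm_coeff_E_mul_le hρ ht' hl hb (hmax l hl)

end Unitary

section SpectralMeasure

variable {ι κ F V : Type*} [Fintype ι] [Fintype κ] [DecidableEq ι] [DecidableEq κ] [Field F]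
  [Fintype F] [NormedAddCommGroup V] [InnerProductSpace ℂ V] {ψ : AddChar F ℂ}
  (α : AddChar (Matrix ι κ F) (Module.End ℂ V))

lemma inner_proj_proj (hψ : ψ ≠ 1) (hα : ∀ x u v, inner ℂ (α x u) (α x v) = inner ℂ u v)
    {b c : Matrix ι κ F} (hbc : b ≠ c) (t : V) :
    inner ℂ (proj ψ α b t) (proj ψ α c t) = 0 := by
  have h : ∀ x : Matrix ι κ F, ψ ((c - b)ᵀ * x).trace * inner ℂ (proj ψ α b t) (proj ψ α c t) =
      inner ℂ (proj ψ α b t) (proj ψ α c t) := fun x => by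
    conv_rhs => rw [← hα x, apply_proj, apply_proj, inner_smul_left, inner_smul_right, ← mul_assoc,
      ← AddChar.map_neg_eq_conj, ← AddChar.map_add_eq_mul]
    congr 2
    rw [Matrix.transpose_sub, Matrix.sub_mul, Matrix.trace_sub]; ring
  have h2 := Finset.sum_congr rfl fun x (_ : x ∈ (Finset.univ : Finset (Matrix ι κ F))) => h x
  rw [← Finset.sum_mul, sum_matChar_right hψ, if_neg (sub_ne_zero.2 hbc.symm), zero_mul,
    Finset.sum_const, nsmul_eq_mul] at h2
  exact (mul_eq_zero.1 h2.symm).resolve_left (by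
    rw [Finset.card_univ]; exact card_matrix_ne_zero)

lemma inner_apply_eq_sum (hψ : ψ ≠ 1) (hα : ∀ x u v, inner ℂ (α x u) (α x v) = inner ℂ u v)
    (t : V) (x : Matrix ι κ F) :
    inner ℂ t (α x t) = ∑ c, ψ (cᵀ * x).trace * ((‖proj ψ α c t‖ ^ 2 : ℝ) : ℂ) := by
  have ht : ∑ c, proj ψ α c t = t := by
    have := congrArg (fun T : Module.End ℂ V => T t) (sum_proj α hψ)
    simpa [LinearMap.sum_apply] using this
  have h1 : ∀ c, inner ℂ t (proj ψ α c t) = ((‖proj ψ α c t‖ ^ 2 : ℝ) : ℂ) := fun c => by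
    rw [show inner ℂ t (proj ψ α c t) = inner ℂ (∑ c, proj ψ α c t) (proj ψ α c t) by rw [ht],
      sum_inner, Finset.sum_eq_single c]
    · rw [inner_self_eq_norm_sq_to_K]; norm_cast
    · intro b _ hb; exact inner_proj_proj α hψ hα hb t
    · simp
  rw [show α x t = α x (∑ c, proj ψ α c t) by rw [ht], map_sum, inner_sum]
  refine Finset.sum_congr rfl fun c _ => ?_
  rw [apply_proj, inner_smul_right, h1]

lemma sum_norm_proj (hψ : ψ ≠ 1) (hα : ∀ x u v, inner ℂ (α x u) (α x v) = inner ℂ u v) (t : V) :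
    ∑ c, ‖proj ψ α c t‖ ^ 2 = ‖t‖ ^ 2 := by
  have h := inner_apply_eq_sum α hψ hα t 0
  rw [AddChar.map_zero_eq_one, Module.End.one_apply, inner_self_eq_norm_sq_to_K] at h
  simp only [Matrix.mul_zero, Matrix.trace_zero, AddChar.map_zero_eq_one, one_mul] at h
  apply Complex.ofReal_injective
  rw [Complex.ofReal_sum, ← h]; simp

lemma sum_addChar_dotProduct (hψ : ψ ≠ 1) (z : ι → F) :
    ∑ y : ι → F, ψ (y ⬝ᵥ z) = if z = 0 then ((Fintype.card F : ℂ) ^ Fintype.card ι) else 0 := by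
  have h := sum_matChar_right (κ := Unit) hψ (Matrix.of fun i _ => z i)
  rw [← Equiv.sum_comp (Equiv.mk (fun y : ι → F => (Matrix.of fun i (_ : Unit) => y i))
    (fun x i => x i ()) (fun _ => rfl) (fun _ => rfl))] at h
  have hz : (Matrix.of fun i (_ : Unit) => z i) = 0 ↔ z = 0 := by
    constructor
    · intro h; ext i; exact congrFun (congrFun h i) ()
    · rintro rfl; rfl
  simp only [hz] at h
  have hc : (Fintype.card (Matrix ι Unit F) : ℂ) = (Fintype.card F : ℂ) ^ Fintype.card ι := by
    rw [show Fintype.card (Matrix ι Unit F) = Fintype.card (ι → Unit → F) from rfl]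
    simp
  rw [hc] at h
  rw [← h]
  refine Finset.sum_congr rfl fun y _ => ?_
  congr 1
  simp [Matrix.trace, Matrix.mul_apply, dotProduct, mul_comm]
  rfl

lemma sum_inner_vecMulVec (hψ : ψ ≠ 1)
    (hα : ∀ x u v, inner ℂ (α x u) (α x v) = inner ℂ u v) (t : V) (p : ι → F) :
    ∑ y : κ → F, inner ℂ t (α (Matrix.vecMulVec p y) t) = (Fintype.card F : ℂ) ^ Fintype.card κ *
      ((∑ c with cᵀ *ᵥ p = 0, ‖proj ψ α c t‖ ^ 2 : ℝ) : ℂ) := by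
  simp only [inner_apply_eq_sum α hψ hα]
  rw [Finset.sum_comm]
  simp only [← Finset.sum_mul]
  have h : ∀ (c : Matrix ι κ F) (y : κ → F), (cᵀ * Matrix.vecMulVec p y).trace =
      y ⬝ᵥ (cᵀ *ᵥ p) := fun c y => by
    rw [Matrix.mul_vecMulVec, Matrix.trace_vecMulVec, dotProduct_comm]
  simp only [h, sum_addChar_dotProduct hψ]
  rw [Complex.ofReal_sum, Finset.mul_sum, Finset.sum_filter]
  refine Finset.sum_congr rfl fun c _ => ?_
  split_ifs <;> simp

end SpectralMeasure

section Square

variable {ι F V : Type*} [Fintype ι] [DecidableEq ι] [Field F]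
  [Fintype F] [NormedAddCommGroup V] [InnerProductSpace ℂ V] {ψ : AddChar F ℂ}
  (α : AddChar (Matrix ι ι F) (Module.End ℂ V))

lemma exists_det_ne_zero_proj_ne_zero (hψ : ψ ≠ 1)
    (hα : ∀ x u v, inner ℂ (α x u) (α x v) = inner ℂ u v) {t : V} (ht : t ≠ 0)
    (hq : 3 ≤ Fintype.card F)
    (hb : ∀ p y : ι → F, p ≠ 0 → y ≠ 0 → ‖inner ℂ t (α (Matrix.vecMulVec p y) t)‖ *
      ((Fintype.card F : ℝ) ^ Fintype.card ι - 1) ≤ ‖t‖ ^ 2) :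
    ∃ c : Matrix ι ι F, c.det ≠ 0 ∧ proj ψ α c t ≠ 0 := by
  by_contra! hcon
  set q : ℝ := (Fintype.card F : ℝ) with hqdef
  set N : ℝ := q ^ Fintype.card ι with hN
  have hq3 : (3 : ℝ) ≤ q := by rw [hqdef]; exact_mod_cast hq
  have hN1 : 1 ≤ N := one_le_pow₀ (by linarith)
  have htp : 0 < ‖t‖ ^ 2 := by positivity
  have hcard : ((Finset.univ.erase (0 : ι → F)).card : ℝ) = N - 1 := by
    rw [Finset.card_erase_of_mem (Finset.mem_univ _), Finset.card_univ,
      Nat.cast_sub Fintype.card_pos]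
    simp [hN, hqdef]
  have h1 : ∀ p : ι → F, p ≠ 0 →
      N * ∑ c with cᵀ *ᵥ p = 0, ‖proj ψ α c t‖ ^ 2 ≤ 2 * ‖t‖ ^ 2 := fun p hp => by
    have h2 := congrArg norm (sum_inner_vecMulVec α hψ hα t p)
    rw [norm_mul, norm_pow, Complex.norm_natCast, Complex.norm_real, Real.norm_of_nonneg
      (Finset.sum_nonneg fun _ _ => by positivity)] at h2
    rw [hN, hqdef, ← h2, ← Finset.add_sum_erase _ _ (Finset.mem_univ (0 : ι → F))]
    have h3 : ‖∑ y ∈ Finset.univ.erase (0 : ι → F), inner ℂ t (α (Matrix.vecMulVec p y) t)‖ ≤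
        ‖t‖ ^ 2 := by
      rcases hN1.eq_or_lt with hN' | hN'
      · have : Finset.univ.erase (0 : ι → F) = ∅ := by
          rw [← Finset.card_eq_zero]
          have : ((Finset.univ.erase (0 : ι → F)).card : ℝ) = 0 := by rw [hcard, ← hN', sub_self]
          exact_mod_cast this
        rw [this]; simp [htp.le]
      · refine (norm_sum_le _ _).trans ?_
        have : ∀ y ∈ Finset.univ.erase (0 : ι → F),
            ‖inner ℂ t (α (Matrix.vecMulVec p y) t)‖ ≤ ‖t‖ ^ 2 / (N - 1) := fun y hy => by
          rw [le_div_iff₀ (by linarith)]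
          exact hb p y hp (Finset.ne_of_mem_erase hy)
        refine (Finset.sum_le_card_nsmul _ _ _ this).trans_eq ?_
        rw [nsmul_eq_mul, hcard]
        field_simp [sub_ne_zero.2 hN'.ne']
    refine (norm_add_le _ _).trans ?_
    have h4 : ‖inner ℂ t (α (Matrix.vecMulVec p (0 : ι → F)) t)‖ = ‖t‖ ^ 2 := by
      rw [Matrix.vecMulVec_zero, AddChar.map_zero_eq_one, Module.End.one_apply,
        inner_self_eq_norm_sq_to_K]
      simp
    linarith
  have h5 : (q - 1) * ‖t‖ ^ 2 ≤ ∑ p ∈ Finset.univ.erase (0 : ι → F),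
      ∑ c with cᵀ *ᵥ p = 0, ‖proj ψ α c t‖ ^ 2 := by
    simp only [Finset.sum_filter]
    rw [Finset.sum_comm, ← sum_norm_proj α hψ hα t, Finset.mul_sum]
    refine Finset.sum_le_sum fun c _ => ?_
    by_cases hc : proj ψ α c t = 0
    · simp [hc]
    have hdet : c.det = 0 := by
      by_contra h; exact hc (hcon c h)
    rw [← Matrix.det_transpose] at hdet
    obtain ⟨p, hp, hcp⟩ := Matrix.exists_mulVec_eq_zero_iff.2 hdet
    rw [← Finset.sum_filter, Finset.sum_const, nsmul_eq_mul]
    gcongr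
    have : Fintype.card F - 1 ≤
        ((Finset.univ.erase (0 : ι → F)).filter fun p => cᵀ *ᵥ p = 0).card := by
      rw [← Finset.card_univ, ← Finset.card_erase_of_mem (Finset.mem_univ (0 : F))]
      refine Finset.card_le_card_of_injOn (fun a => a • p) (fun a ha => ?_) ?_
      · have ha0 : a ≠ 0 := by simpa using ha
        simp [ha0, hp, Matrix.mulVec_smul, hcp]
      · intro a _ b _ hab
        exact smul_left_injective F hp hab
    have h6 : ((Fintype.card F - 1 : ℕ) : ℝ) = q - 1 := by
      rw [Nat.cast_sub (by omega)]; simp [hqdef]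
    rw [← h6]
    exact_mod_cast this
  have h7 : ∑ p ∈ Finset.univ.erase (0 : ι → F),
      ∑ c with cᵀ *ᵥ p = 0, ‖proj ψ α c t‖ ^ 2 ≤ (N - 1) * (2 * ‖t‖ ^ 2 / N) := by
    rw [← hcard, ← nsmul_eq_mul]
    refine Finset.sum_le_card_nsmul _ _ _ fun p hp => ?_
    rw [le_div_iff₀ (by linarith), mul_comm]
    exact h1 p (Finset.ne_of_mem_erase hp)
  have h8 : (N - 1) * (2 * ‖t‖ ^ 2 / N) < 2 * ‖t‖ ^ 2 := by
    rw [mul_div_assoc', div_lt_iff₀ (by linarith)]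
    nlinarith
  nlinarith

end Square

section InvariantInner

variable {G V : Type*} [Group G] [Fintype G] [AddCommGroup V] [Module ℂ V] [FiniteDimensional ℂ V]

/-- A finite-dimensional representation of a finite group carries an invariant inner product. -/
lemma exists_core (ρ : Representation ℂ G V) : ∃ cd : InnerProductSpace.Core ℂ V,
    ∀ g u v, cd.inner (ρ g u) (ρ g v) = cd.inner u v := by
  let e : V ≃ₗ[ℂ] EuclideanSpace ℂ (Fin (Module.finrank ℂ V)) :=
    LinearEquiv.ofFinrankEq _ _ (by simp)
  refine ⟨{ inner := fun u v => ∑ g, inner ℂ (e (ρ g u)) (e (ρ g v))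
            conj_inner_symm := fun u v => ?_
            re_inner_nonneg := fun u => ?_
            add_left := fun u v w => ?_
            smul_left := fun u v r => ?_
            definite := fun u hu => ?_ }, fun g u v => ?_⟩
  · simp only [map_sum, inner_conj_symm]
  · rw [map_sum]
    exact Finset.sum_nonneg fun g _ => inner_self_nonneg
  · simp only [map_add, inner_add_left, Finset.sum_add_distrib]
  · simp only [map_smul, inner_smul_left, Finset.mul_sum]
  · have h0 := congrArg (RCLike.re (K := ℂ)) hu
    simp only [map_sum, map_zero] at h0
    rw [Finset.sum_eq_zero_iff_of_nonneg fun g _ => inner_self_nonneg] at h0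
    have h1 := h0 1 (Finset.mem_univ _)
    rw [map_one, Module.End.one_apply, inner_self_eq_norm_sq] at h1
    simpa using h1
  · refine Fintype.sum_equiv (Equiv.mulRight g) _ _ fun h => ?_
    simp [map_mul]

end InvariantInner

section Place

variable {I F V : Type*} [Fintype I] [DecidableEq I] [Field F] [Fintype F]
  [AddCommGroup V] [Module ℂ V] {ρ : Representation ℂ (GL I F) V} {ψ : AddChar F ℂ}

/-- The `0`-`1` matrix of a map. -/
def selMat (F : Type*) [Field F] {s : ℕ} (X : Fin s → I) : Matrix I (Fin s) F :=
  Matrix.of fun a i => if a = X i then 1 else 0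

/-- A square matrix placed in the rows `X` and columns `Y`. -/
def place {s : ℕ} (X Y : Fin s → I) (x : Matrix (Fin s) (Fin s) F) : Matrix I I F :=
  selMat F X * x * (selMat F Y)ᵀ

lemma place_mul_place {s : ℕ} {X Y : Fin s → I} (hXY : ∀ i j, X i ≠ Y j)
    (x y : Matrix (Fin s) (Fin s) F) : place X Y x * place X Y y = 0 := by
  have : (selMat F Y)ᵀ * selMat F X = 0 := by
    ext i j
    rw [Matrix.mul_apply]
    refine Finset.sum_eq_zero fun a _ => ?_
    by_cases h : a = X j
    · subst h; simp [selMat, hXY]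
    · simp [selMat, h]
  rw [place, place, Matrix.mul_assoc, ← Matrix.mul_assoc _ (selMat F X * y),
    ← Matrix.mul_assoc _ (selMat F X), this]
  simp

lemma place_zero {s : ℕ} (X Y : Fin s → I) : place (F := F) X Y 0 = 0 := by simp [place]

lemma place_add {s : ℕ} (X Y : Fin s → I) (x y : Matrix (Fin s) (Fin s) F) :
    place X Y (x + y) = place X Y x + place X Y y := by
  simp [place, Matrix.mul_add, Matrix.add_mul]

lemma place_vecMulVec {s : ℕ} (X Y : Fin s → I) (p y : Fin s → F) :
    place X Y (Matrix.vecMulVec p y) =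
      Matrix.vecMulVec (selMat F X *ᵥ p) (selMat F Y *ᵥ y) := by
  rw [place, Matrix.mul_vecMulVec, Matrix.vecMulVec_mul, Matrix.vecMul_transpose]

lemma selMat_mulVec_apply {s : ℕ} {X : Fin s → I} (hX : Function.Injective X) (p : Fin s → F)
    (i : Fin s) : (selMat F X *ᵥ p) (X i) = p i := by
  rw [Matrix.mulVec, dotProduct, Finset.sum_eq_single i]
  · simp [selMat]
  · intro j _ hj; simp [selMat, hX.eq_iff, hj.symm]
  · simp

lemma selMat_mulVec_eq_zero {s : ℕ} {X : Fin s → I} (p : Fin s → F) {a : I} (ha : ∀ i, a ≠ X i) :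
    (selMat F X *ᵥ p) a = 0 := by
  rw [Matrix.mulVec, dotProduct]
  exact Finset.sum_eq_zero fun i _ => by simp [selMat, ha]

lemma place_apply_coe {s : ℕ} {X Y : Fin s → I} (hX : Function.Injective X)
    (hY : Function.Injective Y) (x : Matrix (Fin s) (Fin s) F) (i j : Fin s) :
    place X Y x (X i) (Y j) = x i j := by
  rw [place, Matrix.mul_apply, Finset.sum_eq_single j]
  · rw [Matrix.mul_apply, Finset.sum_eq_single i]
    · simp [selMat]
    · intro k _ hk; simp [selMat, hX.eq_iff, hk.symm]
    · simp
  · intro k _ hk; simp [selMat, hY.eq_iff, hk.symm]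
  · simp

lemma place_eq_zero {s : ℕ} {X Y : Fin s → I} (x : Matrix (Fin s) (Fin s) F) {a b : I}
    (h : (∀ i, a ≠ X i) ∨ ∀ j, b ≠ Y j) : place X Y x a b = 0 := by
  rw [place, Matrix.mul_apply]
  refine Finset.sum_eq_zero fun k _ => ?_
  rcases h with h | h
  · rw [Matrix.mul_apply, Finset.sum_eq_zero, zero_mul]
    intro i _; simp [selMat, h]
  · simp [selMat, h]

/-- The representation of the additive group of square matrices placed in rows `X` and
columns `Y`. -/
noncomputable def placeChar (ρ : Representation ℂ (GL I F) V) {s : ℕ} {X Y : Fin s → I}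
    (hXY : ∀ i j, X i ≠ Y j) : AddChar (Matrix (Fin s) (Fin s) F) (Module.End ℂ V) where
  toFun x := ρ (un (place X Y x))
  map_zero_eq_one' := by rw [place_zero, un_zero, map_one]
  map_add_eq_mul' x y := by
    rw [place_add, un_add (place_mul_place hXY _ _) (place_mul_place hXY _ _)
      (place_mul_place hXY _ _) (place_mul_place hXY _ _), map_mul]

lemma placeChar_apply {s : ℕ} {X Y : Fin s → I} (hXY : ∀ i j, X i ≠ Y j)
    (x : Matrix (Fin s) (Fin s) F) : placeChar ρ hXY x = ρ (un (place X Y x)) := rfl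

lemma exists_proj_placeChar_ne_zero [FiniteDimensional ℂ V] (hψ : ψ ≠ 1)
    (hq : 3 ≤ Fintype.card F) {W : Finset I} {χ : Fˣ →* ℂ} {t : V} (ht0 : t ≠ 0)
    (ht : SubT ρ W χ t) (hmax : ∀ l ∉ W, ∀ u : V, SubT ρ (insert l W) χ u → u = 0)
    {s : ℕ} {X Y : Fin s → I} (hX : Function.Injective X) (hY : Function.Injective Y)
    (hXW : ∀ i, X i ∉ W) (hYW : ∀ i, Y i ∈ W) (hXY : ∀ i j, X i ≠ Y j) :
    ∃ c : Matrix (Fin s) (Fin s) F, c.det ≠ 0 ∧ proj ψ (placeChar ρ hXY) c t ≠ 0 := by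
  obtain ⟨cd, hcd⟩ := exists_core ρ
  let _ : NormedAddCommGroup V := cd.toNormedAddCommGroup
  let _ : InnerProductSpace ℂ V := InnerProductSpace.ofCore cd.toCore
  have hρ : ∀ g u v, inner ℂ (ρ g u) (ρ g v) = inner ℂ u v := hcd
  refine exists_det_ne_zero_proj_ne_zero (placeChar ρ hXY) hψ (fun x u v => hρ _ u v) ht0 hq
    fun p y hp hy => ?_
  rw [placeChar_apply, place_vecMulVec]
  have hsW : s ≤ W.card := by
    have := Finset.card_le_card_of_injOn (s := Finset.univ) (t := W) Y (fun i _ => hYW i)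
      (hY.injOn)
    simpa using this
  refine le_trans ?_ (norm_inner_vecMulVec_le hρ ht hmax (p := selMat F X *ᵥ p)
    (y := selMat F Y *ᵥ y) ?_ ?_ ?_ ?_)
  · refine mul_le_mul_of_nonneg_left ?_ (norm_nonneg _)
    have : (1 : ℝ) ≤ Fintype.card F := by exact_mod_cast (by omega : 1 ≤ Fintype.card F)
    have := pow_le_pow_right₀ this hsW
    simpa using this
  · intro a ha
    exact selMat_mulVec_eq_zero p fun i h => hXW i (h ▸ ha)
  · intro a ha
    exact selMat_mulVec_eq_zero y fun i h => ha (h ▸ hYW i)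
  · intro h
    exact hp (funext fun i => by rw [← selMat_mulVec_apply hX p i, h]; rfl)
  · intro h
    exact hy (funext fun i => by rw [← selMat_mulVec_apply hY y i, h]; rfl)

end Place

section InverseTranspose

variable {I F V : Type*} [Fintype I] [DecidableEq I] [Field F] [Fintype F]
  [AddCommGroup V] [Module ℂ V] {ρ : Representation ℂ (GL I F) V} {ψ : AddChar F ℂ}

/-- The inverse transpose automorphism. -/
def invT : GL I F →* GL I F where
  toFun g := ⟨(↑g⁻¹ : Matrix I I F)ᵀ, (g : Matrix I I F)ᵀ,
    by rw [← Matrix.transpose_mul, ← Units.val_mul]; simp,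
    by rw [← Matrix.transpose_mul, ← Units.val_mul]; simp⟩
  map_one' := by ext1; simp
  map_mul' g h := by ext1; simp [_root_.mul_inv_rev, Matrix.transpose_mul]

lemma coe_invT (g : GL I F) : (invT g : Matrix I I F) = (↑g⁻¹ : Matrix I I F)ᵀ := rfl

lemma invT_invT (g : GL I F) : invT (invT g) = g := by
  ext1
  rw [coe_invT, ← map_inv, coe_invT, inv_inv, Matrix.transpose_transpose]

/-- The representation twisted by the inverse transpose automorphism. -/
def tw (ρ : Representation ℂ (GL I F) V) : Representation ℂ (GL I F) V := ρ.comp invT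

lemma tw_apply (g : GL I F) : tw ρ g = ρ (invT g) := rfl

lemma tw_tw : tw (tw ρ) = ρ := by
  ext g v
  rw [tw_apply, tw_apply, invT_invT]

lemma invT_un {x : Matrix I I F} (hx : x * x = 0) : invT (un x) = un (-xᵀ) := by
  have hx' : (-xᵀ) * (-xᵀ) = 0 := by
    rw [neg_mul_neg, ← Matrix.transpose_mul, hx, Matrix.transpose_zero]
  ext1
  rw [coe_invT, un_inv hx, coe_un (by simpa using hx), coe_un hx']
  simp

lemma invT_E {a b : I} (hab : a ≠ b) (t : F) : invT (E a b t) = E b a (-t) := by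
  rw [E, invT_un (single_mul_self hab t), E, Matrix.transpose_single]
  congr 1
  ext i j
  simp [Matrix.single_apply]; split_ifs <;> simp

lemma invT_dg (D : I → Fˣ) : invT (dg D) = dg D⁻¹ := by
  ext1
  rw [coe_invT, coe_dg_inv, coe_dg, Matrix.diagonal_transpose]

lemma hasRank_of_tw (hψ : ψ ≠ 1) {r : ℕ} (h : HasRank (tw ρ) ψ r) : HasRank ρ ψ r := by
  obtain ⟨X, Y, hX, hY, hXY, v, hv, hw⟩ := h
  have hw' : Wt ρ ψ (blk (Finset.univ.image Y)) (-matching Y X) v := fun x => by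
    have hm := mask_mul_mask (sq0_blk (Finset.univ.image Y)) x x
    have h1 := hw.apply (x := -(mask (blk (Finset.univ.image Y)) x)ᵀ) fun a b hab => by
      rw [Matrix.neg_apply, Matrix.transpose_apply, mask_apply, if_neg, neg_zero]
      rw [mem_blk] at hab ⊢
      simp only [Finset.mem_compl] at hab
      tauto
    have hm' : (-(mask (blk (Finset.univ.image Y)) x)ᵀ) * (-(mask (blk (Finset.univ.image Y)) x)ᵀ)
        = 0 := by
      rw [neg_mul_neg, ← Matrix.transpose_mul, hm, Matrix.transpose_zero]
    rw [tw_apply, invT_un hm', Matrix.transpose_neg, neg_neg, Matrix.transpose_transpose] at h1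
    rw [h1, Matrix.mul_neg, Matrix.trace_neg, trace_matching, Matrix.transpose_neg, Matrix.neg_mul,
      Matrix.trace_neg, trace_matching]
    rfl
  refine hw'.hasRank hψ hv (X := Y) (Y := X) (fun i => by simp) (fun i => by
    simp only [Finset.mem_image, Finset.mem_univ, true_and, not_exists]
    exact fun j h => hXY i j h.symm) ?_
  have : (-matching Y X : Matrix I I F).submatrix Y X = -1 := by
    ext i j
    rw [Matrix.submatrix_apply, Matrix.neg_apply, matching_apply hX, Matrix.neg_apply,
      Matrix.one_apply]
    simp [hY.eq_iff]
  rw [this, Matrix.det_neg, Matrix.det_one]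
  simp

lemma hasRank_tw_iff (hψ : ψ ≠ 1) {r : ℕ} : HasRank (tw ρ) ψ r ↔ HasRank ρ ψ r :=
  ⟨hasRank_of_tw hψ, fun h => hasRank_of_tw hψ (by rwa [tw_tw])⟩

end InverseTranspose

section Levi

variable {I F V : Type*} [Fintype I] [DecidableEq I] [Field F] [Fintype F]
  [AddCommGroup V] [Module ℂ V] {ρ : Representation ℂ (GL I F) V} {ψ : AddChar F ℂ}

/-- The space of `χ ∘ det` eigenvectors of the row group of `W`. -/
def subTSpace (ρ : Representation ℂ (GL I F) V) (W : Finset I) (χ : Fˣ →* ℂ) : Submodule ℂ V where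
  carrier := {v | SubT ρ W χ v}
  add_mem' hu hv g hg := by rw [map_add, hu g hg, hv g hg, smul_add]
  zero_mem' g _ := by rw [map_zero, smul_zero]
  smul_mem' c v hv g hg := by rw [map_smul, hv g hg, smul_comm]

lemma emb_compl_mem_par (W : Finset I) (g : GL (Wᶜ : Finset I) F) : emb Wᶜ g ∈ par W :=
  fun a ha b hb => by
    rw [coe_emb, embMat_apply_right _ _ (by simpa using hb), Matrix.one_apply_ne]
    rintro rfl; exact ha hb

/-- The action of the block `GL Wᶜ` on the `χ ∘ det` eigenvectors of the row group of `W`. -/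
def leviRep (ρ : Representation ℂ (GL I F) V) (W : Finset I) (χ : Fˣ →* ℂ) :
    Representation ℂ (GL (Wᶜ : Finset I) F) (subTSpace ρ W χ) :=
  Subrepresentation.toRepresentation (ρ := (ρ.comp (emb Wᶜ) : Representation ℂ _ V))
    ⟨subTSpace ρ W χ, fun g _ hv => SubT.par_smul hv (emb_compl_mem_par W g)⟩

lemma coe_leviRep_apply (W : Finset I) (χ : Fˣ →* ℂ) (g : GL (Wᶜ : Finset I) F)
    (v : subTSpace ρ W χ) : (leviRep ρ W χ g v : V) = ρ (emb Wᶜ g) v := rfl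

lemma emb_E {A : Finset I} {a b : A} (hab : a ≠ b) (t : F) :
    emb A (E a b t) = E (a : I) b t := by
  rw [E, emb_un (single_mul_self hab t), E]
  congr 1
  ext i j
  simp only [extMat, Matrix.of_apply, Matrix.single_apply]
  split_ifs with h1 h2 h3 h3 h2 <;> first | rfl | skip
  · exact absurd ⟨congrArg Subtype.val h2.1, congrArg Subtype.val h2.2⟩ h3
  · exact absurd ⟨Subtype.ext h3.1, Subtype.ext h3.2⟩ h2
  · exact absurd ⟨h2.1 ▸ a.2, h2.2 ▸ b.2⟩ h1

lemma emb_dg {A : Finset I} (a : A) (l : Fˣ) :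
    emb A (dg (Pi.mulSingle a l)) = dg (Pi.mulSingle (a : I) l) := by
  ext i j
  rw [coe_emb, coe_dg, coe_dg, Matrix.diagonal_apply]
  by_cases h : i ∈ A ∧ j ∈ A
  · rw [embMat_apply_mem _ h.1 h.2, Matrix.diagonal_apply]
    simp only [Subtype.mk.injEq]
    congr 2
    simp only [Pi.mulSingle_apply, Subtype.ext_iff]
  · have : embMat A (Matrix.diagonal fun b => ((Pi.mulSingle a l : A → Fˣ) b : F)) i j =
        (1 : Matrix I I F) i j := by simp [embMat, h]
    rw [this, Matrix.one_apply]
    split_ifs with hij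
    · subst hij
      have : i ≠ a := by rintro rfl; exact h ⟨a.2, a.2⟩
      simp [this]
    · rfl

lemma subT_tw_of_leviRep {W : Finset I} {χ χ' : Fˣ →* ℂ} {W' : Finset (Wᶜ : Finset I)}
    {v : subTSpace ρ W χ} (hv : SubT (tw (leviRep ρ W χ)) W' χ' v) :
    SubT (tw ρ) (W'.map (Function.Embedding.subtype _)) χ' (v : V) := by
  refine subT_of_generators (fun a ha b hab t => ?_) fun a ha l => ?_
  · obtain ⟨a', ha', rfl⟩ := Finset.mem_map.1 ha
    change (a' : I) ≠ b at hab
    change tw ρ (E (a' : I) b t) v = v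
    rw [tw_apply, invT_E hab]
    by_cases hb : b ∈ W
    · rw [v.2 _ (E_mem_rowGroup hab.symm hb (-t)), det_E hab.symm, map_one, one_smul]
    · have hb' : b ∈ Wᶜ := by simpa using hb
      have hab' : a' ≠ ⟨b, hb'⟩ := fun h => hab (congrArg Subtype.val h)
      have h1 := hv _ (E_mem_rowGroup hab' ha' t)
      rw [det_E hab', map_one, one_smul, tw_apply, invT_E hab'] at h1
      have h2 := congrArg Subtype.val h1
      rwa [coe_leviRep_apply, emb_E hab'.symm] at h2
  · obtain ⟨a', ha', rfl⟩ := Finset.mem_map.1 ha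
    have h1 := hv (dg (Pi.mulSingle a' l)) fun c hc d => by
      rw [coe_dg, Matrix.diagonal_apply, Matrix.one_apply]
      split_ifs with h
      · rw [Pi.mulSingle_eq_of_ne, Units.val_one]
        rintro rfl; exact hc ha'
      · rfl
    rw [det_dg, Finset.prod_pi_mulSingle', if_pos (Finset.mem_univ _), tw_apply, invT_dg,
      ← Pi.mulSingle_inv] at h1
    have h2 := congrArg Subtype.val h1
    rw [coe_leviRep_apply, emb_dg] at h2
    rw [tw_apply, invT_dg]
    change ρ (dg (Pi.mulSingle (a' : I) l)⁻¹) v = _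
    rw [← Pi.mulSingle_inv]
    exact h2

end Levi

section TheoremU

variable {I F V : Type*} [Fintype I] [DecidableEq I] [Field F] [Fintype F]
  [AddCommGroup V] [Module ℂ V] {ρ : Representation ℂ (GL I F) V} {ψ : AddChar F ℂ}

lemma extMat_submatrix {A : Finset I} {y : Matrix I I F}
    (h : ∀ a b, ¬ (a ∈ A ∧ b ∈ A) → y a b = 0) :
    extMat A (y.submatrix (fun a : A => (a : I)) (fun a : A => (a : I))) = y := by
  ext a b
  by_cases hab : a ∈ A ∧ b ∈ A
  · simp [extMat, hab]
  · simp [extMat, hab, h a b hab]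

lemma transpose_selMat_mul_mul_selMat {s : ℕ} (X Y : Fin s → I) (M : Matrix I I F) :
    (selMat F X)ᵀ * M * selMat F Y = M.submatrix X Y := by
  ext i j
  simp [selMat, Matrix.mul_apply]

lemma trace_transpose_place_mul {s : ℕ} (X Y : Fin s → I) (c : Matrix (Fin s) (Fin s) F)
    (M : Matrix I I F) : ((place X Y c)ᵀ * M).trace = (cᵀ * M.submatrix X Y).trace := by
  rw [place, Matrix.transpose_mul, Matrix.transpose_mul, Matrix.transpose_transpose,
    Matrix.mul_assoc, Matrix.mul_assoc, Matrix.trace_mul_comm, ← transpose_selMat_mul_mul_selMat,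
    Matrix.mul_assoc]

lemma place_submatrix {s : ℕ} {X Y : Fin s → I} (hX : Function.Injective X)
    (hY : Function.Injective Y) {M : Matrix I I F}
    (h : ∀ a b, ((∀ i, a ≠ X i) ∨ ∀ j, b ≠ Y j) → M a b = 0) :
    place X Y (M.submatrix X Y) = M := by
  ext a b
  by_cases hab : (∀ i, a ≠ X i) ∨ ∀ j, b ≠ Y j
  · rw [place_eq_zero _ hab, h a b hab]
  · push Not at hab
    obtain ⟨⟨i, rfl⟩, ⟨j, rfl⟩⟩ := hab
    rw [place_apply_coe hX hY, Matrix.submatrix_apply]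

/-- A weight of the Levi representation gives a weight of `ρ` on the corresponding rectangle. -/
lemma wt_of_leviRep {W : Finset I} {χ : Fˣ →* ℂ} {p : ℕ} {X Y : Fin p → (Wᶜ : Finset I)}
    {t : subTSpace ρ W χ}
    (h : Wt (leviRep ρ W χ) ψ (blk (Finset.univ.image Y)ᶜ) (matching X Y) t)
    {R : Finset I} (hR : ∀ a ∈ R, a ∉ W) (hRY : ∀ j, (Y j : I) ∉ R) :
    Wt ρ ψ (R ×ˢ Finset.univ.image fun j => (Y j : I))
      (matching (fun i => (X i : I)) fun j => (Y j : I)) (t : V) := fun x => by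
  set y := mask (R ×ˢ Finset.univ.image fun j => (Y j : I)) x with hy
  have hy0 : ∀ a b, ¬ (a ∈ R ∧ ∃ j, (Y j : I) = b) → y a b = 0 := fun a b hab => by
    rw [hy, mask_apply, if_neg]
    simpa using hab
  set z := y.submatrix (fun a : (Wᶜ : Finset I) => (a : I)) (fun a : (Wᶜ : Finset I) => (a : I))
    with hz
  have hz0 : ∀ a b, (a, b) ∉ blk (Finset.univ.image Y)ᶜ → z a b = 0 := fun a b hab => by
    refine hy0 _ _ ?_
    rintro ⟨ha, j, hj⟩
    refine hab (mem_blk.2 ⟨?_, ?_⟩)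
    · simp only [Finset.mem_compl, Finset.mem_image, Finset.mem_univ, true_and, not_exists]
      rintro i rfl
      exact hRY i ha
    · simp only [Finset.mem_compl, Finset.mem_image, Finset.mem_univ, true_and, not_not]
      exact ⟨j, Subtype.ext hj⟩
  have hzz : z * z = 0 := by
    rw [← mask_eq_self.2 hz0]
    exact mask_mul_mask (sq0_blk _) _ _
  have h1 := congrArg Subtype.val (h.apply hz0)
  rw [coe_leviRep_apply, emb_un hzz, hz, extMat_submatrix] at h1
  · rw [h1, trace_matching, trace_matching]
    rfl
  · intro a b hab
    refine hy0 a b ?_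
    rintro ⟨ha, j, rfl⟩
    exact hab ⟨by simpa using hR a ha, (Y j).2⟩

lemma exists_injective_fin_of_le_card {s : ℕ} {T : Finset I} (h : s ≤ T.card) :
    ∃ X : Fin s → I, Function.Injective X ∧ ∀ i, X i ∈ T := by
  obtain ⟨f⟩ : Nonempty (Fin s ↪ T) :=
    Function.Embedding.nonempty_of_card_le (by simpa using h)
  exact ⟨fun i => f i, fun i j hij => f.injective (Subtype.ext hij), fun i => (f i).2⟩

/-- Above a maximal eigenvector of a row group, rank in the Levi block adds up with the number of
rows. -/
lemma hasRank_of_leviRep [FiniteDimensional ℂ V] (hψ : ψ ≠ 1) (hq : 3 ≤ Fintype.card F)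
    {W : Finset I} {χ : Fˣ →* ℂ}
    (hmax : ∀ l ∉ W, ∀ u : V, SubT ρ (insert l W) χ u → u = 0) {p s : ℕ}
    (hrank : HasRank (leviRep ρ W χ) ψ p) (hs : s ≤ W.card)
    (hcard : 2 * p + s + W.card ≤ Fintype.card I) : HasRank ρ ψ (p + s) := by
  obtain ⟨X₀, Y₀, hX₀, hY₀, hXY₀, t, ht, hw⟩ := hrank
  set X₁ : Fin p → I := fun i => (X₀ i : I) with hX₁
  set Y₁ : Fin p → I := fun i => (Y₀ i : I) with hY₁
  have hX₁i : Function.Injective X₁ := Subtype.val_injective.comp hX₀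
  have hY₁i : Function.Injective Y₁ := Subtype.val_injective.comp hY₀
  have hXY₁ : ∀ i j, X₁ i ≠ Y₁ j := fun i j h => hXY₀ i j (Subtype.ext h)
  have hX₁W : ∀ i, X₁ i ∉ W := fun i =>
    Finset.mem_compl.1 (X₀ i).2
  have hY₁W : ∀ i, Y₁ i ∉ W := fun i =>
    Finset.mem_compl.1 (Y₀ i).2
  obtain ⟨X₂, hX₂i, hX₂⟩ : ∃ X : Fin s → I, Function.Injective X ∧
      ∀ i, X i ∈ (W ∪ Finset.univ.image X₁ ∪ Finset.univ.image Y₁)ᶜ := by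
    refine exists_injective_fin_of_le_card ?_
    have h1 := Finset.card_union_le (W ∪ Finset.univ.image X₁) (Finset.univ.image Y₁)
    have h2 := Finset.card_union_le W (Finset.univ.image X₁)
    have h3 : (Finset.univ.image X₁).card ≤ p := by
      simpa using Finset.card_image_le (s := Finset.univ) (f := X₁)
    have h4 : (Finset.univ.image Y₁).card ≤ p := by
      simpa using Finset.card_image_le (s := Finset.univ) (f := Y₁)
    rw [Finset.card_compl]
    omega
  obtain ⟨Y₂, hY₂i, hY₂⟩ := exists_injective_fin_of_le_card hs
  have hX₂' : ∀ i, X₂ i ∉ W ∧ (∀ j, X₁ j ≠ X₂ i) ∧ ∀ j, Y₁ j ≠ X₂ i := fun i => by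
    simpa [and_assoc] using hX₂ i
  have hXY₂ : ∀ i j, X₂ i ≠ Y₂ j := fun i j h => (hX₂' i).1 (h ▸ hY₂ j)
  obtain ⟨c, hc, hne⟩ := exists_proj_placeChar_ne_zero (ρ := ρ) hψ hq
    (t := (t : V)) (by simpa using ht) t.2 hmax hX₂i hY₂i (fun i => (hX₂' i).1) hY₂ hXY₂
  set R : Finset I := Finset.univ.image X₁ ∪ Finset.univ.image X₂ with hR
  have hX₁R : ∀ i, X₁ i ∈ R := fun i => by simp [hR]
  have hX₂R : ∀ i, X₂ i ∈ R := fun i => by simp [hR]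
  have hRW : ∀ a ∈ R, a ∉ W := fun a ha => by
    simp only [hR, Finset.mem_union, Finset.mem_image, Finset.mem_univ, true_and] at ha
    rcases ha with ⟨i, rfl⟩ | ⟨i, rfl⟩
    exacts [hX₁W i, (hX₂' i).1]
  have hY₁R : ∀ j, Y₁ j ∉ R := fun j => by
    simp only [hR, Finset.mem_union, Finset.mem_image, Finset.mem_univ, true_and, not_or,
      not_exists]
    exact ⟨fun i => hXY₁ i j, fun i h => (hX₂' i).2.2 j h.symm⟩
  have hY₂R : ∀ j, Y₂ j ∉ R := fun j h => hRW _ h (hY₂ j)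
  set P : Finset (I × I) := R ×ˢ Finset.univ.image Y₁ with hP
  set P' : Finset (I × I) := Finset.univ.image X₂ ×ˢ Finset.univ.image Y₂ with hP'
  have hPR : P ⊆ blk R := by
    rintro ⟨a, b⟩ hab
    obtain ⟨ha, hb⟩ := Finset.mem_product.1 hab
    obtain ⟨j, -, rfl⟩ := Finset.mem_image.1 hb
    exact mem_blk.2 ⟨ha, hY₁R j⟩
  have hPR' : P' ⊆ blk R := by
    rintro ⟨a, b⟩ hab
    obtain ⟨ha, hb⟩ := Finset.mem_product.1 hab
    obtain ⟨j, -, rfl⟩ := Finset.mem_image.1 hb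
    obtain ⟨i, -, rfl⟩ := Finset.mem_image.1 ha
    exact mem_blk.2 ⟨hX₂R i, hY₂R j⟩
  have hplace : ∀ x, mask (blk R) (place X₂ Y₂ x) = place (F := F) X₂ Y₂ x := fun x =>
    mask_eq_self.2 fun a b hab => by
      refine place_eq_zero x ?_
      by_contra h
      push Not at h
      obtain ⟨⟨i, rfl⟩, ⟨j, rfl⟩⟩ := h
      exact hab (mem_blk.2 ⟨hX₂R i, hY₂R j⟩)
  have hY₁₂ : ∀ i j, Y₁ i ≠ Y₂ j := fun i j h => hY₁W i (h ▸ hY₂ j)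
  set v := proj ψ (placeChar ρ hXY₂) c (t : V) with hv
  set B : Matrix I I F := matching X₁ Y₁ + place X₂ Y₂ c with hB
  have hB₁ : ∀ a j, B a (Y₁ j) = if a = X₁ j then (1 : F) else 0 := fun a j => by
    rw [hB, Matrix.add_apply, matching_apply hY₁i,
      place_eq_zero _ (Or.inr (hY₁₂ j)), add_zero]
  have hB₂ : ∀ a j, B a (Y₂ j) = place X₂ Y₂ c a (Y₂ j) := fun a j => by
    rw [hB, Matrix.add_apply, matching_col_eq_zero (hY₁₂ · j), zero_add]
  have hw₁ : Wt ρ ψ P (matching X₁ Y₁) v := fun x => by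
    have := wt_of_leviRep hw hRW hY₁R x
    rw [hv, proj_commute (T := ρ (un (mask P x))), this, map_smul]
    intro y u
    rw [placeChar_apply, ← hplace y]
    exact un_mask_commute (sq0_blk R) hPR x _ u
  have hw₂ : Wt ρ ψ P' (place X₂ Y₂ c) v := fun x => by
    have h1 : place X₂ Y₂ ((mask P' x).submatrix X₂ Y₂) = mask P' x :=
      place_submatrix hX₂i hY₂i fun a b hab => by
        rw [mask_apply, if_neg]
        simp only [hP', Finset.mem_product, Finset.mem_image, Finset.mem_univ, true_and]
        rintro ⟨⟨i, rfl⟩, ⟨j, rfl⟩⟩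
        rcases hab with h | h
        exacts [h i rfl, h j rfl]
    have h2 := apply_proj (ψ := ψ) (placeChar ρ hXY₂) c ((mask P' x).submatrix X₂ Y₂) (t : V)
    rw [placeChar_apply, h1] at h2
    rw [trace_transpose_place_mul]
    exact h2
  have hw₃ : Wt ρ ψ (P ∪ P') B v := by
    refine Wt.union ((sq0_blk R).mono (Finset.union_subset hPR hPR')) (hw₁.congr ?_)
      (hw₂.congr ?_)
    · intro a b hab
      obtain ⟨-, hb⟩ := Finset.mem_product.1 hab
      obtain ⟨j, -, rfl⟩ := Finset.mem_image.1 hb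
      rw [hB₁, matching_apply hY₁i]
    · intro a b hab
      obtain ⟨-, hb⟩ := Finset.mem_product.1 hab
      obtain ⟨j, -, rfl⟩ := Finset.mem_image.1 hb
      rw [hB₂]
  obtain ⟨C, v', hv', hC, hCB⟩ := hw₃.exists_extension hψ (sq0_blk R)
    (Finset.union_subset hPR hPR') hne
  have hC₁ : ∀ a ∈ R, ∀ j, C a (Y₁ j) = if a = X₁ j then (1 : F) else 0 := fun a ha j => by
    rw [hCB _ _ (Finset.mem_union_left _ (Finset.mem_product.2 ⟨ha, by simp⟩)), hB₁]
  have hC₂ : ∀ i j, C (X₂ i) (Y₂ j) = c i j := fun i j => by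
    rw [hCB _ _ (Finset.mem_union_right _ (Finset.mem_product.2 ⟨by simp, by simp⟩)), hB₂,
      place_apply_coe hX₂i hY₂i]
  refine hC.hasRank hψ hv' (X := Sum.elim X₁ X₂ ∘ finSumFinEquiv.symm)
    (Y := Sum.elim Y₁ Y₂ ∘ finSumFinEquiv.symm) ?_ ?_ ?_
  · intro i
    rcases h : finSumFinEquiv.symm i with j | j <;> simp [h, hX₁R, hX₂R]
  · intro i
    rcases h : finSumFinEquiv.symm i with j | j <;> simp [h, hY₁R, hY₂R]
  · rw [← Matrix.submatrix_submatrix, Matrix.det_submatrix_equiv_self]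
    have : C.submatrix (Sum.elim X₁ X₂) (Sum.elim Y₁ Y₂) =
        Matrix.fromBlocks 1 (C.submatrix X₁ Y₂) 0 c := by
      ext (i | i) (j | j)
      · simp [hC₁ _ (hX₁R i), Matrix.one_apply, hX₁i.eq_iff]
      · simp
      · simp [hC₁ _ (hX₂R i), ((hX₂' i).2.1 j).symm]
      · simp [hC₂]
    rw [this, Matrix.det_fromBlocks_zero₂₁, Matrix.det_one, one_mul]
    exact hc

lemma exists_subT_tw_of_maximal [FiniteDimensional ℂ V] (hψ : ψ ≠ 1) (hq : 3 ≤ Fintype.card F)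
    {k : ℕ} (hk : ¬ HasRank ρ ψ (k + 1)) (hcard : 2 * k + 2 ≤ Fintype.card I)
    {W : Finset I} {χ : Fˣ →* ℂ} {t : V} (ht0 : t ≠ 0) (ht : SubT ρ W χ t)
    (hmax : ∀ l ∉ W, ∀ u : V, SubT ρ (insert l W) χ u → u = 0)
    (hW : Fintype.card I - 2 * k ≤ W.card) (hW' : W.card + k < Fintype.card I) :
    ∃ (W' : Finset I) (χ' : Fˣ →* ℂ) (v : V), v ≠ 0 ∧ W.card < W'.card ∧ SubT (tw ρ) W' χ' v := by
  have ht1 : (⟨t, ht⟩ : subTSpace ρ W χ) ≠ 0 := fun h => ht0 (congrArg Subtype.val h)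
  have hno : ∀ p s, s ≤ W.card → 2 * p + s + W.card ≤ Fintype.card I → p + s = k + 1 →
      ¬ HasRank (leviRep ρ W χ) ψ p := fun p s h1 h2 h3 h =>
    hk (h3 ▸ hasRank_of_leviRep hψ hq hmax h h1 h2)
  have hwk : W.card ≤ k := by
    by_contra h
    exact hno 0 (k + 1) (by omega) (by omega) (by omega) (hasRank_zero ht1)
  have h1 := hno (k - W.card + 1) W.card le_rfl (by omega) (by omega)
  rw [← hasRank_tw_iff hψ] at h1
  have : Nontrivial (subTSpace ρ W χ) := ⟨_, _, ht1⟩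
  have hc : Fintype.card (Wᶜ : Finset I) = Fintype.card I - W.card := by
    rw [Fintype.card_coe, Finset.card_compl]
  obtain ⟨W', χ', v, hcW, hv, hT⟩ := exists_subT_of_not_hasRank hψ h1 (by omega)
  refine ⟨_, χ', v, by simpa using hv, ?_, subT_tw_of_leviRep hT⟩
  rw [Finset.card_map]
  omega

/-- Small rank forces a large row group of `ρ`, or of its inverse transpose twist, to have a
determinant eigenvector. -/
theorem exists_subT_or_subT_tw [FiniteDimensional ℂ V] [Nontrivial V] (hψ : ψ ≠ 1)
    (hq : 3 ≤ Fintype.card F) {k : ℕ} (hk : ¬ HasRank ρ ψ (k + 1))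
    (hcard : 2 * k + 2 ≤ Fintype.card I) :
    ∃ (W : Finset I) (χ : Fˣ →* ℂ) (v : V), Fintype.card I ≤ W.card + k ∧ v ≠ 0 ∧
      (SubT ρ W χ v ∨ SubT (tw ρ) W χ v) := by
  let p : ℕ → Prop := fun w => ∃ (W : Finset I) (χ : Fˣ →* ℂ) (v : V), W.card = w ∧ v ≠ 0 ∧
      (SubT ρ W χ v ∨ SubT (tw ρ) W χ v)
  have hb : ∀ w, p w → w ≤ Fintype.card I := by
    rintro w ⟨W, χ, v, rfl, -⟩
    exact Finset.card_le_univ W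
  obtain ⟨W₀, χ₀, v₀, hW₀, hv₀, hT₀⟩ := exists_subT_of_not_hasRank hψ hk hcard
  have h0 : p W₀.card := ⟨W₀, χ₀, v₀, rfl, hv₀, Or.inl hT₀⟩
  have hs := Nat.findGreatest_spec (hb _ h0) h0
  have hle := Nat.le_findGreatest (hb _ h0) h0
  have hgt : ∀ w, p w → w ≤ Nat.findGreatest p (Fintype.card I) := fun w hw =>
    Nat.le_findGreatest (hb _ hw) hw
  obtain ⟨W, χ, v, hW, hv, hT⟩ := hs
  rw [← hW] at hle hgt
  refine ⟨W, χ, v, ?_, hv, hT⟩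
  by_contra hlt
  rcases hT with hT | hT
  · obtain ⟨W', χ', v', hv', hW', hT'⟩ := exists_subT_tw_of_maximal hψ hq hk hcard hv hT
      (fun l hl u hu => by_contra fun hu0 => by
        have := hgt _ ⟨_, χ, u, rfl, hu0, Or.inl hu⟩
        rw [Finset.card_insert_of_notMem hl] at this
        omega) (by omega) (by omega)
    have := hgt _ ⟨_, χ', v', rfl, hv', Or.inr hT'⟩
    omega
  · rw [← hasRank_tw_iff hψ] at hk
    obtain ⟨W', χ', v', hv', hW', hT'⟩ := exists_subT_tw_of_maximal hψ hq hk hcard hv hT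
      (fun l hl u hu => by_contra fun hu0 => by
        have := hgt _ ⟨_, χ, u, rfl, hu0, Or.inr hu⟩
        rw [Finset.card_insert_of_notMem hl] at this
        omega) (by omega) (by omega)
    rw [tw_tw] at hT'
    have := hgt _ ⟨_, χ', v', rfl, hv', Or.inl hT'⟩
    omega

end TheoremU

section Cosets

variable {G V : Type*} [Group G] [Finite G] [AddCommGroup V] [Module ℂ V]
  {ρ : Representation ℂ G V}

/-- A submodule stable under the elements of a subset of the group. -/
def StableUnder (ρ : Representation ℂ G V) (H : Set G) (S : Submodule ℂ V) : Prop :=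
  ∀ g ∈ H, ∀ v ∈ S, ρ g v ∈ S

lemma stableUnder_iSup_map (S : Submodule ℂ V) :
    StableUnder ρ Set.univ (⨆ g, S.map (ρ g)) := by
  intro g _ v hv
  have : (⨆ h, S.map (ρ h)) ≤ (⨆ h, S.map (ρ h)).comap (ρ g) := by
    refine iSup_le fun h => ?_
    rintro _ ⟨w, hw, rfl⟩
    rw [Submodule.mem_comap, ← Module.End.mul_apply, ← map_mul]
    exact Submodule.mem_iSup_of_mem (g * h) ⟨w, hw, rfl⟩
  exact this hv

lemma le_iSup_map (S : Submodule ℂ V) : S ≤ ⨆ g, S.map (ρ g) := fun v hv =>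
  Submodule.mem_iSup_of_mem 1 ⟨v, hv, by simp⟩

lemma finrank_iSup_le_sum {ι : Type*} [Fintype ι] [FiniteDimensional ℂ V]
    (S : ι → Submodule ℂ V) :
    Module.finrank ℂ (⨆ i, S i : Submodule ℂ V) ≤ ∑ i, Module.finrank ℂ (S i) := by
  rw [← Finset.sup_univ_eq_iSup]
  induction (Finset.univ : Finset ι) using Finset.induction_on with
  | empty => simp
  | insert a s ha ih =>
    rw [Finset.sup_insert, Finset.sum_insert ha]
    exact (Submodule.finrank_add_le_finrank_add_finrank _ _).trans (by omega)

/-- The translates of a subspace stable under a subgroup span a space of dimension at most the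
index times its dimension. -/
lemma finrank_iSup_map_le [FiniteDimensional ℂ V] {P : Subgroup G} {S : Submodule ℂ V}
    (hS : StableUnder ρ P S) :
    Module.finrank ℂ (⨆ g, S.map (ρ g) : Submodule ℂ V) ≤
      Nat.card (G ⧸ P) * Module.finrank ℂ S := by
  let _ := Fintype.ofFinite (G ⧸ P)
  have h1 : (⨆ g, S.map (ρ g)) ≤ ⨆ c : G ⧸ P, S.map (ρ c.out) := by
    refine iSup_le fun g => le_trans ?_ (le_iSup _ (g : G ⧸ P))
    rintro _ ⟨w, hw, rfl⟩
    obtain ⟨h, hh⟩ := QuotientGroup.mk_out_eq_mul P g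
    refine ⟨ρ ((h : G)⁻¹) w, hS _ (inv_mem h.2) w hw, ?_⟩
    rw [hh, ← Module.End.mul_apply, ← map_mul, mul_inv_cancel_right]
  refine (Submodule.finrank_mono h1).trans ((finrank_iSup_le_sum _).trans ?_)
  refine (Finset.sum_le_card_nsmul _ _ _ fun c _ => Submodule.finrank_map_le (ρ c.out) S).trans ?_
  rw [Finset.card_univ, Nat.card_eq_fintype_card, smul_eq_mul]

end Cosets

section Index

variable {I F : Type*} [Fintype I] [DecidableEq I] [Field F] [Fintype F]

variable (F) in
/-- The ratio `q / (q - 1)`. -/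
noncomputable def ratio : ℝ := (Fintype.card F : ℝ) / ((Fintype.card F : ℝ) - 1)

lemma one_lt_card : (1 : ℝ) < Fintype.card F := by
  exact_mod_cast Fintype.one_lt_card

lemma one_le_ratio : 1 ≤ ratio F := by
  have := one_lt_card (F := F)
  rw [ratio, le_div_iff₀ (by linarith)]
  linarith

lemma card_pow_le_card_GL_fin (w : ℕ) :
    (Fintype.card F : ℝ) ^ (w * w) ≤ Nat.card (GL (Fin w) F) * ratio F ^ w := by
  have h1 := one_lt_card (F := F)
  have hN : 1 ≤ Fintype.card F := Fintype.card_pos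
  rw [Matrix.card_GL_field, Nat.cast_prod]
  have h2 : ratio F ^ w = ∏ _i : Fin w, ratio F := by simp
  have h3 : (Fintype.card F : ℝ) ^ (w * w) = ∏ _i : Fin w, (Fintype.card F : ℝ) ^ w := by
    simp [pow_mul]
  rw [h2, h3, ← Finset.prod_mul_distrib]
  refine Finset.prod_le_prod (fun i _ => by positivity) fun i _ => ?_
  rw [Nat.cast_sub (Nat.pow_le_pow_right hN i.2.le), Nat.cast_pow, Nat.cast_pow, ratio,
    ← mul_div_assoc, le_div_iff₀ (by linarith)]
  have h4 : (Fintype.card F : ℝ) ^ ((i : ℕ) + 1) ≤ (Fintype.card F : ℝ) ^ w :=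
    pow_le_pow_right₀ h1.le i.2
  rw [pow_succ] at h4
  nlinarith

lemma card_GL_congr {A B : Type*} [Fintype A] [DecidableEq A] [Fintype B] [DecidableEq B]
    (e : A ≃ B) : Nat.card (GL A F) = Nat.card (GL B F) :=
  Nat.card_congr (Units.mapEquiv (Matrix.reindexAlgEquiv F F e).toMulEquiv).toEquiv

lemma card_pow_le_card_GL :
    (Fintype.card F : ℝ) ^ (Fintype.card I * Fintype.card I) ≤
      Nat.card (GL I F) * ratio F ^ Fintype.card I := by
  rw [card_GL_congr (Fintype.equivFin I)]
  exact card_pow_le_card_GL_fin _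

lemma card_quotient_par_mul_card_GL_le (W : Finset I) :
    Nat.card (GL I F ⧸ par (F := F) W) * Nat.card (GL W F) ≤
      Fintype.card F ^ (Fintype.card I * W.card) := by
  let Q : Matrix I W F := (1 : Matrix I I F).submatrix id (fun a : W => (a : I))
  have hQ1 : ∀ a c : W, Q a c = (1 : Matrix W W F) a c := fun a c => by
    change (1 : Matrix I I F) a c = _
    by_cases h : a = c
    · rw [h, Matrix.one_apply_eq, Matrix.one_apply_eq]
    · rw [Matrix.one_apply_ne h, Matrix.one_apply_ne fun e => h (Subtype.ext e)]
  have hQ : ∀ (h : Matrix W W F) (a b : W), (Q * h) a b = h a b := fun h a b => by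
    rw [Matrix.mul_apply]
    simp only [hQ1]
    rw [← Matrix.mul_apply, Matrix.one_mul]
  have hQ0 : ∀ (h : Matrix W W F) (a : I) (b : W), a ∉ W → (Q * h) a b = 0 := fun h a b ha => by
    rw [Matrix.mul_apply]
    refine Finset.sum_eq_zero fun c _ => ?_
    have : a ≠ c := by rintro rfl; exact ha c.2
    simp [Q, this]
  have hMQ : ∀ (M : Matrix I I F) (a : I) (b : W), (M * Q) a b = M a b := fun M a b => by
    have : M * Q = M.submatrix id (fun a : W => (a : I)) := by
      ext; simp [Q, Matrix.mul_apply, Matrix.one_apply]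
    rw [this]; rfl
  let f : (GL I F ⧸ par (F := F) W) × GL W F → Matrix I W F := fun p =>
    (p.1.out : Matrix I I F) * Q * (p.2 : Matrix W W F)
  have hf : Function.Injective f := by
    rintro ⟨c, h⟩ ⟨c', h'⟩ hcc
    have hcc : (c.out : Matrix I I F) * Q * (h : Matrix W W F) =
      (c'.out : Matrix I I F) * Q * (h' : Matrix W W F) := hcc
    have h1 : ((c'.out⁻¹ * c.out : GL I F) : Matrix I I F) * Q =
        Q * ((h' : Matrix W W F) * ((h⁻¹ : GL W F) : Matrix W W F)) := by
      have := congrArg (fun M => ((c'.out⁻¹ : GL I F) : Matrix I I F) * M *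
        ((h⁻¹ : GL W F) : Matrix W W F)) hcc
      simp only [Matrix.mul_assoc, ← Units.val_mul] at this
      rw [mul_inv_cancel, Units.val_one, Matrix.mul_one, ← Matrix.mul_assoc, ← Units.val_mul,
        ← Matrix.mul_assoc, ← Units.val_mul, inv_mul_cancel, Units.val_one, Matrix.one_mul] at this
      rw [this, Units.val_mul]
    have h2 : c' = c := by
      rw [← QuotientGroup.out_eq' c, ← QuotientGroup.out_eq' c', QuotientGroup.eq]
      intro a ha b hb
      have := congrFun (congrFun h1 a) ⟨b, hb⟩
      rwa [hMQ, hQ0 _ _ _ ha] at this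
    subst h2
    rw [inv_mul_cancel, Units.val_one, Matrix.one_mul] at h1
    have h3 : h' * h⁻¹ = 1 := by
      ext a b
      have h4 := hQ ((h' : Matrix W W F) * ((h⁻¹ : GL W F) : Matrix W W F)) a b
      rw [← h1, hQ1] at h4
      rw [Units.val_mul, Units.val_one, h4]
    rw [mul_inv_eq_one] at h3
    rw [h3]
  have := Nat.card_le_card_of_injective f hf
  rw [Nat.card_prod] at this
  refine this.trans (le_of_eq ?_)
  rw [Nat.card_eq_fintype_card, show Fintype.card (Matrix I W F) = Fintype.card (I → W → F) from rfl]
  simp [← pow_mul, mul_comm]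

end Index

section SmallSub

/-- Every nonzero finite-dimensional representation has a nonzero stable subspace of dimension at
most `d`. -/
def HasSmallSub (H : Type*) [Group H] (d : ℝ) : Prop :=
  ∀ (V : Type) [AddCommGroup V] [Module ℂ V] [FiniteDimensional ℂ V] [Nontrivial V]
    (ρ : Representation ℂ H V), ∃ S : Submodule ℂ V, S ≠ ⊥ ∧ StableUnder ρ Set.univ S ∧
      (Module.finrank ℂ S : ℝ) ≤ d

lemma HasSmallSub.of_equiv {H K : Type*} [Group H] [Group K] (e : H ≃* K) {d : ℝ}
    (h : HasSmallSub H d) : HasSmallSub K d := fun V _ _ _ _ ρ => by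
  obtain ⟨S, h1, h2, h3⟩ := h V (ρ.comp e.toMonoidHom)
  refine ⟨S, h1, fun g _ v hv => ?_, h3⟩
  have := h2 (e.symm g) trivial v hv
  simpa using this

variable {G H K V : Type} [Group G] [Group H] [Group K] [AddCommGroup V] [Module ℂ V]
  [FiniteDimensional ℂ V]

lemma HasSmallSub.exists_le {d : ℝ} (h : HasSmallSub H d) (ρ : Representation ℂ H V)
    {S : Submodule ℂ V} (hS : S ≠ ⊥) (hst : StableUnder ρ Set.univ S) :
    ∃ T ≤ S, T ≠ ⊥ ∧ StableUnder ρ Set.univ T ∧ (Module.finrank ℂ T : ℝ) ≤ d := by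
  let σ : Representation ℂ H S := Subrepresentation.toRepresentation (ρ := ρ)
    ⟨S, fun g _ hv => hst g trivial _ hv⟩
  have : Nontrivial S := Submodule.nontrivial_iff_ne_bot.2 hS
  obtain ⟨T, h1, h2, h3⟩ := h S σ
  refine ⟨T.map S.subtype, Submodule.map_subtype_le S T, ?_, ?_, ?_⟩
  · exact fun h0 => h1 (Submodule.map_injective_of_injective S.injective_subtype
      (h0.trans (Submodule.map_bot _).symm))
  · rintro g - _ ⟨v, hv, rfl⟩
    exact ⟨σ g v, h2 g trivial v hv, rfl⟩
  · rwa [Submodule.finrank_map_subtype_eq]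

/-- Dimension bounds multiply for two commuting groups of operators. -/
lemma HasSmallSub.exists_le_of_commute {d d' : ℝ} (h : HasSmallSub H d) (h' : HasSmallSub K d')
    (hd : 0 ≤ d) (ρ : Representation ℂ H V) (ρ' : Representation ℂ K V)
    (hc : ∀ g g' v, ρ g (ρ' g' v) = ρ' g' (ρ g v))
    {S : Submodule ℂ V} (hS : S ≠ ⊥) (hst : StableUnder ρ Set.univ S)
    (hst' : StableUnder ρ' Set.univ S) :
    ∃ T ≤ S, T ≠ ⊥ ∧ StableUnder ρ Set.univ T ∧ StableUnder ρ' Set.univ T ∧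
      (Module.finrank ℂ T : ℝ) ≤ d * d' := by
  obtain ⟨T, hTS, hT, hTst, hTd⟩ := h.exists_le ρ hS hst
  let M : Submodule ℂ (T →ₗ[ℂ] V) :=
    { carrier := {f | (∀ t, f t ∈ S) ∧
        ∀ g (t : T), f ⟨ρ g t, hTst g trivial _ t.2⟩ = ρ g (f t)}
      add_mem' := fun {a b} ha hb => ⟨fun t => S.add_mem (ha.1 t) (hb.1 t), fun g t => by
        rw [LinearMap.add_apply, LinearMap.add_apply, map_add, ha.2, hb.2]⟩
      zero_mem' := ⟨fun t => S.zero_mem, fun g t => by simp⟩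
      smul_mem' := fun c a ha => ⟨fun t => S.smul_mem c (ha.1 t), fun g t => by
        rw [LinearMap.smul_apply, LinearMap.smul_apply, map_smul, ha.2]⟩ }
  let τ : Representation ℂ K (T →ₗ[ℂ] V) :=
    { toFun := fun g => LinearMap.compRight ℂ (ρ' g)
      map_one' := by ext; simp
      map_mul' := fun g g' => by ext; simp }
  have hM : M ≠ ⊥ := by
    rw [Submodule.ne_bot_iff]
    refine ⟨T.subtype, ⟨fun t => hTS t.2, fun g t => rfl⟩, fun h0 => hT ?_⟩
    rw [← Submodule.range_subtype T, h0, LinearMap.range_zero]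
  have hMst : StableUnder τ Set.univ M := fun g _ f hf =>
    ⟨fun t => hst' g trivial _ (hf.1 t), fun g' t => by
      change ρ' g (f _) = ρ g' (ρ' g (f t))
      rw [hf.2, hc]⟩
  obtain ⟨N, hNM, hN, hNst, hNd⟩ := h'.exists_le τ hM hMst
  let φ : TensorProduct ℂ N T →ₗ[ℂ] V := TensorProduct.lift N.subtype
  have hφ : ∀ U : Submodule ℂ V, (∀ f ∈ N, ∀ t, f t ∈ U) → LinearMap.range φ ≤ U := by
    rintro U hU _ ⟨x, rfl⟩
    induction x with
    | zero => simp
    | tmul f t => simpa [φ] using hU f f.2 t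
    | add x y hx hy => rw [map_add]; exact U.add_mem hx hy
  have hφ' : ∀ f ∈ N, ∀ t, f t ∈ LinearMap.range φ := fun f hf t =>
    ⟨TensorProduct.tmul ℂ ⟨f, hf⟩ t, by simp [φ]⟩
  refine ⟨LinearMap.range φ, hφ S fun f hf => (hNM hf).1, ?_, ?_, ?_, ?_⟩
  · obtain ⟨f, hf, hf0⟩ := (Submodule.ne_bot_iff _).1 hN
    obtain ⟨t, ht⟩ : ∃ t, f t ≠ 0 := by
      by_contra hcon
      push Not at hcon
      exact hf0 (LinearMap.ext hcon)
    exact (Submodule.ne_bot_iff _).2 ⟨f t, hφ' f hf t, ht⟩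
  · intro g _ v hv
    refine hφ ((LinearMap.range φ).comap (ρ g)) (fun f hf t => ?_) hv
    rw [Submodule.mem_comap, ← (hNM hf).2]
    exact hφ' f hf _
  · intro g _ v hv
    refine hφ ((LinearMap.range φ).comap (ρ' g)) (fun f hf t => ?_) hv
    exact hφ' _ (hNst g trivial f hf) t
  · have h1 := LinearMap.finrank_range_le φ
    rw [Module.finrank_tensorProduct] at h1
    calc (Module.finrank ℂ (LinearMap.range φ) : ℝ)
        ≤ (Module.finrank ℂ N : ℝ) * Module.finrank ℂ T := by exact_mod_cast h1
      _ ≤ d * d' := by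
        rw [mul_comm]
        exact mul_le_mul hTd hNd (Nat.cast_nonneg _) hd

end SmallSub

section Irreducible

variable {G V : Type*} [Group G] [AddCommGroup V] [Module ℂ V]

/-- Irreducibility in terms of stable subspaces. -/
def Irr (ρ : Representation ℂ G V) : Prop :=
  Nontrivial V ∧ ∀ S : Submodule ℂ V, StableUnder ρ Set.univ S → S ≠ ⊥ → S = ⊤

lemma exists_minimal_stable [FiniteDimensional ℂ V] [Nontrivial V] (ρ : Representation ℂ G V) :
    ∃ (S : Submodule ℂ V) (h : StableUnder ρ Set.univ S),
      Irr (Subrepresentation.toRepresentation (ρ := ρ) ⟨S, fun g _ hv => h g trivial _ hv⟩) := by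
  let p : ℕ → Prop := fun d => ∃ S : Submodule ℂ V, S ≠ ⊥ ∧ StableUnder ρ Set.univ S ∧
    Module.finrank ℂ S = d
  have hp : ∃ d, p d := ⟨_, ⊤, top_ne_bot, fun _ _ _ _ => trivial, rfl⟩
  obtain ⟨S, hS, hst, hd⟩ := Nat.find_spec hp
  refine ⟨S, hst, Submodule.nontrivial_iff_ne_bot.2 hS, fun T hT hT0 => ?_⟩
  have h1 : Nat.find hp ≤ Module.finrank ℂ (T.map S.subtype) := by
    refine Nat.find_min' hp ⟨T.map S.subtype, ?_, ?_, rfl⟩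
    · exact fun h0 => hT0 (Submodule.map_injective_of_injective S.injective_subtype
      (h0.trans (Submodule.map_bot _).symm))
    · rintro g - _ ⟨v, hv, rfl⟩
      exact ⟨_, hT g trivial v hv, rfl⟩
  rw [Submodule.finrank_map_subtype_eq, ← hd] at h1
  exact Submodule.eq_top_of_finrank_eq (le_antisymm (Submodule.finrank_le T) h1)

end Irreducible

section IndexBound

variable {I F : Type*} [Fintype I] [DecidableEq I] [Field F] [Fintype F]

lemma index_par_le (W : Finset I) : (Nat.card (GL I F ⧸ par (F := F) W) : ℝ) ≤
    (Fintype.card F : ℝ) ^ (W.card * (Wᶜ).card) * ratio F ^ W.card := by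
  have h0 := one_lt_card (F := F)
  have h1 : (Nat.card (GL I F ⧸ par (F := F) W) : ℝ) * Nat.card (GL W F) ≤
      (Fintype.card F : ℝ) ^ (Fintype.card I * W.card) := by
    exact_mod_cast card_quotient_par_mul_card_GL_le (F := F) W
  have h2 := card_pow_le_card_GL (I := W) (F := F)
  rw [Fintype.card_coe] at h2
  have hr : 0 < ratio F ^ W.card := pow_pos (by linarith [one_le_ratio (F := F)]) _
  have h3 : Fintype.card I = W.card + (Wᶜ).card := by rw [Finset.card_add_card_compl]
  rw [h3, add_mul, pow_add, mul_comm (Wᶜ).card] at h1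
  have h4 : 0 < (Fintype.card F : ℝ) ^ (W.card * W.card) := by positivity
  refine le_of_mul_le_mul_left ?_ h4
  calc (Fintype.card F : ℝ) ^ (W.card * W.card) * (Nat.card (GL I F ⧸ par (F := F) W) : ℝ)
      ≤ (Nat.card (GL W F) * ratio F ^ W.card) * (Nat.card (GL I F ⧸ par (F := F) W) : ℝ) :=
        mul_le_mul_of_nonneg_right h2 (Nat.cast_nonneg _)
    _ = ((Nat.card (GL I F ⧸ par (F := F) W) : ℝ) * Nat.card (GL W F)) * ratio F ^ W.card := by
        ring
    _ ≤ _ := (mul_le_mul_of_nonneg_right h1 hr.le).trans_eq (by ring)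

end IndexBound

section Chain

variable {n : ℕ} {F V : Type*} [Field F] [Fintype F]
  [AddCommGroup V] [Module ℂ V]

/-- The positions above the diagonal in column `b`. -/
def colP (b : Fin n) : Finset (Fin n × Fin n) := Finset.univ.filter fun p => p.1 < p.2 ∧ p.2 = b

lemma mem_colP {a b c : Fin n} : (a, c) ∈ colP b ↔ a < b ∧ c = b := by
  simp only [colP, Finset.mem_filter, Finset.mem_univ, true_and]
  constructor
  · rintro ⟨h, rfl⟩; exact ⟨h, rfl⟩
  · rintro ⟨h, rfl⟩; exact ⟨h, rfl⟩

lemma sq0_colP (b : Fin n) : Sq0 (colP b) := by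
  intro x y z h h'
  rw [mem_colP] at h h'
  exact absurd (h.2 ▸ h'.1) (lt_irrefl _)

variable (n F) in
/-- The matrix with ones right above the diagonal. -/
def superdiag : Matrix (Fin n) (Fin n) F := Matrix.of fun a b => if a.1 + 1 = b.1 then 1 else 0

lemma superdiag_apply (a b : Fin n) :
    superdiag n F a b = if a.1 + 1 = b.1 then 1 else 0 := rfl

variable (ρ : Representation ℂ (GL (Fin n) F) V) (ψ : AddChar F ℂ)

/-- Vectors on which the columns from `i` on act through the standard nondegenerate character. -/
def chain (i : ℕ) : Submodule ℂ V where
  carrier := {v | ∀ b : Fin n, i ≤ b.1 → Wt ρ ψ (colP b) (superdiag n F) v}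
  add_mem' hv hw b hb x := by rw [map_add, hv b hb x, hw b hb x, smul_add]
  zero_mem' b hb x := by simp
  smul_mem' c v hv b hb x := by rw [map_smul, hv b hb x, smul_comm]

variable {ρ ψ}

lemma chain_eq_top : chain ρ ψ n = ⊤ := by
  refine Submodule.eq_top_iff'.2 fun v b hb => absurd b.2 (by omega)

lemma chain_le_succ (i : ℕ) : chain ρ ψ i ≤ chain ρ ψ (i + 1) := fun _ hv b hb =>
  hv b (by omega)

lemma chain_mono {i j : ℕ} (h : i ≤ j) : chain ρ ψ i ≤ chain ρ ψ j := fun _ hv b hb =>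
  hv b (by omega)

/-- The rows from `i` on are those of the identity matrix. -/
def TailOne (i : ℕ) (g : GL (Fin n) F) : Prop :=
  ∀ a : Fin n, i ≤ a.1 → ∀ c, (g : Matrix (Fin n) (Fin n) F) a c = (1 : Matrix (Fin n) (Fin n) F) a c

lemma TailOne.mul_apply {i : ℕ} {g : GL (Fin n) F} (hg : TailOne i g)
    (x : Matrix (Fin n) (Fin n) F) {a : Fin n} (ha : i ≤ a.1) (c : Fin n) :
    ((g : Matrix (Fin n) (Fin n) F) * x) a c = x a c := by
  rw [Matrix.mul_apply]
  simp [hg a ha, Matrix.one_apply]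

lemma TailOne.inv {i : ℕ} {g : GL (Fin n) F} (hg : TailOne i g) : TailOne i g⁻¹ := by
  intro a ha c
  have h := hg.mul_apply (↑g⁻¹ : Matrix (Fin n) (Fin n) F) ha c
  rw [← Units.val_mul, mul_inv_cancel, Units.val_one] at h
  exact h.symm

lemma tailOne_un (i : Fin n) (x : Matrix (Fin n) (Fin n) F) : TailOne i.1 (un (mask (colP i) x)) := by
  intro a ha c
  rw [coe_un (mask_mul_mask (sq0_colP i) _ _), Matrix.add_apply, mask_apply, if_neg, add_zero]
  rw [mem_colP]
  rintro ⟨h, -⟩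
  exact absurd h (not_lt.2 ha)

lemma tailOne_emb (i : Fin n) (h : GL (Finset.Iio i) F) : TailOne i.1 (emb (Finset.Iio i) h) := by
  intro a ha c
  by_cases hc : c ∈ Finset.Iio i
  · have ha' : a ∉ Finset.Iio i := by simpa using ha
    exact embMat_apply_left (A := Finset.Iio i) h.1 (⟨c, hc⟩ : Finset.Iio i) ha'
  · exact embMat_apply_right _ a hc

lemma TailOne.wt {i : ℕ} {g : GL (Fin n) F} (hg : TailOne i g) {b : Fin n} (hb : i ≤ b.1)
    {B : Matrix (Fin n) (Fin n) F} {v : V}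
    (h : Wt ρ ψ (colP b) ((g : Matrix (Fin n) (Fin n) F)ᵀ * B) v) :
    Wt ρ ψ (colP b) B (ρ g v) := by
  intro x
  set m := mask (colP b) x with hm
  have hmm : m * m = 0 := mask_mul_mask (sq0_colP b) _ _
  have hmg : m * (g : Matrix (Fin n) (Fin n) F) = m := by
    ext a c
    rw [Matrix.mul_apply, Finset.sum_eq_single b]
    · rw [hg b hb, Matrix.one_apply]
      split_ifs with hbc
      · rw [mul_one, hbc]
      · rw [hm, mask_apply, mask_apply, if_neg (fun h => hbc (mem_colP.1 h).2.symm), mul_zero]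
    · intro d _ hd
      rw [hm, mask_apply, if_neg (fun h => hd (mem_colP.1 h).2), zero_mul]
    · simp
  have h1 : g⁻¹ * un m * g = un ((↑g⁻¹ : Matrix (Fin n) (Fin n) F) * m) := by
    have := conj_un g⁻¹ hmm
    rwa [inv_inv, Matrix.mul_assoc, hmg] at this
  have h2 : un m * g = g * un ((↑g⁻¹ : Matrix (Fin n) (Fin n) F) * m) := by
    rw [← h1]; group
  have h3 : ρ (un m) (ρ g v) = ρ g (ρ (un ((↑g⁻¹ : Matrix (Fin n) (Fin n) F) * m)) v) := by
    rw [← rho_mul_apply, h2, rho_mul_apply]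
  rw [h3, h.apply, map_smul]
  · congr 3
    rw [Matrix.transpose_mul, Matrix.transpose_transpose, Matrix.mul_assoc, ← Matrix.mul_assoc _ _ m,
      ← Units.val_mul, mul_inv_cancel, Units.val_one, Matrix.one_mul]
  · intro a c hac
    rw [mem_colP, not_and_or, not_lt] at hac
    rcases hac with hac | hac
    · rw [hg.inv.mul_apply _ (hb.trans hac), hm, mask_apply,
        if_neg (fun h => absurd (mem_colP.1 h).1 (not_lt.2 hac))]
    · rw [Matrix.mul_apply]
      refine Finset.sum_eq_zero fun d _ => ?_
      rw [hm, mask_apply, if_neg (fun h => hac (mem_colP.1 h).2), mul_zero]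

lemma TailOne.apply_mem_chain {i : ℕ} {g : GL (Fin n) F} (hg : TailOne i g) {v : V}
    (hv : v ∈ chain ρ ψ (i + 1)) : ρ g v ∈ chain ρ ψ (i + 1) := by
  intro b hb
  refine hg.wt (by omega) ((hv b hb).congr fun a c hac => ?_)
  obtain ⟨hac, rfl⟩ := mem_colP.1 hac
  rw [Matrix.mul_apply, Finset.sum_eq_single ⟨c.1 - 1, by omega⟩]
  · rw [Matrix.transpose_apply, hg _ (by simp only; omega), superdiag_apply, superdiag_apply,
      Matrix.one_apply, if_pos (show c.1 - 1 + 1 = c.1 by omega), mul_one]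
    simp only [Fin.ext_iff]
    congr 1
    rw [eq_iff_iff]; omega
  · intro d _ hd
    rw [superdiag_apply, if_neg, mul_zero]
    intro h
    exact hd (Fin.ext (by simp only; omega))
  · simp

/-- No vector is fixed by a proper block unipotent group. -/
def Cuspidal {I : Type*} [Fintype I] [DecidableEq I] (ρ : Representation ℂ (GL I F) V) : Prop :=
  ∀ W : Finset I, W.Nonempty → (Wᶜ).Nonempty → ∀ v : V,
    (∀ x, ρ (un (mask (blk W) x)) v = v) → v = 0

/-- The matrix with the given column above the diagonal. -/
def colMat (i : Fin n) (β : Finset.Iio i → F) : Matrix (Fin n) (Fin n) F :=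
  Matrix.of fun a b => if h : a ∈ Finset.Iio i ∧ b = i then β ⟨a, h.1⟩ else 0

lemma colMat_apply (i : Fin n) (β : Finset.Iio i → F) (a : Finset.Iio i) :
    colMat i β a i = β a := by
  simp only [colMat, Matrix.of_apply, a.2, true_and, dite_true]

lemma colMat_injective (i : Fin n) : Function.Injective (colMat (F := F) i) := fun β γ h => by
  ext a
  rw [← colMat_apply i β, h, colMat_apply]

lemma Cuspidal.eq_zero_of_wt_zero (hρ : Cuspidal ρ) {i : Fin n} (hi : 1 ≤ i.1) {v : V}
    (hv : v ∈ chain ρ ψ (i.1 + 1)) (h0 : Wt ρ ψ (colP i) 0 v) : v = 0 := by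
  refine hρ (Finset.Iio i) ⟨⟨0, by omega⟩, by rw [Finset.mem_Iio, Fin.lt_def]; exact hi⟩
    ⟨i, by simp⟩ v fun x => ?_
  let T : Subgroup (GL (Fin n) F) := charStab ρ 1 v
  have hT : ∀ g, g ∈ T ↔ ρ g v = v := fun g => by rw [mem_charStab]; simp
  rw [← hT]
  refine un_mask_mem (sq0_blk _) T (fun a b t hab => ?_) x
  rw [hT]
  rw [mem_blk, Finset.mem_Iio, Finset.mem_Iio, not_lt] at hab
  have hs : ∀ c d, (c, d) ∉ colP b → Matrix.single a b t c d = 0 := by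
    intro c d h
    rw [Matrix.single_apply, if_neg]
    rintro ⟨rfl, rfl⟩
    exact h (mem_colP.2 ⟨hab.1.trans_le hab.2, rfl⟩)
  rcases hab.2.eq_or_lt with rfl | hb
  · have := h0.apply hs
    rw [E, this]; simp
  · have := (hv b hb).apply hs
    rw [E, this, trace_transpose_mul_single, superdiag_apply, if_neg]
    · simp
    · have := Fin.lt_def.1 hab.1
      have := Fin.lt_def.1 hb
      omega

lemma exists_GL_row {A : Type*} [Fintype A] [DecidableEq A] (r : A) {β : A → F} (hβ : β ≠ 0) :
    ∃ h : GL A F, (h : Matrix A A F) r = β := by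
  obtain ⟨c, hc⟩ := Function.ne_iff.1 hβ
  obtain ⟨s, hs⟩ := exists_row hc
  refine ⟨Matrix.GeneralLinearGroup.mkOfDetNeZero ((s : Matrix A A F).submatrix
    (Equiv.swap r c) id) ?_, ?_⟩
  · rw [Matrix.det_permute]
    refine mul_ne_zero ?_ ((Matrix.isUnit_iff_isUnit_det _).1 s.isUnit).ne_zero
    rcases Int.units_eq_one_or (Equiv.Perm.sign (Equiv.swap r c)) with h | h <;> simp [h]
  · ext d
    change (s : Matrix A A F) (Equiv.swap r c r) d = β d
    rw [Equiv.swap_apply_left, hs, Matrix.updateRow_self]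

/-- An element of the mirabolic group taking the character `β` of column `i` to the standard one. -/
lemma exists_tailOne (i : Fin n) {β : Finset.Iio i → F} (hβ : β ≠ 0) : ∃ g : GL (Fin n) F,
    TailOne i.1 g ∧ ∀ a c, (a, c) ∈ colP i →
      ((g : Matrix (Fin n) (Fin n) F)ᵀ * superdiag n F) a c = colMat i β a c := by
  have hi : 1 ≤ i.1 := by
    obtain ⟨c, -⟩ := Function.ne_iff.1 hβ
    have := Fin.lt_def.1 (Finset.mem_Iio.1 c.2)
    omega
  let r : Finset.Iio i := ⟨⟨i.1 - 1, by omega⟩, by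
    rw [Finset.mem_Iio, Fin.lt_def]; simp only; omega⟩
  obtain ⟨h, hh⟩ := exists_GL_row r hβ
  refine ⟨emb _ h, tailOne_emb i h, fun a c hac => ?_⟩
  obtain ⟨ha, rfl⟩ := mem_colP.1 hac
  have ha' : a ∈ Finset.Iio c := Finset.mem_Iio.2 ha
  rw [Matrix.mul_apply, Finset.sum_eq_single r.1]
  · rw [Matrix.transpose_apply, superdiag_apply, if_pos, mul_one, coe_emb,
      embMat_apply_mem _ r.2 ha']
    · exact (congrFun hh ⟨a, ha'⟩).trans (colMat_apply c β ⟨a, ha'⟩).symm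
    · simp only [r]; omega
  · intro d _ hd
    rw [superdiag_apply, if_neg, mul_zero]
    intro h
    exact hd (Fin.ext (by simp only [r]; omega))
  · simp

lemma card_ne_zero_fun (i : Fin n) :
    Fintype.card {β : Finset.Iio i → F // β ≠ 0} = Fintype.card F ^ i.1 - 1 := by
  rw [Fintype.card_subtype_compl, Fintype.card_subtype_eq, Fintype.card_fun, Fintype.card_coe,
    Fin.card_Iio]

variable [FiniteDimensional ℂ V]

/-- The column projection onto a nonstandard character, moved to the standard one. -/
lemma wt_conj_proj {i : Fin n} {β : Finset.Iio i → F} {g : GL (Fin n) F} (hg : TailOne i.1 g)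
    (hgβ : ∀ a c, (a, c) ∈ colP i →
      ((g : Matrix (Fin n) (Fin n) F)ᵀ * superdiag n F) a c = colMat i β a c) {v : V}
    (hv : v ∈ chain ρ ψ (i.1 + 1)) (hw : Wt ρ ψ (colP i) (colMat i β) v) :
    ρ g v ∈ chain ρ ψ i.1 := by
  intro b hb
  rcases hb.eq_or_lt with hb | hb
  · obtain rfl : i = b := Fin.ext hb
    exact hg.wt le_rfl (hw.congr fun a c hac => (hgβ a c hac).symm)
  · exact hg.apply_mem_chain hv b hb

lemma Cuspidal.finrank_chain_succ_le (hρ : Cuspidal ρ) (hψ : ψ ≠ 1) {i : Fin n} (hi : 1 ≤ i.1) :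
    Module.finrank ℂ (chain ρ ψ (i.1 + 1)) ≤
      (Fintype.card F ^ i.1 - 1) * Module.finrank ℂ (chain ρ ψ i.1) := by
  choose g hg hgβ using fun β : {β : Finset.Iio i → F // β ≠ 0} => exists_tailOne i β.2
  let α := uChar ρ (colP i) (sq0_colP i)
  have hα : ∀ x, ∀ v ∈ chain ρ ψ (i.1 + 1), α x v ∈ chain ρ ψ (i.1 + 1) := fun x v hv =>
    (tailOne_un i x).apply_mem_chain hv
  have hp : ∀ B, ∀ v ∈ chain ρ ψ (i.1 + 1), proj ψ α B v ∈ chain ρ ψ (i.1 + 1) := fun B v hv =>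
    proj_mem α hα B hv
  let Φ : chain ρ ψ (i.1 + 1) →ₗ[ℂ] ({β : Finset.Iio i → F // β ≠ 0} → chain ρ ψ i.1) :=
    LinearMap.pi fun β => ((ρ (g β) ∘ₗ proj ψ α (colMat i β.1)) ∘ₗ
      (chain ρ ψ (i.1 + 1)).subtype).codRestrict _ fun v =>
        wt_conj_proj (hg β) (hgβ β) (hp _ v v.2) (wt_proj (sq0_colP i) _ _)
  have hΦ : Function.Injective Φ := by
    rw [← LinearMap.ker_eq_bot, LinearMap.ker_eq_bot']
    rintro ⟨v, hv⟩ h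
    by_contra hv0
    obtain ⟨B, hB⟩ := exists_proj_ne_zero α hψ (v := v) fun h0 => hv0 (Subtype.ext h0)
    have hwB : Wt ρ ψ (colP i) B (proj ψ α B v) := wt_proj (sq0_colP i) B v
    set w := proj ψ α B v with hw
    let β : Finset.Iio i → F := fun a => B a i
    have hBβ : ∀ a b, (a, b) ∈ colP i → B a b = colMat i β a b := by
      intro a b hab
      obtain ⟨ha, rfl⟩ := mem_colP.1 hab
      exact (colMat_apply b β ⟨a, Finset.mem_Iio.2 ha⟩).symm
    have hwβ := hwB.congr hBβ
    by_cases hβ : β = 0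
    · refine hB (hρ.eq_zero_of_wt_zero hi (hp B v hv) (hwβ.congr fun a b hab => ?_))
      rw [hβ]
      simp [colMat]
    · have h2 : B = colMat i β := by
        refine matChar_injective hψ ?_
        ext x
        have e1 : α x w = _ := apply_proj α B x v
        have e2 := hwβ x
        rw [trace_mask] at e2
        have e3 : mask (colP i) (colMat i β) = colMat i β := mask_eq_self.2 fun a b hab => by
          simp only [colMat, Matrix.of_apply]
          rw [dif_neg]
          rintro ⟨ha, rfl⟩
          exact hab (mem_colP.2 ⟨Finset.mem_Iio.1 ha, rfl⟩)
        rw [e3] at e2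
        exact smul_left_injective ℂ hB (e1.symm.trans e2)
      have h3 := congrArg Subtype.val (congrFun h ⟨β, hβ⟩)
      change ρ (g ⟨β, hβ⟩) (proj ψ α (colMat i β) v) = 0 at h3
      rw [← h2] at h3
      exact rho_ne_zero hB _ h3
  have := LinearMap.finrank_le_finrank_of_injective hΦ
  rwa [Module.finrank_pi_fintype, Finset.sum_const, Finset.card_univ, card_ne_zero_fun,
    smul_eq_mul] at this

lemma le_finrank_chain_succ (hψ : ψ ≠ 1) (i : Fin n) :
    (Fintype.card F ^ i.1 - 1) * Module.finrank ℂ (chain ρ ψ i.1) ≤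
      Module.finrank ℂ (chain ρ ψ (i.1 + 1)) := by
  choose g hg hgβ using fun β : {β : Finset.Iio i → F // β ≠ 0} => exists_tailOne i β.2
  let α := uChar ρ (colP i) (sq0_colP i)
  let Ψ : ({β : Finset.Iio i → F // β ≠ 0} → chain ρ ψ i.1) →ₗ[ℂ] chain ρ ψ (i.1 + 1) :=
    (∑ β, (ρ (g β)⁻¹ ∘ₗ (chain ρ ψ i.1).subtype) ∘ₗ LinearMap.proj β).codRestrict _ fun w => by
      rw [LinearMap.sum_apply]
      exact Submodule.sum_mem _ fun β _ =>
        (hg β).inv.apply_mem_chain (chain_le_succ _ (w β).2)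
  have hΨ : Function.Injective Ψ := by
    rw [← LinearMap.ker_eq_bot, LinearMap.ker_eq_bot']
    intro w hw
    ext γ
    have h0 : (∑ β, ρ (g β)⁻¹ (w β : V)) = 0 := by
      have := congrArg Subtype.val hw
      rw [LinearMap.codRestrict_apply, LinearMap.sum_apply] at this
      exact this
    have h1 : ∀ β, Wt ρ ψ (colP i) (colMat i β.1) (ρ (g β)⁻¹ (w β : V)) := by
      intro β
      refine (hg β).inv.wt le_rfl (((w β).2 i le_rfl).congr fun a c hac => ?_)
      have e : ∀ a c, (a, c) ∈ colP i → ((g β : Matrix (Fin n) (Fin n) F)ᵀ * superdiag n F) a c =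
        colMat i β.1 a c := hgβ β
      have e2 : superdiag n F = (((g β)⁻¹ : GL (Fin n) F) : Matrix (Fin n) (Fin n) F)ᵀ *
          ((g β : Matrix (Fin n) (Fin n) F)ᵀ * superdiag n F) := by
        rw [← Matrix.mul_assoc, ← Matrix.transpose_mul, ← Units.val_mul, mul_inv_cancel,
          Units.val_one, Matrix.transpose_one, Matrix.one_mul]
      conv_lhs => rw [e2]
      rw [Matrix.mul_apply, Matrix.mul_apply]
      obtain ⟨ha, rfl⟩ := mem_colP.1 hac
      refine Finset.sum_congr rfl fun d _ => ?_
      by_cases hd : d < c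
      · rw [e d c (mem_colP.2 ⟨hd, rfl⟩)]
      · rw [Matrix.transpose_apply, (hg β).inv d (not_lt.1 hd), Matrix.one_apply, if_neg]
        · simp
        · rintro rfl
          exact hd ha
    have h2 : ∀ β, proj ψ α (colMat i γ.1) (ρ (g β)⁻¹ (w β : V)) =
        if β = γ then ρ (g β)⁻¹ (w β : V) else 0 := by
      intro β
      rw [proj_of_weight α hψ (C := colMat i β.1)]
      · simp only [(colMat_injective i).eq_iff, Subtype.ext_iff]
      · intro x
        have e2 := h1 β x
        rw [trace_mask] at e2
        have e3 : mask (colP i) (colMat i β.1) = colMat i β.1 := mask_eq_self.2 fun a b hab => by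
          simp only [colMat, Matrix.of_apply]
          rw [dif_neg]
          rintro ⟨ha, rfl⟩
          exact hab (mem_colP.2 ⟨Finset.mem_Iio.1 ha, rfl⟩)
        rwa [e3] at e2
    have h3 := congrArg (proj ψ α (colMat i γ.1)) h0
    rw [map_sum, map_zero, Finset.sum_congr rfl fun β _ => h2 β, Finset.sum_ite_eq'] at h3
    rw [if_pos (Finset.mem_univ _)] at h3
    by_contra hne
    exact rho_ne_zero (ρ := ρ) (v := (w γ : V)) (fun h => hne (by simpa using h)) _ h3
  have := LinearMap.finrank_le_finrank_of_injective hΨ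
  rwa [Module.finrank_pi_fintype, Finset.sum_const, Finset.card_univ, card_ne_zero_fun,
    smul_eq_mul] at this

lemma prod_mul_finrank_chain_le (hψ : ψ ≠ 1) {i : ℕ} (d : ℕ) (hd : i + d ≤ n) :
    (∏ j ∈ Finset.range d, (Fintype.card F ^ (i + j) - 1)) * Module.finrank ℂ (chain ρ ψ i) ≤
      Module.finrank ℂ (chain ρ ψ (i + d)) := by
  induction d with
  | zero => simp
  | succ d ih =>
    have h1 := le_finrank_chain_succ (ρ := ρ) hψ ⟨i + d, by omega⟩
    rw [Finset.prod_range_succ, mul_right_comm, mul_comm]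
    exact (Nat.mul_le_mul_left _ (ih (by omega))).trans h1

lemma Cuspidal.finrank_chain_le (hρ : Cuspidal ρ) (hψ : ψ ≠ 1) {i : ℕ} (hi : 1 ≤ i) (d : ℕ)
    (hd : i + d ≤ n) : Module.finrank ℂ (chain ρ ψ (i + d)) ≤
      (∏ j ∈ Finset.range d, (Fintype.card F ^ (i + j) - 1)) *
        Module.finrank ℂ (chain ρ ψ i) := by
  induction d with
  | zero => simp
  | succ d ih =>
    have h1 := hρ.finrank_chain_succ_le hψ (i := ⟨i + d, by omega⟩) (by simp only; omega)
    rw [Finset.prod_range_succ, mul_right_comm, mul_comm]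
    exact h1.trans (Nat.mul_le_mul_left _ (ih (by omega)))

end Chain

section MultiplicityOne

variable {G V : Type*} [Group G] [Fintype G] [AddCommGroup V] [Module ℂ V]
  (ρ : Representation ℂ G V)

lemma Irr.eq_top_of_forall_mem {ρ : Representation ℂ G V} (hρ : Irr ρ) {S : Submodule ℂ V} {v : V}
    (hv : v ≠ 0) (h : ∀ g, ρ g v ∈ S) : S = ⊤ := by
  let T : Submodule ℂ V := Submodule.span ℂ (Set.range fun g => ρ g v)
  have hT : T = ⊤ := by
    refine hρ.2 T ?_ ((Submodule.ne_bot_iff _).2 ⟨v, Submodule.subset_span ⟨1, by simp⟩, hv⟩)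
    intro g _ w hw
    refine (Submodule.span_le (p := T.comap (ρ g))).2 ?_ hw
    rintro _ ⟨h, rfl⟩
    exact Submodule.subset_span ⟨g * h, by simp⟩
  rw [eq_top_iff, ← hT]
  refine Submodule.span_le.2 ?_
  rintro _ ⟨g, rfl⟩
  exact h g

/-- If the compressions of an irreducible representation to the range of an idempotent commute,
then this range is at most one-dimensional. -/
lemma Irr.finrank_range_le_one [FiniteDimensional ℂ V] {ρ : Representation ℂ G V} (hρ : Irr ρ)
    {e : Module.End ℂ V} (he : ∀ v, e (e v) = e v)
    (hc : ∀ g h v, e (ρ g (e (ρ h (e v)))) = e (ρ h (e (ρ g (e v))))) :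
    Module.finrank ℂ (LinearMap.range e) ≤ 1 := by
  have hfix : ∀ v ∈ LinearMap.range e, e v = v := by
    rintro _ ⟨v, rfl⟩; exact he v
  have key : ∀ S : Submodule ℂ V, ∀ v ≠ 0, (∀ g, e (ρ g v) ∈ S) → LinearMap.range e ≤ S := by
    rintro S v hv h _ ⟨w, rfl⟩
    have : S.comap e = ⊤ := hρ.eq_top_of_forall_mem hv fun g => h g
    have hw : w ∈ S.comap e := this ▸ trivial
    exact hw
  by_cases h0 : LinearMap.range e = ⊥
  · rw [h0]; simp
  have : Nontrivial (LinearMap.range e) := Submodule.nontrivial_iff_ne_bot.2 h0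
  have hscalar : ∀ g, ∃ μ : ℂ, ∀ v ∈ LinearMap.range e, e (ρ g v) = μ • v := by
    intro g
    let T : Module.End ℂ (LinearMap.range e) := (e ∘ₗ ρ g).restrict fun v _ => ⟨ρ g v, rfl⟩
    obtain ⟨μ, hμ⟩ := Module.End.exists_eigenvalue T
    obtain ⟨v, hv, hv0⟩ := hμ.exists_hasEigenvector
    rw [Module.End.mem_eigenspace_iff] at hv
    have hv' : e (ρ g v) = μ • (v : V) := congrArg Subtype.val hv
    refine ⟨μ, fun w hw => ?_⟩
    let S : Submodule ℂ V := LinearMap.ker (e ∘ₗ ρ g ∘ₗ e - μ • e)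
    have hS : ∀ x, x ∈ S ↔ e (ρ g (e x)) = μ • e x := fun x => by
      simp only [S, LinearMap.mem_ker, LinearMap.sub_apply, LinearMap.comp_apply,
        LinearMap.smul_apply, sub_eq_zero]
    have h1 := key S (v : V) (fun h => hv0 (Subtype.ext h)) (fun h => by
      rw [hS, he]
      have := hc g h v
      rw [hfix v v.2] at this
      rw [this, hv']
      simp)
    have h2 := (hS w).1 (h1 hw)
    rwa [hfix w hw] at h2
  obtain ⟨v, hv, hv0⟩ := (Submodule.ne_bot_iff _).1 h0
  have h1 := key (Submodule.span ℂ {v}) v hv0 fun g => by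
    obtain ⟨μ, hμ⟩ := hscalar g
    rw [hμ v hv]
    exact Submodule.smul_mem _ _ (Submodule.mem_span_singleton_self v)
  exact (Submodule.finrank_mono h1).trans (finrank_span_le_card _ |>.trans (by simp))

variable {N : Subgroup G} (Θ : N →* ℂ)

/-- The averaging projection onto the vectors on which `N` acts by `Θ`. -/
noncomputable def avg : Module.End ℂ V :=
  (Fintype.card N : ℂ)⁻¹ • ∑ u : N, Θ u⁻¹ • ρ u

lemma avg_apply (v : V) :
    avg ρ Θ v = (Fintype.card N : ℂ)⁻¹ • ∑ u : N, Θ u⁻¹ • ρ u v := by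
  simp [avg, LinearMap.sum_apply]

variable {ρ Θ}

lemma map_inv_mul_map (u : N) : Θ u⁻¹ * Θ u = 1 := by
  rw [← map_mul, inv_mul_cancel, map_one]

lemma rho_avg (u : N) (v : V) : ρ u (avg ρ Θ v) = Θ u • avg ρ Θ v := by
  simp only [avg_apply, map_smul, map_sum]
  rw [smul_comm (Θ u)]
  congr 1
  rw [Finset.smul_sum]
  rw [← Equiv.sum_comp (Equiv.mulLeft u) fun w => Θ u • Θ w⁻¹ • ρ w v]
  refine Finset.sum_congr rfl fun w _ => ?_
  rw [Equiv.coe_mulLeft, _root_.mul_inv_rev, map_mul, smul_smul, mul_comm (Θ w⁻¹), ← mul_assoc,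
    mul_comm (Θ u), map_inv_mul_map, one_mul]
  simp

lemma avg_rho (u : N) (v : V) : avg ρ Θ (ρ u v) = Θ u • avg ρ Θ v := by
  simp only [avg_apply]
  rw [smul_comm (Θ u)]
  congr 1
  rw [Finset.smul_sum]
  rw [← Equiv.sum_comp (Equiv.mulRight u) fun w => Θ u • Θ w⁻¹ • ρ w v]
  refine Finset.sum_congr rfl fun w _ => ?_
  rw [Equiv.coe_mulRight, _root_.mul_inv_rev, map_mul, smul_smul, ← mul_assoc,
    mul_comm (Θ u), map_inv_mul_map, one_mul]
  simp

lemma avg_eq_self {v : V} (h : ∀ u : N, ρ u v = Θ u • v) : avg ρ Θ v = v := by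
  simp only [avg_apply, h, smul_smul, map_inv_mul_map, one_smul, Finset.sum_const,
    Finset.card_univ]
  rw [← Nat.cast_smul_eq_nsmul ℂ, smul_smul, inv_mul_cancel₀, one_smul]
  exact Nat.cast_ne_zero.2 Fintype.card_ne_zero

lemma avg_avg (v : V) : avg ρ Θ (avg ρ Θ v) = avg ρ Θ v :=
  avg_eq_self fun u => rho_avg u v

/-- The Gelfand–Kazhdan argument: an anti-involution fixing the compressed operators makes them
commute. -/
lemma avg_commute {θ : G → G} (hθ : ∀ g h, θ (g * h) = θ h * θ g) (hθθ : ∀ g, θ (θ g) = g)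
    (hN : ∀ u ∈ N, θ u ∈ N) (hΘ : ∀ u : N, Θ ⟨θ u, hN u u.2⟩ = Θ u)
    (hX : ∀ g v, avg ρ Θ (ρ (θ g) (avg ρ Θ v)) = avg ρ Θ (ρ g (avg ρ Θ v))) (g h : G) (v : V) :
    avg ρ Θ (ρ g (avg ρ Θ (ρ h (avg ρ Θ v)))) = avg ρ Θ (ρ h (avg ρ Θ (ρ g (avg ρ Θ v)))) := by
  have hprod : ∀ g h, avg ρ Θ (ρ g (avg ρ Θ (ρ h (avg ρ Θ v)))) =
      (Fintype.card N : ℂ)⁻¹ • ∑ u : N, Θ u⁻¹ • avg ρ Θ (ρ (g * u * h) (avg ρ Θ v)) := by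
    intro g h
    rw [avg_apply ρ Θ (ρ h _), map_smul, map_smul, map_sum, map_sum]
    simp only [map_smul, map_mul, Module.End.mul_apply]
  let σ : N ≃ N := (show Function.Involutive fun u : N => (⟨θ u, hN u u.2⟩ : N) from
    fun u => Subtype.ext (hθθ u)).toPerm
  have h1 : θ 1 = 1 := by
    have := hθ 1 (θ 1)
    rw [one_mul, hθθ, one_mul] at this
    exact this.symm
  have hinv : ∀ u : N, Θ (σ u)⁻¹ = Θ u⁻¹ := by
    intro u
    rw [← hΘ u⁻¹]
    congr 1
    rw [inv_eq_iff_mul_eq_one]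
    ext
    change θ u * θ (u⁻¹ : N) = 1
    rw [← hθ]
    simp [h1]
  rw [← hX g, ← hX h v, hprod (θ g) (θ h), hprod h g]
  congr 1
  rw [← Equiv.sum_comp σ (fun u => Θ u⁻¹ • avg ρ Θ (ρ (h * u * g) (avg ρ Θ v)))]
  refine Finset.sum_congr rfl fun u _ => ?_
  rw [hinv, ← hX (h * σ u * g), hθ, hθ]
  change _ = Θ u⁻¹ • avg ρ Θ (ρ (θ g * (θ (θ u) * θ h)) (avg ρ Θ v))
  rw [hθθ, mul_assoc]

/-- The compressed operator of `g` is determined by a double coset representative `m` fixed by the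
anti-involution, and vanishes if `Θ` separates two elements intertwined by `m`. -/
lemma avg_anti_eq {θ : G → G} (hθ : ∀ g h, θ (g * h) = θ h * θ g)
    (hN : ∀ u ∈ N, θ u ∈ N) (hΘ : ∀ u : N, Θ ⟨θ u, hN u u.2⟩ = Θ u) {g m : G} (u w : N)
    (hg : g = u * m * w) (h : θ m = m ∨ ∃ x y : N, (x : G) * m = m * y ∧ Θ x ≠ Θ y) (v : V) :
    avg ρ Θ (ρ (θ g) (avg ρ Θ v)) = avg ρ Θ (ρ g (avg ρ Θ v)) := by
  have hmul : ∀ (a b : N) (k : G), avg ρ Θ (ρ (a * k * b) (avg ρ Θ v)) =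
      (Θ a * Θ b) • avg ρ Θ (ρ k (avg ρ Θ v)) := by
    intro a b k
    rw [map_mul, map_mul, Module.End.mul_apply, Module.End.mul_apply, rho_avg, map_smul, map_smul,
      map_smul, avg_rho, smul_smul, mul_comm (Θ b)]
  have hz : ∀ (k : G) (x y : N), (x : G) * k = k * y → Θ x ≠ Θ y →
      avg ρ Θ (ρ k (avg ρ Θ v)) = 0 := by
    intro k x y hxy hne
    have h1 := hmul x 1 k
    have h2 := hmul 1 y k
    simp only [OneMemClass.coe_one, mul_one, one_mul, map_one] at h1 h2
    rw [hxy, h2] at h1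
    by_contra h0
    exact hne (smul_left_injective ℂ h0 h1).symm
  have e : θ g = (⟨θ w, hN w w.2⟩ : N) * θ m * (⟨θ u, hN u u.2⟩ : N) := by
    rw [hg, hθ, hθ, mul_assoc]
  rw [e, hg, hmul, hmul, hΘ, hΘ, mul_comm (Θ w)]
  rcases h with h | ⟨x, y, hxy, hne⟩
  · rw [h]
  · rw [hz m x y hxy hne, hz (θ m) ⟨θ y, hN y y.2⟩ ⟨θ x, hN x x.2⟩ ?_ (by rw [hΘ, hΘ]; exact hne.symm)]
    rw [← hθ, ← hθ, hxy]

end MultiplicityOne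

section Runs

variable {n : ℕ} {F : Type*}

/-- If every ascent of `π` is by one and preserves `t`, then every `i < j` with `π i < π j` spans
an interval on which `π` is a translation. -/
lemma run_of_ascents {π : Equiv.Perm (Fin n)} {t : Fin n → F}
    (H : ∀ i j : Fin n, i.1 + 1 = j.1 → π i < π j → (π j).1 = (π i).1 + 1 ∧ t j = t i)
    (d : ℕ) : ∀ i j : Fin n, i.1 + d = j.1 → π i ≤ π j →
      ∀ l : Fin n, i ≤ l → l ≤ j → (π l).1 = (π i).1 + (l.1 - i.1) ∧ t l = t i := by
  induction d with
  | zero =>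
    intro i j hij _ l hl hl'
    obtain rfl : l = i := Fin.ext (by simp only [Fin.le_def] at hl hl'; omega)
    simp
  | succ d ih =>
    intro i j hij hπ l hl hl'
    have hπ' : π i < π j := lt_of_le_of_ne hπ fun h => by
      have := π.injective h
      rw [this] at hij; omega
    let m : Fin n := ⟨i.1 + d, by omega⟩
    have hmj : m.1 + 1 = j.1 := by simp only [m]; omega
    have hmne : m ≠ j := fun h => by rw [h] at hmj; omega
    by_cases hm : π i ≤ π m
    · have hrun := ih i m rfl hm
      have hjm : π m < π j := by
        by_contra hcon
        rw [not_lt, Fin.le_def] at hcon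
        rw [Fin.lt_def] at hπ'
        have hmm := (hrun m (by rw [Fin.le_def]; simp only [m]; omega) le_rfl).1
        have hmv : m.1 = i.1 + d := rfl
        let l' : Fin n := ⟨i.1 + ((π j).1 - (π i).1), by omega⟩
        have h1 := (hrun l' (by rw [Fin.le_def]; simp only [l']; omega)
          (by rw [Fin.le_def]; simp only [l']; omega)).1
        have h2 : π l' = π j := Fin.ext (by rw [h1]; simp only [l']; omega)
        have h3 := congrArg Fin.val (π.injective h2)
        simp only [l'] at h3
        omega
      obtain ⟨h1, h2⟩ := H m j hmj hjm
      have hmm := hrun m (by rw [Fin.le_def]; simp only [m]; omega) le_rfl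
      have hmv : m.1 = i.1 + d := rfl
      rcases hl'.eq_or_lt with rfl | hlt
      · rw [h1, h2, hmm.2]
        exact ⟨by omega, rfl⟩
      · exact hrun l hl (by rw [Fin.lt_def] at hlt; rw [Fin.le_def]; omega)
    · rw [not_le] at hm
      obtain ⟨h1, h2⟩ := H m j hmj (hm.trans hπ')
      rw [Fin.lt_def] at hm hπ'
      omega

/-- Permutations all of whose ascents are by one are symmetric under the antidiagonal flip. -/
lemma flip_of_ascents {π : Equiv.Perm (Fin n)} {t : Fin n → F}
    (H : ∀ i j : Fin n, i.1 + 1 = j.1 → π i < π j → (π j).1 = (π i).1 + 1 ∧ t j = t i)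
    (j : Fin n) : π (Fin.rev (π j)) = Fin.rev j ∧ t (Fin.rev (π j)) = t j := by
  have run := fun (i l : Fin n) (h : i ≤ l) (hπ : π i ≤ π l) =>
    run_of_ascents H (l.1 - i.1) i l (by rw [Fin.le_def] at h; omega) hπ
  let S := Finset.univ.filter fun i => i < j ∧ π i < π j
  let T := Finset.univ.filter fun i => j < i ∧ π j < π i
  let T' := Finset.univ.filter fun i => j < i ∧ π i < π j
  have hcount : S.card + T'.card = (π j).1 := by
    have h1 : (Finset.univ.filter fun i => π i < π j).card = (π j).1 := by
      rw [← Fin.card_Iio (π j), ← Finset.card_map π.toEmbedding]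
      congr 1
      ext a
      simp only [Finset.mem_map, Finset.mem_filter, Finset.mem_univ, true_and, Finset.mem_Iio]
      constructor
      · rintro ⟨b, hb, rfl⟩; exact hb
      · intro h; exact ⟨π.symm a, by simpa using h, by simp⟩
    rw [← h1, ← Finset.card_union_of_disjoint]
    · congr 1
      ext i
      simp only [S, T', Finset.mem_union, Finset.mem_filter, Finset.mem_univ, true_and]
      constructor
      · rintro (h | h) <;> exact h.2
      · intro h
        rcases lt_trichotomy i j with h' | rfl | h'
        · exact Or.inl ⟨h', h⟩
        · exact absurd h (lt_irrefl _)
        · exact Or.inr ⟨h', h⟩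
    · rw [Finset.disjoint_left]
      intro i hi hi'
      simp only [S, T', Finset.mem_filter] at hi hi'
      exact absurd hi.2.1 (not_lt.2 hi'.2.1.le)
  have hcount' : T.card + T'.card = n - 1 - j.1 := by
    rw [← Fin.card_Ioi j, ← Finset.card_union_of_disjoint]
    · congr 1
      ext i
      simp only [T, T', Finset.mem_union, Finset.mem_filter, Finset.mem_univ, true_and,
        Finset.mem_Ioi]
      constructor
      · rintro (h | h) <;> exact h.1
      · intro h
        rcases lt_trichotomy (π i) (π j) with h' | h' | h'
        · exact Or.inr ⟨h, h'⟩
        · exact absurd (π.injective h') h.ne'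
        · exact Or.inl ⟨h, h'⟩
    · rw [Finset.disjoint_left]
      intro i hi hi'
      simp only [T, T', Finset.mem_filter] at hi hi'
      exact absurd hi.2.2 (not_lt.2 hi'.2.2.le)
  have hrev : (Fin.rev (π j)).1 + S.card = j.1 + T.card := by
    rw [Fin.val_rev]; omega
  obtain ⟨l, hl⟩ : ∃ l, l = Fin.rev (π j) := ⟨_, rfl⟩
  rw [← hl] at hrev ⊢
  have hlπ : l.1 + (π j).1 + 1 = n := by rw [hl, Fin.val_rev]; omega
  rcases lt_trichotomy S.card T.card with h | h | h
  · have hT : T.Nonempty := Finset.card_pos.1 (by omega)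
    obtain ⟨hm1, hm2⟩ := (Finset.mem_filter.1 (T.max'_mem hT)).2
    set m := T.max' hT
    have hsub : T ⊆ Finset.Ioc j m := fun i hi =>
      Finset.mem_Ioc.2 ⟨(Finset.mem_filter.1 hi).2.1, T.le_max' i hi⟩
    have hcard := Finset.card_le_card hsub
    rw [Fin.card_Ioc] at hcard
    have := run j m hm1.le hm2.le l (by rw [Fin.le_def]; omega) (by rw [Fin.le_def]; omega)
    refine ⟨Fin.ext ?_, this.2⟩
    rw [this.1, Fin.val_rev]; omega
  · have hlj : l = j := Fin.ext (by omega)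
    rw [hlj] at hlπ ⊢
    exact ⟨Fin.ext (by rw [Fin.val_rev]; omega), rfl⟩
  · have hS : S.Nonempty := Finset.card_pos.1 (by omega)
    obtain ⟨hm1, hm2⟩ := (Finset.mem_filter.1 (S.min'_mem hS)).2
    set m := S.min' hS
    have hsub : S ⊆ Finset.Ico m j := fun i hi =>
      Finset.mem_Ico.2 ⟨S.min'_le i hi, (Finset.mem_filter.1 hi).2.1⟩
    have hcard := Finset.card_le_card hsub
    rw [Fin.card_Ico] at hcard
    have h1 := run m j hm1.le hm2.le l (by rw [Fin.le_def]; omega) (by rw [Fin.le_def]; omega)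
    have h2 := run m j hm1.le hm2.le j hm1.le le_rfl
    refine ⟨Fin.ext ?_, h1.2.trans h2.2.symm⟩
    rw [h1.1, Fin.val_rev]
    have := h2.1
    rw [Fin.lt_def] at hm1
    omega

end Runs

section Unitriangular

variable {n : ℕ} {F V : Type*} [Field F] [Fintype F] [AddCommGroup V] [Module ℂ V]

lemma unitriangular_mul_apply {g h : Matrix (Fin n) (Fin n) F}
    (hg : ∀ a b, b ≤ a → g a b = (1 : Matrix (Fin n) (Fin n) F) a b)
    (hh : ∀ a b, b ≤ a → h a b = (1 : Matrix (Fin n) (Fin n) F) a b) {a b : Fin n}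
    (hab : b ≤ a) : (g * h) a b = (1 : Matrix (Fin n) (Fin n) F) a b := by
  rw [Matrix.mul_apply, Finset.sum_eq_single a]
  · rw [hg a a le_rfl, Matrix.one_apply_eq, one_mul, hh a b hab]
  · intro c _ hc
    rcases lt_or_gt_of_ne hc with h' | h'
    · rw [hg a c h'.le, Matrix.one_apply_ne hc.symm, zero_mul]
    · rw [hh c b (hab.trans h'.le), Matrix.one_apply_ne (hab.trans_lt h').ne', mul_zero]
  · simp

variable (n F) in
/-- The group of upper unitriangular matrices. -/
def uni : Subgroup (GL (Fin n) F) where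
  carrier := {g | ∀ a b, b ≤ a →
    (g : Matrix (Fin n) (Fin n) F) a b = (1 : Matrix (Fin n) (Fin n) F) a b}
  mul_mem' hg hh _ _ hab := unitriangular_mul_apply hg hh hab
  one_mem' _ _ _ := rfl
  inv_mem' {g} hg := by
    have h : ∀ m : ℕ, ∀ a b, b ≤ a →
        ((g ^ m : GL (Fin n) F) : Matrix (Fin n) (Fin n) F) a b =
          (1 : Matrix (Fin n) (Fin n) F) a b := by
      intro m
      induction m with
      | zero => intro a b _; rw [pow_zero]; rfl
      | succ m ih =>
        intro a b hab
        rw [pow_succ, Units.val_mul]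
        exact unitriangular_mul_apply ih hg hab
    have e : g⁻¹ = g ^ (Fintype.card (GL (Fin n) F) - 1) := by
      rw [inv_eq_iff_mul_eq_one, ← pow_succ', Nat.sub_add_cancel Fintype.card_pos, pow_card_eq_one]
    rw [e]
    exact h _

/-- The standard nondegenerate character of the unitriangular group. -/
noncomputable def uniChar (ψ : AddChar F ℂ) : uni n F →* ℂ where
  toFun u := ψ ((superdiag n F)ᵀ * ((u : GL (Fin n) F) : Matrix (Fin n) (Fin n) F)).trace
  map_one' := by
    have : ((superdiag n F)ᵀ * (1 : Matrix (Fin n) (Fin n) F)).trace = 0 := by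
      rw [trace_transpose_mul]
      refine Finset.sum_eq_zero fun a _ => Finset.sum_eq_zero fun b _ => ?_
      rw [superdiag_apply, Matrix.one_apply]
      split_ifs with h1 h2
      · rw [h2] at h1; omega
      all_goals simp
    change ψ ((superdiag n F)ᵀ * (1 : Matrix (Fin n) (Fin n) F)).trace = 1
    rw [this, AddChar.map_zero_eq_one]
  map_mul' g h := by
    rw [← AddChar.map_add_eq_mul]
    congr 1
    simp only [trace_transpose_mul, ← Finset.sum_add_distrib]
    refine Finset.sum_congr rfl fun a _ => Finset.sum_congr rfl fun b _ => ?_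
    rw [superdiag_apply]
    split_ifs with hab
    · have hne : a ≠ b := fun h => by rw [h] at hab; omega
      rw [one_mul, one_mul, one_mul, Subgroup.coe_mul, Units.val_mul, Matrix.mul_apply,
        Finset.sum_eq_add a b hne]
      · rw [g.2 a a le_rfl, h.2 b b le_rfl]
        simp [add_comm]
      · rintro c - ⟨hca, hcb⟩
        rcases lt_or_gt_of_ne hca with h' | h'
        · rw [g.2 a c h'.le, Matrix.one_apply_ne hca.symm, zero_mul]
        · have : b ≤ c := by rw [Fin.le_def]; rw [Fin.lt_def] at h'; omega
          rw [h.2 c b this, Matrix.one_apply_ne hcb, mul_zero]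
      · simp
      · simp
    · simp

lemma uniChar_apply (ψ : AddChar F ℂ) (u : uni n F) : uniChar ψ u =
    ψ ((superdiag n F)ᵀ * ((u : GL (Fin n) F) : Matrix (Fin n) (Fin n) F)).trace := rfl

lemma un_mask_colP_mem_uni (c : Fin n) (x : Matrix (Fin n) (Fin n) F) :
    un (mask (colP c) x) ∈ uni n F := by
  intro a b hab
  rw [coe_un (mask_mul_mask (sq0_colP c) _ _), Matrix.add_apply, mask_apply, if_neg, add_zero]
  rw [mem_colP]
  rintro ⟨h, rfl⟩
  exact absurd h (not_lt.2 hab)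

lemma uniChar_un_mask (ψ : AddChar F ℂ) (c : Fin n) (x : Matrix (Fin n) (Fin n) F) :
    uniChar ψ ⟨un (mask (colP c) x), un_mask_colP_mem_uni c x⟩ =
      ψ ((superdiag n F)ᵀ * mask (colP c) x).trace := by
  have h1 := map_one (uniChar (n := n) ψ)
  rw [uniChar_apply] at h1 ⊢
  simp only [coe_un (mask_mul_mask (sq0_colP c) _ _), Matrix.mul_add, Matrix.trace_add,
    AddChar.map_add_eq_mul]
  change ψ ((superdiag n F)ᵀ * 1).trace = 1 at h1
  rw [h1, one_mul]

lemma mem_chain_one_iff {ρ : Representation ℂ (GL (Fin n) F) V} {ψ : AddChar F ℂ} {v : V} :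
    v ∈ chain ρ ψ 1 ↔ ∀ u : uni n F, ρ u v = uniChar ψ u • v := by
  constructor
  · intro hv
    have key : ∀ d : ℕ, ∀ u : uni n F, (∀ a b : Fin n, d ≤ b.1 →
        ((u : GL (Fin n) F) : Matrix (Fin n) (Fin n) F) a b = (1 : Matrix (Fin n) (Fin n) F) a b) →
        ρ u v = uniChar ψ u • v := by
      intro d
      induction d with
      | zero =>
        intro u hu
        have : u = 1 := by
          ext a b
          exact hu a b (Nat.zero_le _)
        rw [this]; simp
      | succ d ih =>
        intro u hu
        by_cases hd : d < n
        · let c : Fin n := ⟨d, hd⟩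
          let x := (u : GL (Fin n) F).1
          let m := mask (colP c) x
          have hmm : m * m = 0 := mask_mul_mask (sq0_colP c) _ _
          let w : uni n F := ⟨un m, un_mask_colP_mem_uni c x⟩
          have hmu : m * x = m := by
            ext a b
            rw [Matrix.mul_apply, Finset.sum_eq_single c]
            · have hx : x c b = (1 : Matrix (Fin n) (Fin n) F) c b := by
                rcases le_or_gt b c with h | h
                · exact u.2 c b h
                · exact hu c b h
              rw [hx, Matrix.one_apply]
              split_ifs with h
              · rw [← h, mul_one]
              · rw [mul_zero, show m a b = _ from mask_apply _ _ _ _,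
                  if_neg (fun h' => h (mem_colP.1 h').2.symm)]
            · intro e _ he
              rw [show m a e = _ from mask_apply _ _ _ _, if_neg (fun h' => he (mem_colP.1 h').2),
                zero_mul]
            · simp
          have e1 : ((w⁻¹ * u : uni n F) : GL (Fin n) F).1 = x - m := by
            have : (w⁻¹ : uni n F).1.1 = 1 + -m := by
              change ((un m)⁻¹ : GL (Fin n) F).1 = _
              rw [un_inv hmm, coe_un (by rw [neg_mul_neg, hmm])]
            rw [Subgroup.coe_mul, Units.val_mul, this, add_mul, one_mul, neg_mul]
            change x + -(m * x) = _
            rw [hmu, sub_eq_add_neg]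
          have e2 := ih (w⁻¹ * u) fun a b hb => by
            rw [e1, Matrix.sub_apply, show m a b = _ from mask_apply _ _ _ _]
            rcases hb.eq_or_lt with hb | hb
            · obtain rfl : c = b := Fin.ext hb
              rcases lt_or_ge a c with h | h
              · rw [if_pos (mem_colP.2 ⟨h, rfl⟩), sub_self, Matrix.one_apply_ne h.ne]
              · rw [if_neg (fun h' => absurd (mem_colP.1 h').1 (not_lt.2 h)), sub_zero]
                exact u.2 a c h
            · rw [if_neg, sub_zero]
              · exact hu a b hb
              · intro h'
                rw [(mem_colP.1 h').2] at hb
                exact lt_irrefl _ hb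
          have e3 : ρ w v = uniChar ψ w • v := by
            by_cases h1 : 1 ≤ d
            · exact (hv c h1 x).trans (by rw [uniChar_un_mask])
            · have hm0 : m = 0 := by
                ext a b
                rw [show m a b = _ from mask_apply _ _ _ _, if_neg]
                · rfl
                · intro h'
                  have := (mem_colP.1 h').1
                  rw [Fin.lt_def] at this
                  simp only [c] at this
                  omega
              have : w = 1 := Subtype.ext (by
                change un m = 1
                rw [hm0, un_zero])
              rw [this]; simp
          have e4 : u = w * (w⁻¹ * u) := by group
          rw [e4, Subgroup.coe_mul, rho_mul_apply, e2, map_smul, e3, smul_smul, ← map_mul,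
            map_mul, mul_comm, ← map_mul]
        · exact ih u fun a b hb => absurd b.2 (by omega)
    exact fun u => key n u fun a b hb => absurd b.2 (by omega)
  · intro h b _ x
    rw [← uniChar_un_mask]
    exact h ⟨_, un_mask_colP_mem_uni b x⟩

/-- The transpose along the antidiagonal. -/
def antiflip (g : GL (Fin n) F) : GL (Fin n) F :=
  ⟨(g : Matrix (Fin n) (Fin n) F)ᵀ.submatrix Fin.revPerm Fin.revPerm,
    ((g⁻¹ : GL (Fin n) F) : Matrix (Fin n) (Fin n) F)ᵀ.submatrix Fin.revPerm Fin.revPerm,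
    by rw [Matrix.submatrix_mul_equiv, ← Matrix.transpose_mul, ← Units.val_mul]; simp,
    by rw [Matrix.submatrix_mul_equiv, ← Matrix.transpose_mul, ← Units.val_mul]; simp⟩

lemma coe_antiflip (g : GL (Fin n) F) (a b : Fin n) :
    (antiflip g : Matrix (Fin n) (Fin n) F) a b = (g : Matrix (Fin n) (Fin n) F) b.rev a.rev := rfl

lemma antiflip_mul (g h : GL (Fin n) F) : antiflip (g * h) = antiflip h * antiflip g := by
  ext1
  change ((g * h : GL (Fin n) F) : Matrix (Fin n) (Fin n) F)ᵀ.submatrix _ _ =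
    (h : Matrix (Fin n) (Fin n) F)ᵀ.submatrix _ _ * (g : Matrix (Fin n) (Fin n) F)ᵀ.submatrix _ _
  rw [Matrix.submatrix_mul_equiv, ← Matrix.transpose_mul, Units.val_mul]

lemma antiflip_antiflip (g : GL (Fin n) F) : antiflip (antiflip g) = g := by
  ext a b
  rw [coe_antiflip, coe_antiflip, Fin.rev_rev, Fin.rev_rev]

lemma antiflip_mem_uni {g : GL (Fin n) F} (hg : g ∈ uni n F) : antiflip g ∈ uni n F := by
  intro a b hab
  rw [coe_antiflip, hg _ _ (Fin.rev_le_rev.2 hab), Matrix.one_apply, Matrix.one_apply]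
  simp only [Fin.rev_inj, eq_comm]

lemma uniChar_antiflip (ψ : AddChar F ℂ) (u : uni n F) :
    uniChar ψ ⟨antiflip (u : GL (Fin n) F), antiflip_mem_uni u.2⟩ = uniChar ψ u := by
  rw [uniChar_apply, uniChar_apply, trace_transpose_mul, trace_transpose_mul, Finset.sum_comm]
  congr 1
  rw [← Equiv.sum_comp Fin.revPerm]
  refine Finset.sum_congr rfl fun a _ => ?_
  rw [← Equiv.sum_comp Fin.revPerm]
  refine Finset.sum_congr rfl fun b _ => ?_
  rw [Fin.revPerm_apply, Fin.revPerm_apply, coe_antiflip, Fin.rev_rev, Fin.rev_rev, superdiag_apply,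
    superdiag_apply]
  congr 2
  rw [eq_iff_iff, Fin.val_rev, Fin.val_rev]
  omega

end Unitriangular

section Bruhat

variable {n : ℕ} {F V : Type*} [Field F] [Fintype F] [AddCommGroup V] [Module ℂ V]

/-- Up to unitriangular factors, the first `c` columns of an invertible matrix are monomial. -/
lemma exists_uni_monomial_columns (g : GL (Fin n) F) (c : ℕ) (hc : c ≤ n) :
    ∃ u ∈ uni n F, ∃ w ∈ uni n F, ∃ p : Fin n → Fin n, ∀ j : Fin n, j.1 < c →
      (∀ a, a ≠ p j → (u * g * w : GL (Fin n) F).1 a j = 0) ∧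
      (∀ b, b ≠ j → (u * g * w : GL (Fin n) F).1 (p j) b = 0) := by
  induction c with
  | zero => exact ⟨1, one_mem _, 1, one_mem _, id, fun j hj => absurd hj (by omega)⟩
  | succ c ih =>
    obtain ⟨u, hu, w, hw, p, hp⟩ := ih (by omega)
    set h := u * g * w with hh
    let j : Fin n := ⟨c, by omega⟩
    let S := Finset.univ.filter fun a => h.1 a j ≠ 0
    have hS : S.Nonempty := by
      by_contra hcon
      rw [Finset.not_nonempty_iff_eq_empty, Finset.filter_eq_empty_iff] at hcon
      have := Matrix.det_eq_zero_of_column_eq_zero (A := h.1) j fun a => by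
        simpa using hcon (Finset.mem_univ a)
      exact ((Matrix.isUnit_iff_isUnit_det _).1 h.isUnit).ne_zero this
    set r := S.max' hS with hr
    have hrj : h.1 r j ≠ 0 := (Finset.mem_filter.1 (S.max'_mem hS)).2
    have hbelow : ∀ a, r < a → h.1 a j = 0 := by
      intro a ha
      by_contra hne
      exact absurd (S.le_max' a (Finset.mem_filter.2 ⟨Finset.mem_univ _, hne⟩)) (not_le.2 ha)
    have hjlt : ∀ i : Fin n, i.1 < c → i ≠ j := fun i hi e => by
      rw [e] at hi; exact lt_irrefl _ hi
    have hrp : ∀ i : Fin n, i.1 < c → r ≠ p i := fun i hi e =>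
      hrj (by rw [e]; exact (hp i hi).2 j (hjlt i hi).symm)
    let x : Matrix (Fin n) (Fin n) F := Matrix.of fun a b => if a < r ∧ b = r then
      -(h.1 a j / h.1 r j) else 0
    have hx : ∀ a b, x a b = if a < r ∧ b = r then -(h.1 a j / h.1 r j) else 0 := fun _ _ => rfl
    let y : Matrix (Fin n) (Fin n) F := Matrix.of fun a b => if a = j ∧ j < b then
      -(h.1 r b / h.1 r j) else 0
    have hy : ∀ a b, y a b = if a = j ∧ j < b then -(h.1 r b / h.1 r j) else 0 := fun _ _ => rfl
    have hxx : x * x = 0 := by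
      ext a b
      rw [Matrix.mul_apply]
      refine Finset.sum_eq_zero fun d _ => ?_
      rw [hx a d, hx d b]
      split_ifs with h1 h2
      · exact absurd h2.1 (h1.2 ▸ lt_irrefl _)
      all_goals simp
    have hyy : y * y = 0 := by
      ext a b
      rw [Matrix.mul_apply]
      refine Finset.sum_eq_zero fun d _ => ?_
      rw [hy a d, hy d b]
      split_ifs with h1 h2
      · exact absurd h1.2 (h2.1 ▸ lt_irrefl _)
      all_goals simp
    have hxu : un x ∈ uni n F := by
      intro a b hab
      rw [coe_un hxx, Matrix.add_apply, hx, if_neg, add_zero]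
      rintro ⟨h1, rfl⟩
      exact absurd h1 (not_lt.2 hab)
    have hyu : un y ∈ uni n F := by
      intro a b hab
      rw [coe_un hyy, Matrix.add_apply, hy, if_neg, add_zero]
      rintro ⟨rfl, h1⟩
      exact absurd h1 (not_lt.2 hab)
    have hmulx : ∀ (M : Matrix (Fin n) (Fin n) F) a b, (x * M) a b =
        (if a < r then -(h.1 a j / h.1 r j) else 0) * M r b := by
      intro M a b
      rw [Matrix.mul_apply, Finset.sum_eq_single r]
      · rw [hx]; simp
      · intro d _ hd
        rw [hx, if_neg (fun h' => hd h'.2), zero_mul]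
      · simp
    have hmuly : ∀ (M : Matrix (Fin n) (Fin n) F) a b, (M * y) a b =
        M a j * (if j < b then -(h.1 r b / h.1 r j) else 0) := by
      intro M a b
      rw [Matrix.mul_apply, Finset.sum_eq_single j]
      · rw [hy]; simp
      · intro d _ hd
        rw [hy, if_neg (fun h' => hd h'.1), mul_zero]
      · simp
    have e : (un x * u * g * (w * un y) : GL (Fin n) F) = un x * h * un y := by
      rw [hh]; group
    have hcol : ∀ a, (h.1 + x * h.1) a j = if a = r then h.1 r j else 0 := by
      intro a
      rw [Matrix.add_apply, hmulx]
      split_ifs with h1 h2 h2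
      · exact absurd h1 (h2 ▸ lt_irrefl _)
      · field_simp; ring
      · rw [h2]; simp
      · rw [hbelow a (lt_of_le_of_ne (not_lt.1 h1) (Ne.symm h2))]; simp
    have hval : ∀ a b, (un x * h * un y : GL (Fin n) F).1 a b =
        (h.1 a b + (if a < r then -(h.1 a j / h.1 r j) else 0) * h.1 r b) +
          (if a = r then h.1 r j else 0) * (if j < b then -(h.1 r b / h.1 r j) else 0) := by
      intro a b
      rw [Units.val_mul, Units.val_mul, coe_un hxx, coe_un hyy, add_mul, one_mul, mul_add, mul_one,
        Matrix.add_apply, hmuly, hcol, Matrix.add_apply, hmulx]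
    refine ⟨un x * u, mul_mem hxu hu, w * un y, mul_mem hw hyu, Function.update p j r, ?_⟩
    intro i hi
    rw [e]
    rcases (Nat.lt_succ_iff.1 hi).eq_or_lt with hi | hi
    · obtain rfl : i = j := Fin.ext hi
      rw [Function.update_self]
      constructor
      · intro a ha
        have := hcol a
        rw [Matrix.add_apply, hmulx, if_neg ha] at this
        rw [hval, this]
        simp
      · intro b hb
        rw [hval]
        simp only [lt_irrefl, if_false, zero_mul, add_zero, if_true]
        rcases lt_or_gt_of_ne hb with h' | h'
        · rw [(hp b (Fin.lt_def.1 h')).1 r (hrp b (Fin.lt_def.1 h'))]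
          simp
        · rw [if_pos h']; field_simp; ring
    · rw [Function.update_of_ne (hjlt i hi)]
      have hri : h.1 r i = 0 := (hp i hi).1 r (hrp i hi)
      constructor
      · intro a ha
        rw [hval, (hp i hi).1 a ha, hri]
        simp
      · intro b hb
        rw [hval, (hp i hi).2 b hb, (hp i hi).2 j (hjlt i hi).symm, if_neg (hrp i hi).symm]
        simp

/-- Bruhat decomposition: up to unitriangular factors an invertible matrix is monomial. -/
lemma exists_uni_monomial (g : GL (Fin n) F) : ∃ u ∈ uni n F, ∃ w ∈ uni n F,
    ∃ (π : Equiv.Perm (Fin n)) (t : Fin n → F), (∀ j, t j ≠ 0) ∧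
      ∀ a b, (u * g * w : GL (Fin n) F).1 a b = if a = π b then t b else 0 := by
  obtain ⟨u, hu, w, hw, p, hp⟩ := exists_uni_monomial_columns g n le_rfl
  set h := u * g * w
  have h0 : ∀ j, h.1 (p j) j ≠ 0 := by
    intro j hj
    have := Matrix.det_eq_zero_of_column_eq_zero (A := h.1) j fun a => by
      by_cases ha : a = p j
      · rw [ha, hj]
      · exact (hp j j.2).1 a ha
    exact ((Matrix.isUnit_iff_isUnit_det _).1 h.isUnit).ne_zero this
  have hinj : Function.Injective p := by
    intro i j hij
    by_contra hne
    exact h0 i (by rw [hij]; exact (hp j j.2).2 i hne)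
  refine ⟨u, hu, w, hw, Equiv.ofBijective p (Finite.injective_iff_bijective.1 hinj),
    fun j => h.1 (p j) j, h0, fun a b => ?_⟩
  rw [Equiv.ofBijective_apply]
  split_ifs with hab
  · rw [hab]
  · exact (hp b b.2).1 a hab

/-- A monomial matrix is either fixed by the antidiagonal transpose or intertwines two
unitriangular elements with different character values. -/
lemma monomial_dichotomy {ψ : AddChar F ℂ} (hψ : ψ ≠ 1) {m : GL (Fin n) F}
    {π : Equiv.Perm (Fin n)} {t : Fin n → F} (ht : ∀ j, t j ≠ 0)
    (hm : ∀ a b, m.1 a b = if a = π b then t b else 0) :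
    antiflip m = m ∨ ∃ x y : uni n F, (x : GL (Fin n) F) * m = m * y ∧
      uniChar ψ x ≠ uniChar ψ y := by
  by_cases H : ∀ i j : Fin n, i.1 + 1 = j.1 → π i < π j → (π j).1 = (π i).1 + 1 ∧ t j = t i
  · left
    have hfl := flip_of_ascents H
    have hinv : ∀ j, Fin.rev (π (Fin.rev (π j))) = j := fun j => by rw [(hfl j).1, Fin.rev_rev]
    ext a b
    rw [coe_antiflip, hm, hm]
    by_cases hab : a = π b
    · rw [if_pos hab, hab, (hfl b).1, if_pos rfl, (hfl b).2]
    · rw [if_neg hab, if_neg]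
      intro h
      apply hab
      have h1 : Fin.rev b = π (Fin.rev a) := h
      have h2 := hinv (Fin.rev a)
      rw [← h1, Fin.rev_rev] at h2
      exact (Fin.rev_injective h2).symm
  · right
    push Not at H
    obtain ⟨i, j, hij, hπ, hne⟩ := H
    have hijlt : i < j := by rw [Fin.lt_def]; omega
    have hE : ∀ {a b : Fin n}, a < b → ∀ s : F, E a b s ∈ uni n F := by
      intro a b hab s c d hcd
      rw [coe_E hab.ne, Matrix.add_apply, Matrix.single_apply, if_neg, add_zero]
      rintro ⟨rfl, rfl⟩
      exact absurd hab (not_lt.2 hcd)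
    have hchar : ∀ {a b : Fin n} (hab : a < b) (s : F), uniChar ψ ⟨E a b s, hE hab s⟩ =
        ψ (superdiag n F a b * s) := by
      intro a b hab s
      have h1 := map_one (uniChar (n := n) ψ)
      rw [uniChar_apply] at h1 ⊢
      simp only [coe_E hab.ne, Matrix.mul_add, Matrix.trace_add, AddChar.map_add_eq_mul,
        trace_transpose_mul_single]
      change ψ ((superdiag n F)ᵀ * 1).trace = 1 at h1
      rw [h1, one_mul]
    by_contra! hcon
    have h1 : ∀ s, ψ (superdiag n F (π i) (π j) * s) = ψ (t j / t i * s) := by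
      intro s
      have h2 := hcon ⟨E (π i) (π j) s, hE hπ s⟩ ⟨E i j (t j / t i * s), hE hijlt _⟩ (by
        ext1
        change (E (π i) (π j) s).1 * m.1 = m.1 * (E i j (t j / t i * s)).1
        rw [coe_E hπ.ne, coe_E hijlt.ne, add_mul, mul_add, one_mul, mul_one]
        congr 1
        ext a b
        have hL : (Matrix.single (π i) (π j) s * m.1) a b =
            if a = π i then s * m.1 (π j) b else 0 := by
          by_cases h : a = π i
          · rw [if_pos h, h, Matrix.single_mul_apply_same]
          · rw [if_neg h, Matrix.single_mul_apply_of_ne _ _ _ _ _ h]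
        have hR : (m.1 * Matrix.single i j (t j / t i * s)) a b =
            if b = j then m.1 a i * (t j / t i * s) else 0 := by
          by_cases h : b = j
          · rw [if_pos h, h, Matrix.mul_single_apply_same]
          · rw [if_neg h, Matrix.mul_single_apply_of_ne _ _ _ _ _ h]
        rw [hL, hR, hm, hm]
        by_cases ha : a = π i <;> by_cases hb : b = j
        · have := ht i
          rw [if_pos ha, if_pos hb, if_pos ha, hb, if_pos rfl]
          field_simp
        · rw [if_pos ha, if_neg hb, if_neg fun h => hb (π.injective h).symm, mul_zero]
        · rw [if_neg ha, if_pos hb, if_neg ha, zero_mul]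
        · rw [if_neg ha, if_neg hb])
      rw [hchar hπ, hchar hijlt, superdiag_apply i j, if_pos hij, one_mul] at h2
      exact h2
    have h2 := addChar_mul_injective hψ h1
    rw [superdiag_apply] at h2
    split_ifs at h2 with h3
    · have h4 := hne h3.symm
      apply h4
      field_simp [ht i] at h2
      exact h2.symm
    · exact div_ne_zero (ht j) (ht i) h2.symm

/-- Uniqueness of Whittaker vectors. -/
lemma Irr.finrank_chain_one_le [FiniteDimensional ℂ V] {ρ : Representation ℂ (GL (Fin n) F) V}
    (hρ : Irr ρ) {ψ : AddChar F ℂ} (hψ : ψ ≠ 1) : Module.finrank ℂ (chain ρ ψ 1) ≤ 1 := by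
  have hle : chain ρ ψ 1 ≤ LinearMap.range (avg ρ (uniChar (n := n) ψ)) := fun v hv =>
    ⟨v, avg_eq_self (mem_chain_one_iff.1 hv)⟩
  refine (Submodule.finrank_mono hle).trans (hρ.finrank_range_le_one avg_avg
    (avg_commute antiflip_mul antiflip_antiflip (fun u hu => antiflip_mem_uni hu)
      (uniChar_antiflip ψ) fun g v => ?_))
  obtain ⟨u, hu, w, hw, π, t, ht, hm⟩ := exists_uni_monomial g
  refine avg_anti_eq antiflip_mul (fun u hu => antiflip_mem_uni hu) (uniChar_antiflip ψ)
    (m := u * g * w) (⟨u, hu⟩⁻¹) (⟨w, hw⟩⁻¹) ?_ (monomial_dichotomy hψ ht hm) v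
  simp only [InvMemClass.coe_inv]
  group

end Bruhat

section ParabolicFactor

variable {I F : Type*} [Fintype I] [DecidableEq I] [Field F] [Fintype F]

lemma exists_eq_mul_emb_compl {W : Finset I} {g : GL I F} (hg : g ∈ par W) :
    ∃ r ∈ rowGroup (F := F) W, ∃ h : GL (Wᶜ : Finset I) F, g = r * emb Wᶜ h := by
  have key : ∀ {g g' : GL I F}, g ∈ par W → g * g' = 1 →
      (g : Matrix I I F).submatrix ((↑) : (Wᶜ : Finset I) → I) (↑) *
        (g' : Matrix I I F).submatrix (↑) ((↑) : (Wᶜ : Finset I) → I) = 1 := by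
    intro g g' hg hgg
    ext a b
    have h1 : ((g : Matrix I I F) * g') a b = (1 : Matrix I I F) a b := by
      rw [← Units.val_mul, hgg, Units.val_one]
    rw [Matrix.mul_apply, ← Finset.sum_subset (Finset.subset_univ (Wᶜ)) fun c _ hc => by
      rw [mem_par.1 hg a (Finset.mem_compl.1 a.2) c (by simpa using hc), zero_mul],
      ← Finset.sum_coe_sort] at h1
    rw [Matrix.mul_apply, Matrix.one_apply]
    simp only [Matrix.submatrix_apply]
    rw [h1, Matrix.one_apply]
    simp only [Subtype.ext_iff]
  let h : GL (Wᶜ : Finset I) F := ⟨(g : Matrix I I F).submatrix (↑) (↑),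
    (↑g⁻¹ : Matrix I I F).submatrix (↑) (↑), key hg (mul_inv_cancel g),
    key (inv_mem hg) (inv_mul_cancel g)⟩
  refine ⟨g * (emb Wᶜ h)⁻¹, fun a ha b => ?_, h, by group⟩
  have h1 : ∀ c, (g : Matrix I I F) a c = (emb Wᶜ h : Matrix I I F) a c := by
    intro c
    by_cases hc : c ∈ W
    · rw [mem_par.1 hg a ha c hc, coe_emb, embMat_apply_right _ _ (by simpa using hc),
        Matrix.one_apply_ne]
      rintro rfl; exact ha hc
    · rw [coe_emb, embMat_apply_mem _ (by simpa using ha) (by simpa using hc)]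
      rfl
  rw [Units.val_mul, Matrix.mul_apply]
  simp only [h1]
  rw [← Matrix.mul_apply, ← Units.val_mul, mul_inv_cancel, Units.val_one]

lemma emb_mul_emb_compl (W : Finset I) (g : GL W F) (h : GL (Wᶜ : Finset I) F) :
    emb W g * emb Wᶜ h = emb Wᶜ h * emb W g := by
  have key : ∀ (M : Matrix W W F) (N : Matrix (Wᶜ : Finset I) (Wᶜ : Finset I) F),
      extMat W M * extMat Wᶜ N = 0 ∧ extMat Wᶜ N * extMat W M = 0 := by
    intro M N
    constructor <;>
    · ext a b
      rw [Matrix.mul_apply, Matrix.zero_apply]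
      refine Finset.sum_eq_zero fun c _ => ?_
      by_cases hc : c ∈ W <;> simp [extMat, hc]
  ext1
  rw [Units.val_mul, Units.val_mul, coe_emb, coe_emb]
  obtain ⟨M, hM⟩ : ∃ M, (g : Matrix W W F) = 1 + M := ⟨(g : Matrix _ _ F) - 1, by simp⟩
  obtain ⟨N, hN⟩ : ∃ N, (h : Matrix (Wᶜ : Finset I) (Wᶜ : Finset I) F) = 1 + N :=
    ⟨(h : Matrix _ _ F) - 1, by simp⟩
  rw [hM, hN, embMat_one_add, embMat_one_add, add_mul, mul_add, mul_add, add_mul, mul_add, mul_add,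
    (key M N).1, (key M N).2]
  simp only [mul_one, one_mul]
  abel

end ParabolicFactor

section SmallSubGL

variable {F : Type} [Field F] [Fintype F]

variable (F) in
/-- The dimension bound for irreducible representations of `GL j F`. -/
noncomputable def irrBound (j : ℕ) : ℝ := (Fintype.card F : ℝ) ^ (j.choose 2) * ratio F ^ (j * j)

lemma irrBound_nonneg (j : ℕ) : 0 ≤ irrBound F j := by
  have := one_le_ratio (F := F)
  unfold irrBound
  positivity

lemma add_choose_two (a b : ℕ) : (a + b).choose 2 = a.choose 2 + b.choose 2 + a * b := by
  induction b with
  | zero => simp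
  | succ b ih =>
    rw [← add_assoc, Nat.choose_succ_succ' (a + b) 1, ih, Nat.choose_succ_succ' b 1]
    simp only [Nat.choose_one_right]
    ring

lemma mul_irrBound_le (w : ℕ) {a : ℕ} (ha : 0 < a) :
    (Fintype.card F : ℝ) ^ (w * a) * ratio F ^ w * (irrBound F w * irrBound F a) ≤
      irrBound F (w + a) := by
  have e1 : (Fintype.card F : ℝ) ^ (w * a) * ratio F ^ w * (irrBound F w * irrBound F a) =
      (Fintype.card F : ℝ) ^ ((w + a).choose 2) * ratio F ^ (w + w * w + a * a) := by
    rw [add_choose_two]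
    unfold irrBound
    ring
  rw [e1]
  unfold irrBound
  refine mul_le_mul_of_nonneg_left (pow_le_pow_right₀ one_le_ratio ?_) (by positivity)
  nlinarith

lemma prod_card_pow_le (n : ℕ) : ∏ j ∈ Finset.range n, (Fintype.card F ^ (1 + j) - 1) ≤
    Fintype.card F ^ ((n + 1).choose 2) := by
  induction n with
  | zero => simp
  | succ n ih =>
    rw [Finset.prod_range_succ, Nat.choose_succ_succ' (n + 1) 1, Nat.choose_one_right,
      pow_add _ (n + 1), mul_comm, add_comm 1 n]
    exact Nat.mul_le_mul (Nat.sub_le _ _) ih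

lemma HasSmallSub.of_equiv_index {I J : Type} [Fintype I] [DecidableEq I] [Fintype J]
    [DecidableEq J] (e : I ≃ J) {d : ℝ} (h : HasSmallSub (GL I F) d) : HasSmallSub (GL J F) d :=
  h.of_equiv (Units.mapEquiv (Matrix.reindexAlgEquiv F F e).toMulEquiv)

lemma hasSmallSub_GL_fin {ψ : AddChar F ℂ} (hψ : ψ ≠ 1) (n : ℕ) :
    HasSmallSub (GL (Fin n) F) (irrBound F n) := by
  have hr := one_le_ratio (F := F)
  have hq := one_lt_card (F := F)
  induction n using Nat.strong_induction_on with
  | _ n ih =>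
  have ih' : ∀ A : Finset (Fin n), A.card < n → HasSmallSub (GL A F) (irrBound F A.card) :=
    fun A hA => (ih _ hA).of_equiv_index A.equivFin.symm
  intro V _ _ _ _ ρ
  by_cases hρ : Cuspidal ρ
  · obtain ⟨S, hS, hirr⟩ := exists_minimal_stable ρ
    have := hirr.1
    refine ⟨S, Submodule.nontrivial_iff_ne_bot.1 hirr.1, hS, ?_⟩
    set σ := Subrepresentation.toRepresentation (ρ := ρ) ⟨S, fun g _ hv => hS g trivial _ hv⟩
    have hσ : Cuspidal σ := fun W h1 h2 v hv => by
      have := hρ W h1 h2 v fun x => congrArg Subtype.val (hv x)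
      exact Subtype.ext this
    have h1 := hirr.finrank_chain_one_le hψ
    have h2 : Module.finrank ℂ S ≤ Fintype.card F ^ (n.choose 2) := by
      rcases n with _ | n
      · have h3 : chain σ ψ 1 = ⊤ := by
          rw [eq_top_iff, ← chain_eq_top (ρ := σ) (ψ := ψ)]
          exact chain_mono (by omega)
        rw [h3, finrank_top] at h1
        simpa using h1
      · have h3 := hσ.finrank_chain_le hψ (i := 1) le_rfl n (by omega)
        rw [add_comm 1 n, chain_eq_top, finrank_top] at h3
        exact h3.trans ((Nat.mul_le_mul (prod_card_pow_le n) h1).trans_eq (mul_one _))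
    calc (Module.finrank ℂ S : ℝ) ≤ (Fintype.card F : ℝ) ^ (n.choose 2) := by exact_mod_cast h2
      _ ≤ _ := le_mul_of_one_le_right (by positivity) (one_le_pow₀ hr)
  · unfold Cuspidal at hρ
    push Not at hρ
    obtain ⟨W, hW, hWc, v, hv, hv0⟩ := hρ
    have hcard : W.card + (Wᶜ).card = n := by rw [Finset.card_add_card_compl, Fintype.card_fin]
    have hWpos := hW.card_pos
    have hWcpos := hWc.card_pos
    let S : Submodule ℂ V :=
      { carrier := {v | Wt ρ ψ (blk W) 0 v}
        add_mem' := fun {a b} ha hb x => by rw [map_add, ha x, hb x, smul_add]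
        zero_mem' := fun x => by rw [map_zero, smul_zero]
        smul_mem' := fun c a ha x => by rw [map_smul, ha x, smul_comm] }
    have hfix : ∀ v ∈ S, ∀ x, ρ (un (mask (blk W) x)) v = v := fun v hv x => by
      have : Wt ρ ψ (blk W) 0 v := hv
      rw [this x]; simp
    have hSst : ∀ g : GL (Fin n) F, BlockDiag W (g : Matrix _ _ F) → ∀ v ∈ S, ρ g v ∈ S := by
      intro g hg v hv
      have := Wt.conj (h := hv) hg
      rw [Matrix.mul_zero, Matrix.zero_mul] at this
      exact this
    have hS : S ≠ ⊥ := (Submodule.ne_bot_iff _).2 ⟨v, fun x => by rw [hv x]; simp, hv0⟩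
    obtain ⟨T, hTS, hT, hT1, hT2, hTd⟩ := (ih' W (by omega)).exists_le_of_commute
      (ih' Wᶜ (by omega)) (irrBound_nonneg _)
      (ρ.comp (emb W) : Representation ℂ _ V) (ρ.comp (emb Wᶜ) : Representation ℂ _ V)
      (fun g g' v => by
        change ρ _ (ρ _ v) = ρ _ (ρ _ v)
        rw [← rho_mul_apply, emb_mul_emb_compl, rho_mul_apply]) hS
      (fun g _ v hv => hSst _ (blockDiag_embMat _ _) v hv)
      (fun g _ v hv => hSst _ (fun a b h => by
        have := blockDiag_embMat Wᶜ _ a b h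
        simpa [not_iff_not] using this) v hv)
    have hTp : StableUnder ρ (par W : Subgroup (GL (Fin n) F)) T := by
      intro g hg v hv
      obtain ⟨r, hr, h, rfl⟩ := exists_eq_mul_emb_compl hg
      obtain ⟨h', e⟩ := eq_un_mul_emb hr
      rw [e, mul_assoc, rho_mul_apply, rho_mul_apply]
      have := hT1 h' trivial _ (hT2 h trivial v hv)
      exact (hfix _ (hTS this) r).symm ▸ this
    refine ⟨⨆ g, T.map (ρ g), ?_, stableUnder_iSup_map T, ?_⟩
    · intro h0
      exact hT (eq_bot_iff.2 ((le_iSup_map T).trans h0.le))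
    have h1 : (Module.finrank ℂ (⨆ g, T.map (ρ g) : Submodule ℂ V) : ℝ) ≤
        Nat.card (GL (Fin n) F ⧸ par (F := F) W) * Module.finrank ℂ T := by
      exact_mod_cast finrank_iSup_map_le hTp
    refine h1.trans ((mul_le_mul (index_par_le W) hTd (Nat.cast_nonneg _) (by positivity)).trans ?_)
    exact (mul_irrBound_le _ hWcpos).trans_eq (congrArg _ hcard)

lemma hasSmallSub_GL {ψ : AddChar F ℂ} (hψ : ψ ≠ 1) {I : Type} [Fintype I] [DecidableEq I] :
    HasSmallSub (GL I F) (irrBound F (Fintype.card I)) :=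
  (hasSmallSub_GL_fin hψ _).of_equiv_index (Fintype.equivFin I).symm

end SmallSubGL

section UpperBound

variable {F : Type} [Field F] [Fintype F] {I : Type} [Fintype I] [DecidableEq I]
  {V : Type} [AddCommGroup V] [Module ℂ V] {ρ : Representation ℂ (GL I F) V} {ψ : AddChar F ℂ}

lemma Irr.tw (h : Irr ρ) : Irr (tw ρ) :=
  ⟨h.1, fun S hS hS0 => h.2 S (fun g _ v hv => by
    have := hS (invT g) trivial v hv
    rwa [tw_apply, invT_invT] at this) hS0⟩

lemma Irr.finrank_le_of_subT [FiniteDimensional ℂ V] (hρ : Irr ρ) (hψ : ψ ≠ 1) {W : Finset I}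
    {χ : Fˣ →* ℂ} {v : V} (hv : v ≠ 0) (h : SubT ρ W χ v) :
    (Module.finrank ℂ V : ℝ) ≤ (Fintype.card F : ℝ) ^ (W.card * (Wᶜ).card) * ratio F ^ W.card *
      irrBound F (Wᶜ).card := by
  have : Nontrivial (subTSpace ρ W χ) := ⟨⟨v, h⟩, 0, fun e => hv (congrArg Subtype.val e)⟩
  obtain ⟨S, hS, hst, hd⟩ := hasSmallSub_GL hψ (subTSpace ρ W χ) (leviRep ρ W χ)
  rw [Fintype.card_coe] at hd
  let T := S.map (subTSpace ρ W χ).subtype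
  have hTd : (Module.finrank ℂ T : ℝ) ≤ irrBound F (Wᶜ).card := by
    rwa [Submodule.finrank_map_subtype_eq]
  have hTp : StableUnder ρ (par W : Subgroup (GL I F)) T := by
    rintro g hg _ ⟨v, hv, rfl⟩
    obtain ⟨r, hr, h, rfl⟩ := exists_eq_mul_emb_compl hg
    rw [rho_mul_apply]
    have h1 : ρ (emb Wᶜ h) ((subTSpace ρ W χ).subtype v) ∈ T :=
      ⟨leviRep ρ W χ h v, hst h trivial v hv, rfl⟩
    have h2 : SubT ρ W χ (ρ (emb Wᶜ h) ((subTSpace ρ W χ).subtype v)) :=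
      Submodule.map_subtype_le _ _ h1
    rw [h2 r hr]
    exact T.smul_mem _ h1
  have htop : (⨆ g, T.map (ρ g)) = ⊤ := by
    refine hρ.2 _ (stableUnder_iSup_map T) fun h0 => hS ?_
    have h1 : T = ⊥ := eq_bot_iff.2 ((le_iSup_map T).trans h0.le)
    exact Submodule.map_injective_of_injective (Submodule.injective_subtype _)
      (h1.trans (Submodule.map_bot _).symm)
  have h1 : (Module.finrank ℂ (⨆ g, T.map (ρ g) : Submodule ℂ V) : ℝ) ≤
      Nat.card (GL I F ⧸ par (F := F) W) * Module.finrank ℂ T := by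
    exact_mod_cast finrank_iSup_map_le hTp
  rw [htop, finrank_top] at h1
  have hr := one_le_ratio (F := F)
  exact h1.trans (mul_le_mul (index_par_le W) hTd (Nat.cast_nonneg _) (by positivity))

/-- The dimension bound for irreducible representations of low rank. -/
lemma Irr.finrank_le_of_not_hasRank [FiniteDimensional ℂ V] (hρ : Irr ρ) (hψ : ψ ≠ 1)
    (hq : 3 ≤ Fintype.card F) {n k : ℕ} (hn : Fintype.card I = n) (hk : ¬ HasRank ρ ψ (k + 1))
    (hkn : 2 * k + 2 ≤ n) :
    (Module.finrank ℂ V : ℝ) ≤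
      (Fintype.card F : ℝ) ^ (k * (n - k) + k.choose 2) * ratio F ^ (n + n * n) := by
  have := hρ.1
  have hr := one_le_ratio (F := F)
  obtain ⟨W, χ, v, hW, hv, h⟩ := exists_subT_or_subT_tw hψ hq hk (by omega)
  have h1 : (Module.finrank ℂ V : ℝ) ≤ (Fintype.card F : ℝ) ^ (W.card * (Wᶜ).card) *
      ratio F ^ W.card * irrBound F (Wᶜ).card := by
    rcases h with h | h
    · exact hρ.finrank_le_of_subT hψ hv h
    · exact hρ.tw.finrank_le_of_subT hψ hv h
  have hcard : W.card + (Wᶜ).card = n := by rw [Finset.card_add_card_compl, hn]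
  obtain ⟨w, hw⟩ : ∃ w, w = W.card := ⟨_, rfl⟩
  obtain ⟨a, ha⟩ : ∃ a, a = (Wᶜ).card := ⟨_, rfl⟩
  rw [← hw, ← ha] at h1
  rw [← hw, ← ha] at hcard
  rw [hn, ← hw] at hW
  have e1 : w * a + a.choose 2 ≤ k * (n - k) + k.choose 2 := by
    have h2 := add_choose_two w a
    have h3 := add_choose_two k (n - k)
    have h4 : (n - k).choose 2 ≤ w.choose 2 := Nat.choose_le_choose 2 (by omega)
    rw [hcard] at h2
    rw [Nat.add_sub_cancel' (by omega)] at h3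
    omega
  calc (Module.finrank ℂ V : ℝ) ≤ _ := h1
    _ = (Fintype.card F : ℝ) ^ (w * a + a.choose 2) * ratio F ^ (w + a * a) := by
      unfold irrBound; ring
    _ ≤ _ := mul_le_mul
      (pow_le_pow_right₀ one_lt_card.le e1)
      (pow_le_pow_right₀ hr (Nat.add_le_add (by omega) (Nat.mul_le_mul (by omega) (by omega))))
      (by positivity) (by positivity)

end UpperBound

section LowerBound

variable {I F V : Type*} [Fintype I] [DecidableEq I] [Field F] [Fintype F]
  [AddCommGroup V] [Module ℂ V] {ρ : Representation ℂ (GL I F) V} {ψ : AddChar F ℂ}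

/-- Nonzero vectors of distinct weights are linearly independent. -/
lemma linearIndependent_of_wt (hψ : ψ ≠ 1) {P : Finset (I × I)} (hP : Sq0 P) {ι : Type*}
    {B : ι → Matrix I I F} {v : ι → V} (hv : ∀ i, v i ≠ 0) (h : ∀ i, Wt ρ ψ P (B i) (v i))
    (hB : ∀ i j, (∀ a b, (a, b) ∈ P → B i a b = B j a b) → i = j) : LinearIndependent ℂ v := by
  rw [linearIndependent_iff']
  intro s c hc i hi
  have h1 : ∀ j, proj ψ (uChar ρ P hP) (mask P (B i)) (v j) = if j = i then v j else 0 := by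
    intro j
    rw [proj_of_weight (uChar ρ P hP) hψ (C := mask P (B j))]
    · by_cases hji : j = i
      · rw [if_pos hji, if_pos (by rw [hji])]
      · rw [if_neg hji, if_neg]
        intro e
        refine hji (hB j i fun a b hab => ?_)
        have := congrFun (congrFun e a) b
        rwa [mask_apply, mask_apply, if_pos hab, if_pos hab] at this
    · intro x
      rw [uChar_apply, h j x, trace_mask]
  have h2 := congrArg (proj ψ (uChar ρ P hP) (mask P (B i))) hc
  rw [map_sum, map_zero, Finset.sum_eq_single i] at h2
  · rw [map_smul, h1, if_pos rfl] at h2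
    exact (smul_eq_zero.1 h2).resolve_right (hv i)
  · intro j _ hj
    rw [map_smul, h1, if_neg hj, smul_zero]
  · exact fun h => absurd hi h

lemma HasRank.card_pow_le [FiniteDimensional ℂ V] (hψ : ψ ≠ 1) {k : ℕ} (h : HasRank ρ ψ k) {n : ℕ}
    (hn : Fintype.card I = n) : (Fintype.card F : ℝ) ^ (k * (n - k)) ≤
      (Module.finrank ℂ V : ℝ) * ratio F ^ (n - k) := by
  obtain ⟨X, Y, hX, hY, hXY, v, hv, hw⟩ := h
  obtain ⟨C, hC⟩ : ∃ C : Finset I, C = (Finset.univ.image Y)ᶜ := ⟨_, rfl⟩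
  rw [← hC] at hw
  have hXC : ∀ j, X j ∈ C := fun j => by simpa [hC] using fun i => (hXY j i).symm
  have hYC : ∀ j, Y j ∉ C := fun j => by simp [hC]
  have hCcard : C.card = n - k := by
    rw [hC, Finset.card_compl, hn, Finset.card_image_of_injective _ hY, Finset.card_univ,
      Fintype.card_fin]
  let X' : Fin k → C := fun j => ⟨X j, hXC j⟩
  have hX' : Function.Injective X' := fun i j e => hX (congrArg Subtype.val e)
  have hk : k ≤ n - k := by
    have := Fintype.card_le_of_injective X' hX'
    rwa [Fintype.card_fin, Fintype.card_coe, hCcard] at this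
  let R : GL C F → Fin k → C → F := fun g j a => (↑g⁻¹ : Matrix C C F) (X' j) a
  have hwt : ∀ g : GL C F, Wt ρ ψ (blk C) ((↑(emb C g)⁻¹ : Matrix I I F)ᵀ * matching X Y *
      (emb C g : Matrix I I F)ᵀ) (ρ (emb C g) v) := fun g => hw.conj (blockDiag_embMat _ _)
  have hval : ∀ (g : GL C F) (j : Fin k) (a : C), ((↑(emb C g)⁻¹ : Matrix I I F)ᵀ * matching X Y *
      (emb C g : Matrix I I F)ᵀ : Matrix I I F) a (Y j) = R g j a := by
    intro g j a
    rw [Matrix.mul_apply, Finset.sum_eq_single (Y j), Matrix.mul_apply, Finset.sum_eq_single (X j)]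
    · rw [Matrix.transpose_apply, Matrix.transpose_apply, matching_apply hY, if_pos rfl, mul_one,
        coe_emb, embMat_apply_left _ _ (hYC j), Matrix.one_apply_eq, mul_one, ← map_inv, coe_emb,
        embMat_apply_mem _ (hXC j) a.2]
    · intro d _ hd
      rw [matching_apply hY, if_neg hd, mul_zero]
    · simp
    · intro c _ hc
      rw [Matrix.transpose_apply _ c, coe_emb, embMat_apply_left _ _ (hYC j),
        Matrix.one_apply_ne hc.symm, mul_zero]
    · simp
  let s : Set.range R → GL C F := fun r => r.2.choose
  have hs : ∀ r, R (s r) = r := fun r => r.2.choose_spec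
  have hli := linearIndependent_of_wt (ρ := ρ) hψ (sq0_blk C)
    (v := fun r : Set.range R => ρ (emb C (s r)) v) (fun r => rho_ne_zero hv _)
    (fun r => hwt (s r)) fun r r' e => by
      ext1
      rw [← hs r, ← hs r']
      funext j a
      rw [← hval, ← hval]
      exact e a (Y j) (mem_blk.2 ⟨a.2, hYC j⟩)
  have h1 := hli.fintype_card_le_finrank
  let Φ : GL C F → Set.range R × ({c : C // c ∉ Set.range X'} → C → F) := fun g =>
    (⟨R g, g, rfl⟩, fun c a => (↑g⁻¹ : Matrix C C F) c a)
  have hΦ : Function.Injective Φ := by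
    intro g g' e
    rw [← _root_.inv_inj]
    ext c a
    by_cases hc : c ∈ Set.range X'
    · obtain ⟨j, rfl⟩ := hc
      exact congrFun (congrFun (congrArg Subtype.val (congrArg Prod.fst e)) j) a
    · exact congrFun (congrFun (congrArg Prod.snd e) ⟨c, hc⟩) a
  have h2 := Fintype.card_le_of_injective Φ hΦ
  have h3 : Fintype.card {c : C // c ∉ Set.range X'} = n - k - k := by
    rw [Fintype.card_subtype_compl, Fintype.card_coe, hCcard]
    congr 1
    rw [Set.card_range_of_injective hX', Fintype.card_fin]
  rw [Fintype.card_prod, Fintype.card_fun, Fintype.card_fun, h3, Fintype.card_coe, hCcard,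
    ← pow_mul] at h2
  have h4 := card_pow_le_card_GL (I := C) (F := F)
  rw [Fintype.card_coe, hCcard, Nat.card_eq_fintype_card] at h4
  have hr := one_le_ratio (F := F)
  have hq := one_lt_card (F := F)
  have h5 : (Fintype.card (GL C F) : ℝ) ≤
      Module.finrank ℂ V * (Fintype.card F : ℝ) ^ ((n - k) * (n - k - k)) := by
    exact_mod_cast h2.trans (Nat.mul_le_mul_right _ h1)
  have h6 : (n - k) * (n - k) = k * (n - k) + (n - k) * (n - k - k) := by
    obtain ⟨d, hd⟩ := Nat.exists_eq_add_of_le hk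
    rw [hd, Nat.add_sub_cancel_left]; ring
  rw [h6, pow_add] at h4
  refine le_of_mul_le_mul_right ?_ (by positivity : (0 : ℝ) <
    (Fintype.card F : ℝ) ^ ((n - k) * (n - k - k)))
  refine h4.trans ((mul_le_mul_of_nonneg_right h5 (by positivity)).trans_eq (by ring))

end LowerBound

section Maschke

variable {G V : Type*} [Group G] [Finite G] [AddCommGroup V] [Module ℂ V]
  {ρ : Representation ℂ G V}

/-- A stable subspace is the image of an equivariant projection. -/
lemma exists_equivariant_projection {S : Submodule ℂ V} (hS : StableUnder ρ Set.univ S) :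
    ∃ π : V →ₗ[ℂ] V, (∀ g v, π (ρ g v) = ρ g (π v)) ∧ (∀ v, π v ∈ S) ∧ ∀ v ∈ S, π v = v := by
  let _ := Fintype.ofFinite G
  obtain ⟨p, hp⟩ := S.subtype.exists_leftInverse_of_injective S.ker_subtype
  have hpS : ∀ v ∈ S, (p v : V) = v := fun v hv =>
    congrArg Subtype.val (LinearMap.congr_fun hp ⟨v, hv⟩)
  refine ⟨(Fintype.card G : ℂ)⁻¹ • ∑ g : G, ρ g ∘ₗ S.subtype ∘ₗ p ∘ₗ ρ g⁻¹, fun h v => ?_,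
    fun v => ?_, fun v hv => ?_⟩
  · simp only [LinearMap.smul_apply, LinearMap.sum_apply, LinearMap.comp_apply, map_smul, map_sum]
    congr 1
    refine Fintype.sum_equiv (Equiv.mulLeft h⁻¹) _ _ fun g => ?_
    simp only [Equiv.coe_mulLeft, ← Module.End.mul_apply, ← map_mul, mul_inv_cancel_left,
      _root_.mul_inv_rev, _root_.inv_inv]
  · simp only [LinearMap.smul_apply, LinearMap.sum_apply, LinearMap.comp_apply]
    exact S.smul_mem _ (S.sum_mem fun g _ => hS g trivial _ (p _).2)
  · simp only [LinearMap.smul_apply, LinearMap.sum_apply, LinearMap.comp_apply]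
    have : ∀ g : G, ρ g (S.subtype (p (ρ g⁻¹ v))) = v := fun g => by
      rw [Submodule.subtype_apply, hpS _ (hS _ trivial v hv), ← Module.End.mul_apply, ← map_mul,
        mul_inv_cancel, map_one, Module.End.one_apply]
    simp only [this, Finset.sum_const, Finset.card_univ]
    rw [← Nat.cast_smul_eq_nsmul ℂ, smul_smul, inv_mul_cancel₀, one_smul]
    exact Nat.cast_ne_zero.2 Fintype.card_ne_zero

/-- A stable subspace meeting a subspace preserved by all equivariant endomorphisms contains an
irreducible one that still meets it. -/
lemma exists_irr_inf_ne_bot [FiniteDimensional ℂ V] {N S : Submodule ℂ V}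
    (hN : ∀ T : V →ₗ[ℂ] V, (∀ g v, T (ρ g v) = ρ g (T v)) → ∀ v ∈ N, T v ∈ N)
    (hS : StableUnder ρ Set.univ S) (hSN : S ⊓ N ≠ ⊥) :
    ∃ (T : Submodule ℂ V) (h : StableUnder ρ Set.univ T), T ≤ S ∧ T ⊓ N ≠ ⊥ ∧
      Irr (Subrepresentation.toRepresentation (ρ := ρ) ⟨T, fun g _ hv => h g trivial _ hv⟩) := by
  let p : ℕ → Prop := fun d => ∃ T : Submodule ℂ V, T ≤ S ∧ T ⊓ N ≠ ⊥ ∧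
    StableUnder ρ Set.univ T ∧ Module.finrank ℂ T = d
  have hp : ∃ d, p d := ⟨_, S, le_rfl, hSN, hS, rfl⟩
  obtain ⟨T, hTS, hTN, hT, hd⟩ := Nat.find_spec hp
  have hmin : ∀ T' : Submodule ℂ V, T' ≤ T → T' ⊓ N ≠ ⊥ → StableUnder ρ Set.univ T' → T' = T := by
    intro T' h1 h2 h3
    have := Nat.find_min' hp ⟨T', h1.trans hTS, h2, h3, rfl⟩
    exact Submodule.eq_of_le_of_finrank_le h1 (hd.trans_le this)
  refine ⟨T, hT, hTS, hTN, Submodule.nontrivial_iff_ne_bot.2 fun h => hTN ?_,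
    fun R hR hR0 => ?_⟩
  · exact (congrArg (· ⊓ N) h).trans (bot_inf_eq _)
  obtain ⟨R', hR'⟩ : ∃ R', R' = R.map T.subtype := ⟨_, rfl⟩
  have hR't : StableUnder ρ Set.univ R' := by
    rw [hR']
    rintro g - _ ⟨v, hv, rfl⟩
    exact ⟨_, hR g trivial v hv, rfl⟩
  have hR'T : R' ≤ T := by rw [hR']; exact Submodule.map_subtype_le T R
  have hR'0 : R' ≠ ⊥ := fun h0 => hR0 (Submodule.map_injective_of_injective T.injective_subtype
      ((hR'.symm.trans h0).trans (Submodule.map_bot _).symm))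
  suffices h : R' = T by
    refine Submodule.map_injective_of_injective T.injective_subtype ?_
    rw [← hR', h, Submodule.map_top, Submodule.range_subtype]
  obtain ⟨π, h1, h2, h3⟩ := exists_equivariant_projection hR't
  by_contra hne
  have hker : StableUnder ρ Set.univ (T ⊓ LinearMap.ker π) := by
    rintro g - v ⟨hv, hv'⟩
    refine ⟨hT g trivial v hv, ?_⟩
    rw [SetLike.mem_coe, LinearMap.mem_ker] at hv' ⊢
    rw [h1, hv', map_zero]
  have h4 : T ⊓ LinearMap.ker π ≠ T := by
    intro h
    refine hR'0 (eq_bot_iff.2 fun v hv => ?_)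
    have : v ∈ T ⊓ LinearMap.ker π := h.ge (hR'T hv)
    rw [Submodule.mem_bot, ← h3 v hv]
    exact this.2
  obtain ⟨v, ⟨hvT, hvN⟩, hv0⟩ := Submodule.exists_mem_ne_zero_of_ne_bot hTN
  by_cases hv : π v = 0
  · refine h4 (hmin _ inf_le_left (fun h => hv0 ?_) hker)
    exact (Submodule.mem_bot ℂ).1 (h ▸ ⟨⟨hvT, hv⟩, hvN⟩)
  · refine hne (hmin _ hR'T (fun h => hv ?_) hR't)
    exact (Submodule.mem_bot ℂ).1 (h ▸ ⟨h2 v, hN π h1 v hvN⟩)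

end Maschke

section Category

variable {G : Type} [Group G] [Finite G]

/-- The endomorphism of an object of `FDRep` given by an equivariant linear map. -/
noncomputable def homOfLinearMap (ρ : FDRep ℂ G) (T : ρ →ₗ[ℂ] ρ)
    (hT : ∀ g v, T (ρ.ρ g v) = ρ.ρ g (T v)) : ρ ⟶ ρ :=
  ⟨InducedCategory.homMk (ModuleCat.ofHom T), fun g => by
    ext v
    exact hT g v⟩

lemma hom_comm_apply (ρ : FDRep ℂ G) (f : ρ ⟶ ρ) (g : G) (v : ρ) :
    f.hom.hom.hom (ρ.ρ g v) = ρ.ρ g (f.hom.hom.hom v) :=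
  ConcreteCategory.congr_hom ((forget (FGModuleCat ℂ)).congr_map (f.comm g)) v

/-- An object of `FDRep` is simple iff its representation has no proper nonzero subspace that is
stable. -/
lemma simple_iff_irr (ρ : FDRep ℂ G) : Simple ρ ↔ Irr (ρ.ρ : Representation ℂ G ρ) := by
  have : NeZero (Nat.card G : ℂ) := ⟨Nat.cast_ne_zero.2 Nat.card_pos.ne'⟩
  rw [FDRep.simple_iff_end_is_rank_one]
  constructor
  · intro h
    have hnt : Nontrivial ρ := by
      by_contra hsub
      rw [not_nontrivial_iff_subsingleton] at hsub
      obtain ⟨f, hf⟩ := (Module.finrank_pos_iff_exists_ne_zero (R := ℂ)).1 (h ▸ Nat.one_pos)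
      refine hf (Action.Hom.ext ?_)
      ext v
      exact Subsingleton.elim _ _
    refine ⟨hnt, fun S hS hS0 => eq_top_iff.2 fun w _ => ?_⟩
    obtain ⟨π, h1, h2, h3⟩ := exists_equivariant_projection hS
    obtain ⟨v, hv, hv0⟩ := Submodule.exists_mem_ne_zero_of_ne_bot hS0
    have hone : (𝟙 ρ : ρ ⟶ ρ) ≠ 0 := by
      intro h0
      refine hv0 ?_
      exact congrArg (fun f : ρ ⟶ ρ => f.hom.hom.hom v) h0
    obtain ⟨c, hc⟩ := (finrank_eq_one_iff_of_nonzero' _ hone).1 h (homOfLinearMap ρ π h1)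
    have hcv : ∀ u : ρ, c • u = π u := fun u =>
      congrArg (fun f : ρ ⟶ ρ => f.hom.hom.hom u) hc
    have hc1 : c ≠ 0 := by
      rintro rfl
      exact hv0 (by rw [← h3 v hv, ← hcv, zero_smul])
    have : c⁻¹ • π w ∈ S := S.smul_mem _ (h2 w)
    rwa [← hcv, smul_smul, inv_mul_cancel₀ hc1, one_smul] at this
  · rintro ⟨hnt, h⟩
    obtain ⟨v, hv⟩ := exists_ne (0 : ρ)
    have hone : (𝟙 ρ : ρ ⟶ ρ) ≠ 0 := by
      intro h0
      refine hv ?_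
      exact congrArg (fun f : ρ ⟶ ρ => f.hom.hom.hom v) h0
    refine (finrank_eq_one_iff_of_nonzero' _ hone).2 fun f => ?_
    let T : Module.End ℂ ρ := f.hom.hom.hom
    obtain ⟨c, hc⟩ := Module.End.exists_eigenvalue T
    have htop : T.eigenspace c = ⊤ := by
      refine h _ (fun g _ v hv => ?_) hc
      rw [Module.End.mem_eigenspace_iff] at hv ⊢
      rw [show T (ρ.ρ g v) = ρ.ρ g (T v) from hom_comm_apply ρ f g v, hv, map_smul]
    refine ⟨c, Action.Hom.ext ?_⟩
    ext u
    have : u ∈ T.eigenspace c := htop ▸ Submodule.mem_top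
    exact (Module.End.mem_eigenspace_iff.1 this).symm

end Category

section MatRep

variable {I F V : Type*} [Fintype I] [DecidableEq I] [Field F] [Fintype F]
  [AddCommGroup V] [Module ℂ V] {ρ : Representation ℂ (GL I F) V} {ψ : AddChar F ℂ}

lemma Wt.coe {S : Subrepresentation ρ} {P : Finset (I × I)} {B : Matrix I I F}
    {v : S.toSubmodule} (h : Wt S.toRepresentation ψ P B v) : Wt ρ ψ P B (v : V) := fun x =>
  congrArg Subtype.val (h x)

lemma Wt.restrict {S : Subrepresentation ρ} {P : Finset (I × I)} {B : Matrix I I F}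
    {v : S.toSubmodule} (h : Wt ρ ψ P B (v : V)) : Wt S.toRepresentation ψ P B v := fun x =>
  Subtype.ext (h x)

lemma HasRank.of_subrepresentation {S : Subrepresentation ρ} {r : ℕ}
    (h : HasRank S.toRepresentation ψ r) : HasRank ρ ψ r := by
  obtain ⟨X, Y, hX, hY, hXY, v, hv, hw⟩ := h
  exact ⟨X, Y, hX, hY, hXY, v, fun h => hv (Subtype.ext h), hw.coe⟩

variable (I F) in
/-- The representation on functions of `k`-tuples of column vectors. -/
noncomputable def matRep (k : ℕ) : Representation ℂ (GL I F) (Matrix I (Fin k) F → ℂ) where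
  toFun g := LinearMap.funLeft ℂ ℂ fun m => (↑g⁻¹ : Matrix I I F) * m
  map_one' := by
    ext f m
    simp [LinearMap.funLeft_apply]
  map_mul' g h := by
    ext f m
    simp [LinearMap.funLeft_apply, Matrix.mul_assoc]

lemma matRep_apply {k : ℕ} (g : GL I F) (f : Matrix I (Fin k) F → ℂ) (m : Matrix I (Fin k) F) :
    matRep I F k g f m = f ((↑g⁻¹ : Matrix I I F) * m) := rfl

lemma matRep_un_apply {k : ℕ} {x : Matrix I I F} (hx : x * x = 0) (f : Matrix I (Fin k) F → ℂ)
    (m : Matrix I (Fin k) F) : matRep I F k (un x) f m = f (m - (x * m : Matrix I (Fin k) F)) := by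
  rw [matRep_apply, un_inv hx, coe_un (by simpa using hx), Matrix.add_mul, Matrix.one_mul,
    Matrix.neg_mul, sub_eq_add_neg]

/-- Functions of `k`-tuples of vectors only involve weights of rank at most `k`. -/
lemma not_hasRank_matRep (hψ : ψ ≠ 1) {k r : ℕ} (hr : k < r) : ¬ HasRank (matRep I F k) ψ r := by
  rintro ⟨X, Y, hX, hY, hXY, f, hf, hw⟩
  obtain ⟨m, hm⟩ := Function.ne_iff.1 hf
  obtain ⟨c, hc, hc0⟩ : ∃ c : Fin r → F, c ᵥ* m.submatrix Y id = 0 ∧ c ≠ 0 := by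
    have := LinearMap.ker_ne_bot_of_finrank_lt (f := (m.submatrix Y id).vecMulLinear)
      (by simpa using hr)
    obtain ⟨c, hc, hc0⟩ := Submodule.exists_mem_ne_zero_of_ne_bot this
    exact ⟨c, hc, hc0⟩
  obtain ⟨i, hi⟩ := Function.ne_iff.1 hc0
  rw [Pi.zero_apply] at hi
  obtain ⟨t, ht⟩ := exists_addChar_ne_one hψ
  let x : Matrix I I F := ∑ j, Matrix.single (X i) (Y j) ((c i)⁻¹ * t * c j)
  have hxa : ∀ a, x (X i) (Y a) = (c i)⁻¹ * t * c a := by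
    intro a
    simp only [x, Matrix.sum_apply]
    rw [Finset.sum_eq_single a]
    · simp
    · intro j _ hj
      rw [Matrix.single_apply, if_neg]
      exact fun h => hj (hY h.2)
    · simp
  have hx0 : ∀ a b, a ≠ X i → x a b = 0 := by
    intro a b h
    simp only [x, Matrix.sum_apply]
    refine Finset.sum_eq_zero fun j _ => ?_
    rw [Matrix.single_apply, if_neg]
    exact fun h' => h h'.1.symm
  have hP : ∀ a b, (a, b) ∉ blk (Finset.univ.image Y)ᶜ → x a b = 0 := by
    intro a b h
    simp only [x, Matrix.sum_apply]
    refine Finset.sum_eq_zero fun j _ => ?_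
    rw [Matrix.single_apply, if_neg]
    rintro ⟨rfl, rfl⟩
    refine h (mem_blk.2 ⟨?_, ?_⟩)
    · simpa using fun l => (hXY i l).symm
    · simp
  have hxx : x * x = 0 := by
    have := mask_mul_mask (sq0_blk (Finset.univ.image Y)ᶜ) x x
    rwa [mask_eq_self.2 hP] at this
  have hxm : (x * m : Matrix I (Fin k) F) = 0 := by
    have : (x * m : Matrix I (Fin k) F) = ∑ j, Matrix.single (X i) (Y j) ((c i)⁻¹ * t * c j) * m := by
      simp only [x, Matrix.sum_mul]
    rw [this]
    ext a l
    rw [Matrix.sum_apply, Matrix.zero_apply]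
    by_cases ha : a = X i
    · subst ha
      simp only [Matrix.single_mul_apply_same]
      have := congrFun hc l
      rw [Matrix.vecMul, dotProduct] at this
      simp only [Matrix.submatrix_apply, id, Pi.zero_apply] at this
      simp only [mul_assoc]
      rw [← Finset.mul_sum, ← Finset.mul_sum, this, mul_zero, mul_zero]
    · exact Finset.sum_eq_zero fun j _ => Matrix.single_mul_apply_of_ne _ _ _ _ _ ha _
  have h1 := congrFun (hw.apply hP) m
  rw [matRep_un_apply hxx, hxm, sub_zero, trace_matching, Finset.sum_eq_single i,
    hxa, mul_right_comm, inv_mul_cancel₀ hi, one_mul, Pi.smul_apply, smul_eq_mul] at h1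
  · exact ht (mul_right_cancel₀ hm (by rw [one_mul]; exact h1.symm))
  · exact fun j _ hj => hx0 _ _ fun h => hj (hX h)
  · simp

variable (ρ ψ) in
/-- The vectors of a given weight. -/
def wtSpace (P : Finset (I × I)) (B : Matrix I I F) : Submodule ℂ V where
  carrier := {v | Wt ρ ψ P B v}
  add_mem' hv hw x := by rw [map_add, hv x, hw x, smul_add]
  zero_mem' x := by simp
  smul_mem' c v hv x := by rw [map_smul, hv x, smul_comm]

lemma Wt.map {P : Finset (I × I)} {B : Matrix I I F} {v : V} (h : Wt ρ ψ P B v) {T : V →ₗ[ℂ] V}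
    (hT : ∀ g v, T (ρ g v) = ρ g (T v)) : Wt ρ ψ P B (T v) := fun x => by
  rw [← hT, h x, map_smul]

/-- The indicator function of the tuples spanning the coordinate space of the image of `Y`. -/
noncomputable def spanInd {k : ℕ} (Y : Fin k → I) : Matrix I (Fin k) F → ℂ := fun m =>
  if (∀ a ∉ Finset.univ.image Y, m a = 0) ∧ (m.submatrix Y id).det ≠ 0 then 1 else 0

lemma matRep_spanInd {k : ℕ} {Y : Fin k → I} (hY : Function.Injective Y) {g : GL I F}
    (hg : g ∈ par (Finset.univ.image Y)) : matRep I F k g (spanInd Y) = spanInd Y := by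
  have key : ∀ g ∈ par (F := F) (Finset.univ.image Y), ∀ m : Matrix I (Fin k) F,
      ((∀ a ∉ Finset.univ.image Y, m a = 0) ∧ (m.submatrix Y id).det ≠ 0) →
      ((∀ a ∉ Finset.univ.image Y, ((g : Matrix I I F) * m) a = 0) ∧
        (((g : Matrix I I F) * m).submatrix Y id).det ≠ 0) := by
    rintro g hg m ⟨h1, h2⟩
    have h3 : ∀ (g : GL I F) (m : Matrix I (Fin k) F), (∀ a ∉ Finset.univ.image Y, m a = 0) →
        ∀ a l, ((g : Matrix I I F) * m) a l = ∑ j, (g : Matrix I I F) a (Y j) * m (Y j) l := by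
      intro g m h1 a l
      rw [Matrix.mul_apply, ← Finset.sum_subset (Finset.subset_univ (Finset.univ.image Y)),
        Finset.sum_image fun _ _ _ _ h => hY h]
      intro b _ hb
      rw [h1 b hb, Pi.zero_apply, mul_zero]
    have h4 : ∀ g ∈ par (F := F) (Finset.univ.image Y), ∀ m : Matrix I (Fin k) F,
        (∀ a ∉ Finset.univ.image Y, m a = 0) →
        ∀ a ∉ Finset.univ.image Y, ((g : Matrix I I F) * m) a = 0 := by
      intro g hg m h1 a ha
      ext l
      rw [h3 g m h1]
      exact Finset.sum_eq_zero fun j _ => by rw [mem_par.1 hg a ha _ (by simp), zero_mul]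
    have h5 : ∀ (g : GL I F) (m : Matrix I (Fin k) F), (∀ a ∉ Finset.univ.image Y, m a = 0) →
        ((g : Matrix I I F) * m).submatrix Y id =
          (g : Matrix I I F).submatrix Y Y * m.submatrix Y id := by
      intro g m h1
      ext i l
      rw [Matrix.submatrix_apply, h3 g m h1, Matrix.mul_apply]
      rfl
    refine ⟨h4 g hg m h1, ?_⟩
    have h6 := h5 g⁻¹ _ (h4 g hg m h1)
    rw [← Matrix.mul_assoc, ← Units.val_mul, inv_mul_cancel, Units.val_one, Matrix.one_mul] at h6
    intro h0
    rw [h6, Matrix.det_mul, h0, mul_zero] at h2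
    exact h2 rfl
  ext m
  rw [matRep_apply]
  by_cases h : (∀ a ∉ Finset.univ.image Y, m a = 0) ∧ (m.submatrix Y id).det ≠ 0
  · rw [spanInd, spanInd, if_pos h, if_pos (key _ (inv_mem hg) m h)]
  · rw [spanInd, spanInd, if_neg h, if_neg]
    intro h'
    have := key g hg _ h'
    rw [← Matrix.mul_assoc, ← Units.val_mul, mul_inv_cancel, Units.val_one, Matrix.one_mul] at this
    exact h this

/-- The indicator function of a coordinate space has a component of full rank. -/
lemma proj_spanInd_ne_zero {k : ℕ} {X Y : Fin k → I} (hY : Function.Injective Y)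
    (hXY : ∀ i j, X i ≠ Y j) :
    proj ψ (uChar (matRep I F k) (blk (Finset.univ.image Y)ᶜ) (sq0_blk _)) (matching X Y)
      (spanInd Y) ≠ 0 := by
  obtain ⟨P, hPdef⟩ : ∃ P, P = blk (Finset.univ.image Y)ᶜ := ⟨_, rfl⟩
  have hP : Sq0 P := hPdef ▸ sq0_blk _
  have hmem : ∀ a j, a ∉ Finset.univ.image Y → (a, Y j) ∈ P := fun a j ha => by
    rw [hPdef]; exact mem_blk.2 ⟨by simpa using ha, by simp⟩
  have hnmem : ∀ a b, (a, b) ∈ P → a ∉ Finset.univ.image Y ∧ b ∈ Finset.univ.image Y := by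
    intro a b hab
    rw [hPdef, mem_blk] at hab
    exact ⟨by simpa using hab.1, by simpa using hab.2⟩
  let m : Matrix I (Fin k) F := Matrix.of fun a l => if a = Y l then 1 else 0
  have hmul : ∀ (x : Matrix I I F) a l, (x * m : Matrix I (Fin k) F) a l = x a (Y l) := by
    intro x a l
    rw [Matrix.mul_apply, Finset.sum_eq_single (Y l)]
    · simp [m]
    · intro b _ hb
      simp [m, hb]
    · simp
  have hm0 : ∀ a ∉ Finset.univ.image Y, m a = 0 := by
    intro a ha
    ext l
    simp only [m, Matrix.of_apply, Pi.zero_apply]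
    rw [if_neg]
    rintro rfl
    exact ha (by simp)
  have hmY : m.submatrix Y id = 1 := by
    ext i l
    simp only [m, Matrix.submatrix_apply, Matrix.of_apply, id, Matrix.one_apply, hY.eq_iff]
  have hval : ∀ x : Matrix I I F, ψ (-((matching X Y)ᵀ * x).trace) *
      spanInd Y (m - (mask P x * m : Matrix I (Fin k) F)) =
      if mask P x = 0 then 1 else 0 := by
    intro x
    split_ifs with hx
    · have h1 : ((matching X Y)ᵀ * x).trace = 0 := by
        rw [trace_matching]
        refine Finset.sum_eq_zero fun i _ => ?_
        have := congrFun (congrFun hx (X i)) (Y i)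
        rwa [mask_apply, if_pos (hmem _ _ (by simpa using fun j => (hXY i j).symm))] at this
      rw [h1, neg_zero, AddChar.map_zero_eq_one, one_mul, hx, Matrix.zero_mul, sub_zero,
        spanInd, if_pos ⟨hm0, by rw [hmY, Matrix.det_one]; exact one_ne_zero⟩]
    · rw [spanInd, if_neg, mul_zero]
      rintro ⟨h1, -⟩
      refine hx ?_
      ext a b
      rw [Matrix.zero_apply]
      by_cases hab : (a, b) ∈ P
      · obtain ⟨ha, hb⟩ := hnmem a b hab
        obtain ⟨l, -, rfl⟩ := Finset.mem_image.1 hb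
        have := congrFun (h1 a ha) l
        rw [Matrix.sub_apply, hmul, hm0 a ha, Pi.zero_apply, zero_sub,
          neg_eq_zero] at this
        exact this
      · rw [mask_apply, if_neg hab]
  subst hPdef
  intro h
  have h1 := congrFun h m
  simp only [proj, LinearMap.smul_apply, LinearMap.sum_apply, uChar_apply, Pi.smul_apply,
    Finset.sum_apply, Pi.zero_apply, smul_eq_mul,
    matRep_un_apply (mask_mul_mask hP _ _), hval] at h1
  rw [Finset.sum_boole] at h1
  refine mul_ne_zero (inv_ne_zero card_matrix_ne_zero) (Nat.cast_ne_zero.2 ?_) h1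
  exact Finset.card_ne_zero_of_mem (Finset.mem_filter.2 ⟨Finset.mem_univ 0, mask_zero _⟩)

/-- There is an irreducible representation of rank `k` of small dimension. -/
lemma exists_irr_hasRank_finrank_le (hψ : ψ ≠ 1) {k : ℕ} {X Y : Fin k → I}
    (hX : Function.Injective X) (hY : Function.Injective Y) (hXY : ∀ i j, X i ≠ Y j) :
    ∃ S : Subrepresentation (matRep I F k), Irr S.toRepresentation ∧
      HasRank S.toRepresentation ψ k ∧ ¬ HasRank S.toRepresentation ψ (k + 1) ∧
      (Module.finrank ℂ S.toSubmodule : ℝ) ≤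
        (Fintype.card F : ℝ) ^ (k * (Fintype.card I - k)) * ratio F ^ k := by
  obtain ⟨W, hW⟩ : ∃ W, W = Finset.univ.image Y := ⟨_, rfl⟩
  have hWc : W.card = k := by
    rw [hW, Finset.card_image_of_injective _ hY, Finset.card_univ, Fintype.card_fin]
  let S₀ : Submodule ℂ (Matrix I (Fin k) F → ℂ) := ℂ ∙ spanInd Y
  have hS₀ : StableUnder (matRep I F k) (par (F := F) W) S₀ := by
    intro g hg v hv
    obtain ⟨c, rfl⟩ := Submodule.mem_span_singleton.1 hv
    rw [map_smul, matRep_spanInd hY (hW ▸ hg)]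
    exact hv
  have hle : Module.finrank ℂ S₀ ≤ 1 := finrank_span_le_card {spanInd Y} |>.trans (by simp)
  have h1 := finrank_iSup_map_le hS₀
  have hst := stableUnder_iSup_map (ρ := matRep I F k) S₀
  obtain ⟨T, hT, hTS, hTN, hirr⟩ := exists_irr_inf_ne_bot
    (N := wtSpace (matRep I F k) ψ (blk (Finset.univ.image Y)ᶜ) (matching X Y))
    (fun T hT v hv => Wt.map hv hT) hst (by
      refine (Submodule.ne_bot_iff _).2 ⟨_, ⟨?_, ?_⟩, proj_spanInd_ne_zero (ψ := ψ) hY hXY⟩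
      · exact proj_mem _ (fun x v hv => hst _ trivial v hv) _
          (le_iSup_map S₀ (Submodule.mem_span_singleton_self _))
      · exact wt_proj _ _ _)
  refine ⟨⟨T, fun g _ hv => hT g trivial _ hv⟩, hirr, ?_, ?_, ?_⟩
  · obtain ⟨v, ⟨hvT, hvN⟩, hv0⟩ := Submodule.exists_mem_ne_zero_of_ne_bot hTN
    exact ⟨X, Y, hX, hY, hXY, ⟨v, hvT⟩, fun h => hv0 (congrArg Subtype.val h),
      Wt.restrict hvN⟩
  · exact fun h => not_hasRank_matRep hψ (Nat.lt_succ_self k) h.of_subrepresentation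
  · have h2 := index_par_le (F := F) W
    rw [hWc, Finset.card_compl, hWc] at h2
    refine le_trans ?_ h2
    exact_mod_cast (Submodule.finrank_mono hTS).trans (h1.trans
      ((Nat.mul_le_mul_left _ hle).trans_eq (mul_one _)))

end MatRep

section Flag

variable {n : ℕ} {F : Type*} [Field F] [Fintype F] {ψ : AddChar F ℂ}

/-- The matrices whose last rows form a unipotent upper triangular matrix. -/
def FlagSupp {k : ℕ} (m : Matrix (Fin n) (Fin k) F) : Prop :=
  ∀ (c : Fin k) (a : Fin n), (a.1 = n - k + c.1 → m a c = 1) ∧ (n - k + c.1 < a.1 → m a c = 0)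

/-- The place right above the `c`-th of the last rows. -/
def flagRow {k : ℕ} (hk : k < n) (c : Fin k) : Fin n := ⟨n - k + c.1 - 1, by omega⟩

variable (ψ) in
/-- A function transforming under the last columns through the standard nondegenerate character. -/
noncomputable def flagFun {k : ℕ} (hk : k < n) : Matrix (Fin n) (Fin k) F → ℂ := fun m =>
  if FlagSupp m then ψ (-∑ c, m (flagRow hk c) c) else 0

lemma flagFun_mem_chain {k : ℕ} (hk : k < n) :
    flagFun ψ hk ∈ chain (matRep (Fin n) F k) ψ (n - k) := by
  intro b hb x
  obtain ⟨y, hy⟩ : ∃ y, y = mask (colP b) x := ⟨_, rfl⟩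
  have hyy : y * y = 0 := hy ▸ mask_mul_mask (sq0_colP b) x x
  have hy1 : ∀ a d, d ≠ b → y a d = 0 := by
    intro a d hd
    rw [hy, mask_apply, if_neg]
    rw [mem_colP]
    exact fun h => hd h.2
  have hy2 : ∀ a, b ≤ a → y a b = 0 := by
    intro a ha
    rw [hy, mask_apply, if_neg]
    rw [mem_colP]
    exact fun h => absurd h.1 (not_lt.2 ha)
  rw [← hy]
  obtain ⟨c₀, hc₀⟩ : ∃ c₀ : Fin k, b.1 = n - k + c₀.1 := ⟨⟨b.1 - (n - k), by omega⟩, by simp; omega⟩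
  have htr : ((superdiag n F)ᵀ * y).trace = y (flagRow hk c₀) b := by
    rw [trace_transpose_mul, Finset.sum_eq_single (flagRow hk c₀), Finset.sum_eq_single b]
    · rw [superdiag_apply, if_pos, one_mul]
      simp only [flagRow]
      omega
    · intro d _ hd
      rw [hy1 _ _ hd, mul_zero]
    · simp
    · intro a _ ha
      refine Finset.sum_eq_zero fun d _ => ?_
      by_cases hd : d = b
      · rw [superdiag_apply, if_neg, zero_mul]
        intro h
        refine ha (Fin.ext ?_)
        simp only [flagRow]
        omega
      · rw [hy1 _ _ hd, mul_zero]
    · simp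
  ext m
  rw [matRep_un_apply hyy, htr, Pi.smul_apply, smul_eq_mul]
  obtain ⟨m', hm'⟩ : ∃ m' : Matrix (Fin n) (Fin k) F, m' = m - (y * m : Matrix (Fin n) (Fin k) F) :=
    ⟨_, rfl⟩
  have hmul : ∀ a c, m' a c = m a c - y a b * m b c := by
    intro a c
    rw [hm', Matrix.sub_apply, Matrix.mul_apply, Finset.sum_eq_single b]
    · intro d _ hd
      rw [hy1 _ _ hd, zero_mul]
    · simp
  rw [← hm']
  have hb' : ∀ c, m' b c = m b c := fun c => by rw [hmul, hy2 b le_rfl, zero_mul, sub_zero]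
  have hlow : (∀ c < c₀, m b c = 0) → ∀ (c : Fin k) (a : Fin n), n - k + c.1 ≤ a.1 →
      m' a c = m a c := by
    intro hz c a hac
    rw [hmul]
    rcases lt_or_ge c c₀ with h | h
    · rw [hz c h, mul_zero, sub_zero]
    · rw [hy2, zero_mul, sub_zero]
      rw [Fin.le_def] at h ⊢
      omega
  have hz : ∀ {m : Matrix (Fin n) (Fin k) F}, FlagSupp m → ∀ c < c₀, m b c = 0 := by
    intro m h c hc
    rw [Fin.lt_def] at hc
    exact (h c b).2 (by omega)
  have hiff : FlagSupp m' ↔ FlagSupp m := by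
    constructor
    · intro h c a
      have hl := hlow fun c hc => (hb' c).symm.trans (hz h c hc)
      exact ⟨fun e => (hl c a e.ge).symm.trans ((h c a).1 e),
        fun e => (hl c a e.le).symm.trans ((h c a).2 e)⟩
    · intro h c a
      have hl := hlow (hz h)
      exact ⟨fun e => (hl c a e.ge).trans ((h c a).1 e), fun e => (hl c a e.le).trans ((h c a).2 e)⟩
  by_cases h : FlagSupp m
  · rw [flagFun, flagFun, if_pos h, if_pos (hiff.2 h), ← AddChar.map_add_eq_mul]
    congr 1
    simp only [hmul]
    rw [Finset.sum_sub_distrib, neg_sub, sub_eq_add_neg]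
    congr 1
    rw [Finset.sum_eq_single c₀]
    · rw [(h c₀ b).1 hc₀, mul_one]
    · intro c _ hc
      rcases lt_or_gt_of_ne hc with hc | hc
      · rw [hz h c hc, mul_zero]
      · rw [hy2, zero_mul]
        rw [Fin.lt_def] at hc
        rw [Fin.le_def]
        simp only [flagRow]
        omega
    · simp
  · rw [flagFun, flagFun, if_neg h, if_neg (fun h' => h (hiff.1 h')), mul_zero]

lemma flagFun_ne_zero {k : ℕ} (hk : k < n) : flagFun ψ hk ≠ 0 := by
  refine Function.ne_iff.2 ⟨Matrix.of fun a c => if a.1 = n - k + c.1 then 1 else 0, ?_⟩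
  rw [flagFun, if_pos]
  · exact fun h => one_ne_zero ((AddChar.map_zero_eq_one ψ).symm.trans
      ((add_neg_cancel (G := F) _) ▸ (AddChar.map_add_eq_mul ψ _ _).trans
        (by rw [mul_comm]; exact mul_eq_zero_of_left h _)))
  · intro c a
    constructor
    · intro h
      rw [Matrix.of_apply, if_pos h]
    · intro h
      rw [Matrix.of_apply, if_neg h.ne']

/-- There is an irreducible representation of rank at most `k` of large dimension. -/
lemma exists_irr_le_finrank (hψ : ψ ≠ 1) {k : ℕ} (hk : k < n) :
    ∃ S : Subrepresentation (matRep (Fin n) F k), Irr S.toRepresentation ∧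
      ¬ HasRank S.toRepresentation ψ (k + 1) ∧
      ∏ j ∈ Finset.range k, (Fintype.card F ^ (n - k + j) - 1) ≤
        Module.finrank ℂ S.toSubmodule := by
  obtain ⟨T, hT, -, hTN, hirr⟩ := exists_irr_inf_ne_bot (ρ := matRep (Fin n) F k)
    (N := chain (matRep (Fin n) F k) ψ (n - k)) (S := ⊤)
    (fun T hT v hv b hb => Wt.map (hv b hb) hT) (fun _ _ _ _ => trivial)
    ((Submodule.ne_bot_iff _).2 ⟨_, ⟨trivial, flagFun_mem_chain hk⟩, flagFun_ne_zero hk⟩)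
  obtain ⟨S, hS⟩ : ∃ S : Subrepresentation (matRep (Fin n) F k),
    S = ⟨T, fun g _ hv => hT g trivial _ hv⟩ := ⟨_, rfl⟩
  rw [← hS] at hirr
  refine ⟨S, hirr, fun h => not_hasRank_matRep hψ (Nat.lt_succ_self k) h.of_subrepresentation, ?_⟩
  obtain ⟨v, ⟨hvT, hvN⟩, hv0⟩ := Submodule.exists_mem_ne_zero_of_ne_bot hTN
  have hpos : 1 ≤ Module.finrank ℂ (chain S.toRepresentation ψ (n - k)) := by
    refine Submodule.one_le_finrank_iff.2 ?_
    subst hS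
    exact (Submodule.ne_bot_iff _).2 ⟨⟨v, hvT⟩, fun b hb => Wt.restrict (hvN b hb),
      fun h => hv0 (congrArg Subtype.val h)⟩
  have h1 := prod_mul_finrank_chain_le (ρ := S.toRepresentation) hψ (i := n - k) k (by omega)
  have h2 : chain S.toRepresentation ψ (n - k + k) = ⊤ := by
    rw [Nat.sub_add_cancel hk.le]
    exact chain_eq_top
  rw [h2, finrank_top] at h1
  exact (Nat.le_mul_of_pos_right _ hpos).trans h1

end Flag

section Bridge

variable {n : ℕ} {F : Type} [Field F] [Fintype F] {ψ : AddChar F ℂ}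

/-- The square matrix with upper right block `A` and zeros elsewhere. -/
def lift (A : Matrix (Fin (n / 2)) (Fin (n - n / 2)) F) : Matrix (Fin n) (Fin n) F :=
  (Matrix.fromBlocks 0 A 0 0).submatrix (blockEquiv n).symm (blockEquiv n).symm

variable (n) in
/-- The first half of the indices. -/
def upper : Finset (Fin n) := Finset.univ.image fun i => blockEquiv n (Sum.inl i)

lemma inl_mem_upper (i : Fin (n / 2)) : blockEquiv n (Sum.inl i) ∈ upper n :=
  Finset.mem_image_of_mem _ (Finset.mem_univ _)

lemma inr_notMem_upper (j : Fin (n - n / 2)) : blockEquiv n (Sum.inr j) ∉ upper n := by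
  simp [upper]

lemma exists_of_mem_upper {a : Fin n} (ha : a ∈ upper n) : ∃ i, blockEquiv n (Sum.inl i) = a := by
  simpa [upper] using ha

lemma exists_of_notMem_upper {a : Fin n} (ha : a ∉ upper n) :
    ∃ j, blockEquiv n (Sum.inr j) = a := by
  obtain ⟨s, rfl⟩ := (blockEquiv n).surjective a
  rcases s with i | j
  · exact absurd (inl_mem_upper i) ha
  · exact ⟨j, rfl⟩

lemma lift_apply (A : Matrix (Fin (n / 2)) (Fin (n - n / 2)) F) (i : Fin (n / 2))
    (j : Fin (n - n / 2)) :
    lift A (blockEquiv n (Sum.inl i)) (blockEquiv n (Sum.inr j)) = A i j := by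
  simp [lift]

lemma mask_eq_lift (x : Matrix (Fin n) (Fin n) F) :
    mask (blk (upper n)) x = lift
      (x.submatrix (fun i => blockEquiv n (Sum.inl i)) fun j => blockEquiv n (Sum.inr j)) := by
  ext a b
  obtain ⟨s, rfl⟩ := (blockEquiv n).surjective a
  obtain ⟨t, rfl⟩ := (blockEquiv n).surjective b
  rw [mask_apply]
  rcases s with i | i <;> rcases t with j | j
  · rw [if_neg fun h => (mem_blk.1 h).2 (inl_mem_upper j)]
    simp [lift]
  · rw [if_pos (mem_blk.2 ⟨inl_mem_upper i, inr_notMem_upper j⟩)]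
    simp [lift]
  · rw [if_neg fun h => (mem_blk.1 h).2 (inl_mem_upper j)]
    simp [lift]
  · rw [if_neg fun h => inr_notMem_upper i (mem_blk.1 h).1]
    simp [lift]

lemma mask_lift (A : Matrix (Fin (n / 2)) (Fin (n - n / 2)) F) :
    mask (blk (upper n)) (lift A) = lift A := by
  rw [mask_eq_lift]
  congr 1
  ext i j
  exact lift_apply A i j

lemma lift_mul_lift (A B : Matrix (Fin (n / 2)) (Fin (n - n / 2)) F) : lift A * lift B = 0 := by
  rw [← mask_lift A, ← mask_lift B]
  exact mask_mul_mask (sq0_blk _) _ _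

lemma uGL_eq_un (A : Matrix (Fin (n / 2)) (Fin (n - n / 2)) F) : uGL F n A = un (lift A) := by
  apply Units.ext
  rw [coe_un (lift_mul_lift A A)]
  change uMat F n A = _
  have h : Matrix.fromBlocks 1 A 0 1 =
      (1 : Matrix (Fin (n / 2) ⊕ Fin (n - n / 2)) (Fin (n / 2) ⊕ Fin (n - n / 2)) F) +
        Matrix.fromBlocks 0 A 0 0 := by
    rw [← Matrix.fromBlocks_one, Matrix.fromBlocks_add]
    simp
  rw [uMat, lift, h, Matrix.submatrix_add, Pi.add_apply, Pi.add_apply,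
    Matrix.submatrix_one_equiv]

lemma trace_lift (A B : Matrix (Fin (n / 2)) (Fin (n - n / 2)) F) :
    ((lift B)ᵀ * lift A).trace = (Bᵀ * A).trace := by
  rw [lift, lift, Matrix.transpose_submatrix, Matrix.submatrix_mul_equiv,
    Matrix.fromBlocks_transpose,
    Matrix.fromBlocks_multiply, Matrix.trace, ← Equiv.sum_comp (blockEquiv n)]
  simp [Matrix.trace]

lemma wt_upper_iff {V : Type*} [AddCommGroup V] [Module ℂ V] {ρ : Representation ℂ (GL (Fin n) F) V}
    {B : Matrix (Fin (n / 2)) (Fin (n - n / 2)) F} {v : V} :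
    Wt ρ ψ (blk (upper n)) (lift B) v ↔ ∀ A, ρ (uGL F n A) v = ψ (Bᵀ * A).trace • v := by
  constructor
  · intro h A
    have := h (lift A)
    rwa [mask_lift, trace_lift, ← uGL_eq_un] at this
  · intro h x
    rw [mask_eq_lift, trace_lift, ← uGL_eq_un, h]

/-- The restriction of a representation to the abelian unipotent group. -/
noncomputable def uRep {V : Type*} [AddCommGroup V] [Module ℂ V]
    (ρ : Representation ℂ (GL (Fin n) F) V) :
    AddChar (Matrix (Fin (n / 2)) (Fin (n - n / 2)) F) (Module.End ℂ V) where
  toFun A := ρ (uGL F n A)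
  map_zero_eq_one' := by
    rw [uGL_eq_un, show lift (0 : Matrix (Fin (n / 2)) (Fin (n - n / 2)) F) = 0 by
      simp [lift], un_zero, map_one]
  map_add_eq_mul' A B := by
    rw [← map_mul, uGL_eq_un, uGL_eq_un, uGL_eq_un, ← un_add (lift_mul_lift _ _)
      (lift_mul_lift _ _) (lift_mul_lift _ _) (lift_mul_lift _ _)]
    congr 2
    ext a b
    rcases h : (blockEquiv n).symm a with i | i <;> rcases h' : (blockEquiv n).symm b with j | j <;>
      simp [lift, h, h']

lemma occursInRes_iff (hψ : ψ ≠ 1) (ρ : FDRep ℂ (GL (Fin n) F))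
    (B : Matrix (Fin (n / 2)) (Fin (n - n / 2)) F) :
    OccursInRes n F ψ ρ B ↔ ∃ v : ρ, v ≠ 0 ∧
      Wt (ρ.ρ : Representation ℂ (GL (Fin n) F) ρ) ψ (blk (upper n)) (lift B) v := by
  have htr : LinearMap.trace ℂ ρ (proj ψ (uRep ρ.ρ) B) =
      (Fintype.card (Matrix (Fin (n / 2)) (Fin (n - n / 2)) F) : ℂ)⁻¹ *
        ∑ A, ρ.character (uGL F n A) * ψ (-(Bᵀ * A).trace) := by
    rw [proj, map_smul, map_sum, smul_eq_mul]
    congr 1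
    refine Finset.sum_congr rfl fun A _ => ?_
    rw [map_smul, smul_eq_mul, mul_comm]
    rfl
  have hid : IsIdempotentElem (proj ψ (uRep ρ.ρ) B) :=
    LinearMap.ext fun v => (proj_comp_self (uRep ρ.ρ) hψ B B v).trans (if_pos rfl)
  have h : OccursInRes n F ψ ρ B ↔ proj ψ (uRep ρ.ρ) B ≠ 0 := by
    rw [OccursInRes, ne_eq, ne_eq, ← LinearMap.IsIdempotentElem.trace_eq_zero_iff hid, htr,
      mul_eq_zero, or_iff_right (inv_ne_zero card_matrix_ne_zero)]
  rw [h]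
  constructor
  · intro h0
    obtain ⟨v, hv⟩ := DFunLike.ne_iff.1 h0
    exact ⟨_, hv, wt_upper_iff.2 fun A => apply_proj (uRep ρ.ρ) B A v⟩
  · rintro ⟨v, hv, hw⟩ h0
    have := proj_of_weight (uRep ρ.ρ) hψ (B := B) (wt_upper_iff.1 hw)
    rw [if_pos rfl, h0] at this
    exact hv this.symm

end Bridge

section Minor

variable {F : Type*} [Field F]

lemma exists_linearIndependent_rows {ι κ : Type*} [Fintype ι] [Fintype κ] (M : Matrix ι κ F) {r : ℕ}
    (hr : r ≤ M.rank) : ∃ X : Fin r → ι, LinearIndependent F (M.submatrix X id).row := by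
  obtain ⟨f, hf, -, hlin⟩ := Submodule.exists_fun_fin_finrank_span_eq F (Set.range M.row)
  rw [Matrix.rank_eq_finrank_span_row] at hr
  choose X hX using hf
  refine ⟨fun i => X (Fin.castLE hr i), ?_⟩
  have : (M.submatrix (fun i => X (Fin.castLE hr i)) id).row = f ∘ Fin.castLE hr := by
    ext i j
    rw [Function.comp_apply, ← hX]
    rfl
  rw [this]
  exact hlin.comp _ (Fin.castLE_injective hr)

lemma exists_minor_of_le_rank {ι κ : Type*} [Fintype ι] [Fintype κ] (M : Matrix ι κ F) {r : ℕ}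
    (hr : r ≤ M.rank) : ∃ (X : Fin r → ι) (Y : Fin r → κ), (M.submatrix X Y).det ≠ 0 := by
  obtain ⟨X, hX⟩ := exists_linearIndependent_rows M hr
  obtain ⟨Y, hY⟩ := exists_linearIndependent_rows (r := r) (M.submatrix X id)ᵀ (by
    rw [Matrix.rank_transpose, hX.rank_matrix, Fintype.card_fin])
  refine ⟨X, Y, ?_⟩
  have h := Matrix.linearIndependent_rows_iff_isUnit.1 hY
  rw [Matrix.isUnit_iff_isUnit_det] at h
  rw [← Matrix.det_transpose]
  exact h.ne_zero

end Minor

section Perm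

variable {I : Type*} [Fintype I] [DecidableEq I] {F : Type*} [Field F] [Fintype F]

lemma exists_perm_conj (σ : Equiv.Perm I) : ∃ g : GL I F, ∀ x : Matrix I I F, x * x = 0 →
    un x * g = g * un (x.submatrix σ σ : Matrix I I F) := by
  have h1 : (1 : Matrix I I F).submatrix id σ * (1 : Matrix I I F).submatrix σ id = 1 := by
    rw [← Matrix.submatrix_mul _ _ _ _ _ σ.bijective]
    simp
  have h2 : (1 : Matrix I I F).submatrix σ id * (1 : Matrix I I F).submatrix id σ = 1 := by
    rw [← Matrix.submatrix_mul _ _ _ _ _ Function.bijective_id]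
    simp
  obtain ⟨g, hg⟩ : ∃ g : GL I F, (g : Matrix I I F) = (1 : Matrix I I F).submatrix id σ :=
    ⟨⟨_, _, h1, h2⟩, rfl⟩
  refine ⟨g, fun x hx => ?_⟩
  ext1
  rw [Units.val_mul, Units.val_mul, hg, coe_un hx, coe_un, add_mul, mul_add, one_mul]
  · rw [Matrix.mul_one]
    congr 1
    conv_lhs => rw [← Matrix.submatrix_id_id x]
    rw [← Matrix.submatrix_mul _ _ _ _ _ Function.bijective_id,
      ← Matrix.submatrix_mul _ _ _ _ _ σ.bijective, Matrix.mul_one, Matrix.one_mul]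
  · rw [← Matrix.submatrix_mul _ _ _ _ _ σ.bijective, hx]
    rfl

lemma exists_perm_comp {r : ℕ} {X Y X' Y' : Fin r → I} (hX : Function.Injective X)
    (hY : Function.Injective Y) (hXY : ∀ i j, X i ≠ Y j) (hX' : Function.Injective X')
    (hY' : Function.Injective Y') (hXY' : ∀ i j, X' i ≠ Y' j) :
    ∃ σ : Equiv.Perm I, (∀ i, σ (X i) = X' i) ∧ ∀ i, σ (Y i) = Y' i := by
  have hf := hX.sumElim hY hXY
  have hf' := hX'.sumElim hY' hXY'
  obtain ⟨σ, hσ⟩ : ∃ σ : Equiv.Perm I, ∀ s, σ (Sum.elim X Y s) = Sum.elim X' Y' s := by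
    refine ⟨((Equiv.ofInjective _ hf).symm.trans (Equiv.ofInjective _ hf')).extendSubtype,
      fun s => ?_⟩
    rw [Equiv.extendSubtype_apply_of_mem _ _ (Set.mem_range_self s)]
    simp
  exact ⟨σ, fun i => hσ (Sum.inl i), fun i => hσ (Sum.inr i)⟩

end Perm

section Bridge

variable {n : ℕ} {F : Type} [Field F] [Fintype F] {ψ : AddChar F ℂ}

lemma hasRank_of_occursInRes (hψ : ψ ≠ 1) {ρ : FDRep ℂ (GL (Fin n) F)}
    {B : Matrix (Fin (n / 2)) (Fin (n - n / 2)) F} (h : OccursInRes n F ψ ρ B) {r : ℕ}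
    (hr : r ≤ B.rank) : HasRank (ρ.ρ : Representation ℂ (GL (Fin n) F) ρ) ψ r := by
  obtain ⟨v, hv, hw⟩ := (occursInRes_iff hψ ρ B).1 h
  obtain ⟨X, Y, hdet⟩ := exists_minor_of_le_rank B hr
  refine hw.hasRank hψ hv (X := fun i => blockEquiv n (Sum.inl (X i)))
    (Y := fun i => blockEquiv n (Sum.inr (Y i))) (fun i => inl_mem_upper _)
    (fun i => inr_notMem_upper _) ?_
  have : (lift B).submatrix (fun i => blockEquiv n (Sum.inl (X i)))
      (fun i => blockEquiv n (Sum.inr (Y i))) = B.submatrix X Y := by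
    ext i j
    exact lift_apply B _ _
  rwa [this]

lemma exists_occursInRes_of_hasRank (hψ : ψ ≠ 1) {ρ : FDRep ℂ (GL (Fin n) F)} {r : ℕ}
    (hr : r ≤ n / 2) (h : HasRank (ρ.ρ : Representation ℂ (GL (Fin n) F) ρ) ψ r) :
    ∃ B, r ≤ B.rank ∧ OccursInRes n F ψ ρ B := by
  obtain ⟨X, Y, hX, hY, hXY, v, hv, hw⟩ := h
  have hr' : r ≤ n - n / 2 := by omega
  obtain ⟨X', hX'⟩ : ∃ X' : Fin r → Fin n,
    X' = fun i => blockEquiv n (Sum.inl (Fin.castLE hr i)) := ⟨_, rfl⟩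
  obtain ⟨Y', hY'⟩ : ∃ Y' : Fin r → Fin n,
    Y' = fun i => blockEquiv n (Sum.inr (Fin.castLE hr' i)) := ⟨_, rfl⟩
  have hXu : ∀ i, X' i ∈ upper n := fun i => hX' ▸ inl_mem_upper _
  have hYu : ∀ i, Y' i ∉ upper n := fun i => hY' ▸ inr_notMem_upper _
  have hYi : Function.Injective Y' := by
    rw [hY']
    exact (blockEquiv n).injective.comp (Sum.inr_injective.comp (Fin.castLE_injective hr'))
  have hXi : Function.Injective X' := by
    rw [hX']
    exact (blockEquiv n).injective.comp (Sum.inl_injective.comp (Fin.castLE_injective hr))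
  obtain ⟨σ, hσX, hσY⟩ := exists_perm_comp hX hY hXY hXi hYi fun i j e => hYu j (e ▸ hXu i)
  obtain ⟨g, hg⟩ := exists_perm_conj (F := F) σ
  obtain ⟨P, hP⟩ : ∃ P, P = Finset.univ.image X' ×ˢ Finset.univ.image Y' := ⟨_, rfl⟩
  have hPu : P ⊆ blk (upper n) := by
    rw [hP]
    rintro ⟨a, b⟩ hab
    obtain ⟨ha, hb⟩ := Finset.mem_product.1 hab
    obtain ⟨i, -, rfl⟩ := Finset.mem_image.1 ha
    obtain ⟨j, -, rfl⟩ := Finset.mem_image.1 hb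
    exact mem_blk.2 ⟨hXu i, hYu j⟩
  have hw' : Wt (ρ.ρ : Representation ℂ (GL (Fin n) F) ρ) ψ P (matching X' Y') (ρ.ρ g v) := by
    intro x
    rw [← Module.End.mul_apply, ← map_mul, hg _ (mask_mul_mask ((sq0_blk _).mono hPu) x x), map_mul,
      Module.End.mul_apply, hw.apply, map_smul, trace_matching, trace_matching]
    · simp [hσX, hσY]
    · intro a b hab
      rw [Matrix.submatrix_apply, mask_apply, if_neg]
      intro h
      rw [hP] at h
      obtain ⟨ha, hb⟩ := Finset.mem_product.1 h
      obtain ⟨i, -, hi⟩ := Finset.mem_image.1 ha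
      obtain ⟨j, -, hj⟩ := Finset.mem_image.1 hb
      have hi' : a = X i := σ.injective ((hσX i).trans hi).symm
      have hj' : b = Y j := σ.injective ((hσY j).trans hj).symm
      refine hab (mem_blk.2 ⟨?_, ?_⟩)
      · simpa [hi'] using fun j => (hXY i j).symm
      · simp [hj']
  have hgv : ρ.ρ g v ≠ 0 := by
    intro h0
    apply hv
    have : ρ.ρ g⁻¹ (ρ.ρ g v) = v := by
      rw [← Module.End.mul_apply, ← map_mul, inv_mul_cancel, map_one]
      rfl
    rw [← this, h0, map_zero]
  obtain ⟨C, u, hu, hC, hCP⟩ := hw'.exists_extension hψ (sq0_blk (upper n)) hPu hgv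
  obtain ⟨B, hB⟩ : ∃ B : Matrix (Fin (n / 2)) (Fin (n - n / 2)) F, B =
    C.submatrix (fun i => blockEquiv n (Sum.inl i)) fun j => blockEquiv n (Sum.inr j) := ⟨_, rfl⟩
  refine ⟨B, ?_, (occursInRes_iff hψ ρ B).2 ⟨u, hu, hC.congr fun a b hab => ?_⟩⟩
  · have h1 : B.submatrix (Fin.castLE hr) (Fin.castLE hr') = 1 := by
      ext i j
      have h2 := hCP (X' i) (Y' j) (hP ▸ Finset.mem_product.2 ⟨by simp, by simp⟩)
      rw [matching_apply hYi] at h2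
      rw [hX', hY'] at h2
      rw [hB, Matrix.one_apply]
      refine h2.trans ?_
      simp
    have h3 := Matrix.rank_submatrix_le B (Fin.castLE hr) (Fin.castLE hr')
    rwa [h1, Matrix.rank_one, Fintype.card_fin] at h3
  · obtain ⟨ha, hb⟩ := mem_blk.1 hab
    obtain ⟨i, rfl⟩ := exists_of_mem_upper ha
    obtain ⟨j, rfl⟩ := exists_of_notMem_upper hb
    rw [lift_apply, hB]
    rfl

/-- The `U`-rank in terms of the matchings that occur as weights. -/
lemma hasURank_iff (hψ : ψ ≠ 1) (ρ : FDRep ℂ (GL (Fin n) F)) {k : ℕ} (hk : k < n / 2) :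
    HasURank n F ψ ρ k ↔ HasRank (ρ.ρ : Representation ℂ (GL (Fin n) F) ρ) ψ k ∧
      ¬ HasRank (ρ.ρ : Representation ℂ (GL (Fin n) F) ρ) ψ (k + 1) := by
  constructor
  · rintro ⟨⟨B, hB, hocc⟩, hmax⟩
    refine ⟨hasRank_of_occursInRes hψ hocc hB.ge, fun h => ?_⟩
    obtain ⟨B', hB', hocc'⟩ := exists_occursInRes_of_hasRank hψ hk h
    exact hmax B' hB' hocc'
  · rintro ⟨h, hmax⟩
    have hmax' : ∀ B : Matrix (Fin (n / 2)) (Fin (n - n / 2)) F, k < B.rank →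
        ¬ OccursInRes n F ψ ρ B := fun B hB hocc => hmax (hasRank_of_occursInRes hψ hocc hB)
    obtain ⟨B, hB, hocc⟩ := exists_occursInRes_of_hasRank hψ hk.le h
    exact ⟨⟨B, le_antisymm (not_lt.1 fun h => hmax' B h hocc) hB, hocc⟩, hmax'⟩

end Bridge

section Asymptotics

lemma exists_forall_ratio_pow_le (c : ℕ) {ε : ℝ} (hε : 0 < ε) : ∃ Q : ℕ,
    ∀ (F : Type) [Field F] [Fintype F], Q ≤ Fintype.card F →
      3 ≤ Fintype.card F ∧ 1 + ε < Fintype.card F ∧ ratio F ^ c ≤ 1 + ε := by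
  have h1 : Filter.Tendsto (fun q : ℕ => ((q : ℝ) / (q - 1)) ^ c) Filter.atTop (nhds 1) := by
    have h2 : Filter.Tendsto (fun q : ℕ => (1 : ℝ) + ((q : ℝ) - 1)⁻¹) Filter.atTop
        (nhds (1 + 0)) :=
      tendsto_const_nhds.add (tendsto_inv_atTop_zero.comp
        (Filter.tendsto_atTop_add_const_right _ (-1) tendsto_natCast_atTop_atTop))
    have h3 : Filter.Tendsto (fun q : ℕ => (q : ℝ) / (q - 1)) Filter.atTop (nhds (1 + 0)) := by
      refine h2.congr' ?_
      filter_upwards [Filter.eventually_ge_atTop 2] with q hq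
      have hq' : (2 : ℝ) ≤ q := by exact_mod_cast hq
      have : (q : ℝ) - 1 ≠ 0 := by linarith
      field_simp
      ring
    simpa using h3.pow c
  have h4 : ∀ᶠ q : ℕ in Filter.atTop, 1 + ε < (q : ℝ) :=
    tendsto_natCast_atTop_atTop.eventually_gt_atTop _
  obtain ⟨Q, hQ⟩ := Filter.eventually_atTop.1 (((h1.eventually_le_const
    (by linarith : (1 : ℝ) < 1 + ε)).and h4).and (Filter.eventually_ge_atTop 3))
  exact ⟨Q, fun F _ _ h => ⟨(hQ _ h).2, (hQ _ h).1.2, (hQ _ h).1.1⟩⟩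

lemma one_sub_mul_le {a d r ε : ℝ} (hε : 0 < ε) (ha : 0 ≤ a) (hd : 0 ≤ d) (h : a ≤ d * r)
    (hr : r ≤ 1 + ε) : (1 - ε) * a ≤ d := by
  rcases le_or_gt ε 1 with h1 | h1
  · calc (1 - ε) * a ≤ (1 - ε) * (d * (1 + ε)) :=
          mul_le_mul_of_nonneg_left (h.trans (mul_le_mul_of_nonneg_left hr hd)) (by linarith)
      _ = d - ε ^ 2 * d := by ring
      _ ≤ d := sub_le_self _ (by positivity)
  · exact (mul_nonpos_of_nonpos_of_nonneg (by linarith) ha).trans hd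

variable {F : Type} [Field F] [Fintype F]

lemma ratio_pow_le_pow {a b : ℕ} (h : a ≤ b) : ratio F ^ a ≤ ratio F ^ b :=
  pow_le_pow_right₀ one_le_ratio h

lemma card_pow_le_prod_mul_ratio_pow {m : ℕ} (hm : 0 < m) (k : ℕ) :
    (Fintype.card F : ℝ) ^ (k * m + k.choose 2) ≤
      ((∏ j ∈ Finset.range k, (Fintype.card F ^ (m + j) - 1) : ℕ) : ℝ) * ratio F ^ k := by
  have hq : (1 : ℝ) < Fintype.card F := one_lt_card
  induction k with
  | zero => simp
  | succ k ih =>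
    have e : (k + 1) * m + (k + 1).choose 2 = (k * m + k.choose 2) + (m + k) := by
      rw [Nat.choose_succ_succ' k 1, Nat.choose_one_right]
      ring
    have h1 : (Fintype.card F : ℝ) ^ (m + k) ≤
        ((Fintype.card F ^ (m + k) - 1 : ℕ) : ℝ) * ratio F := by
      rw [Nat.cast_sub (Nat.one_le_pow _ _ Fintype.card_pos), Nat.cast_pow, Nat.cast_one]
      have h2 : (Fintype.card F : ℝ) ≤ (Fintype.card F : ℝ) ^ (m + k) :=
        le_self_pow₀ hq.le (by omega)
      rw [ratio, mul_div_assoc', le_div_iff₀ (by linarith)]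
      nlinarith
    rw [e, pow_add, Finset.prod_range_succ, Nat.cast_mul, pow_succ]
    calc _ ≤ (((∏ j ∈ Finset.range k, (Fintype.card F ^ (m + j) - 1) : ℕ) : ℝ) * ratio F ^ k) *
          (((Fintype.card F ^ (m + k) - 1 : ℕ) : ℝ) * ratio F) :=
          mul_le_mul ih h1 (by positivity) (le_trans (by positivity) ih)
      _ = _ := by ring

end Asymptotics

end URank

/-- fix `n ≥ 2` and `0 ≤ k < ⌊n/2⌋`.  For every `ε > 0` there is `Q` such
that for every finite field `F_q` with `q ≥ Q`:
(i) every irreducible representation `ρ` of `GL_n(F_q)` of `U`-rank `k` satisfies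
`(1−ε)·q^{k(n−k)} ≤ dim ρ ≤ (1+ε)·q^{k(n−k)+k(k−1)/2}`; and
(ii) both bounds are attained (up to the factor `1 ± ε`). -/
theorem dim_bounds_of_URank (n : ℕ) (hn : 2 ≤ n) (k : ℕ) (hk : k < n / 2) :
    ∀ ε : ℝ, 0 < ε → ∃ Q : ℕ,
      ∀ (F : Type) [Field F] [Fintype F], Q ≤ Fintype.card F →
        ∀ (ψ : AddChar F ℂ), ψ ≠ 1 →
          ((∀ ρ : FDRep ℂ (GL (Fin n) F), Simple ρ → HasURank n F ψ ρ k →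
              (1 - ε) * (Fintype.card F : ℝ) ^ (k * (n - k)) ≤ (Module.finrank ℂ ρ : ℝ) ∧
              (Module.finrank ℂ ρ : ℝ) ≤
                (1 + ε) * (Fintype.card F : ℝ) ^ (k * (n - k) + k * (k - 1) / 2))
          ∧ (∃ ρ₁ : FDRep ℂ (GL (Fin n) F), Simple ρ₁ ∧ HasURank n F ψ ρ₁ k ∧
              (Module.finrank ℂ ρ₁ : ℝ) ≤ (1 + ε) * (Fintype.card F : ℝ) ^ (k * (n - k)))
          ∧ (∃ ρ₂ : FDRep ℂ (GL (Fin n) F), Simple ρ₂ ∧ HasURank n F ψ ρ₂ k ∧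
              (1 - ε) * (Fintype.card F : ℝ) ^ (k * (n - k) + k * (k - 1) / 2) ≤
                (Module.finrank ℂ ρ₂ : ℝ))) := by
  intro ε hε
  obtain ⟨Q, hQ⟩ := URank.exists_forall_ratio_pow_le (n + (n + n * n)) hε
  refine ⟨Q, fun F _ _ hF ψ hψ => ?_⟩
  obtain ⟨hq3, hqε, hr⟩ := hQ F hF
  have hr' : ∀ a ≤ n + (n + n * n), URank.ratio F ^ a ≤ 1 + ε := fun a ha =>
    (URank.ratio_pow_le_pow ha).trans hr
  have hq0 : (0 : ℝ) < Fintype.card F := by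
    rw [Nat.cast_pos]
    omega
  have hcard : Fintype.card (Fin n) = n := Fintype.card_fin n
  rw [← Nat.choose_two_right]
  refine ⟨fun ρ hρ hrank => ?_, ?_, ?_⟩
  · rw [URank.hasURank_iff hψ ρ hk] at hrank
    rw [URank.simple_iff_irr] at hρ
    refine ⟨URank.one_sub_mul_le hε (by positivity) (Nat.cast_nonneg _)
      (hrank.1.card_pow_le hψ hcard) (hr' _ (by omega)), ?_⟩
    refine (hρ.finrank_le_of_not_hasRank hψ hq3 hcard hrank.2 (by omega)).trans ?_
    rw [mul_comm]
    exact mul_le_mul_of_nonneg_right (hr' _ (by omega)) (by positivity)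
  · obtain ⟨S, hS, hk1, hk2, hdim⟩ := URank.exists_irr_hasRank_finrank_le (I := Fin n) hψ
      (X := fun i : Fin k => ⟨i.1, by omega⟩) (Y := fun i : Fin k => ⟨k + i.1, by omega⟩)
      (fun i j h => by simpa [Fin.ext_iff] using h) (fun i j h => by simpa [Fin.ext_iff] using h)
      (fun i j h => by
        rw [Fin.ext_iff] at h
        simp only at h
        omega)
    refine ⟨FDRep.of S.toRepresentation, (URank.simple_iff_irr _).2 hS,
      (URank.hasURank_iff hψ _ hk).2 ⟨hk1, hk2⟩, hdim.trans ?_⟩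
    rw [hcard, mul_comm]
    exact mul_le_mul_of_nonneg_right (hr' _ (by omega)) (by positivity)
  · obtain ⟨S, hS, hk2, hdim⟩ := URank.exists_irr_le_finrank (F := F) (n := n) hψ
      (show k < n by omega)
    have hdim' : (Fintype.card F : ℝ) ^ (k * (n - k) + k.choose 2) ≤
        (Module.finrank ℂ S.toSubmodule : ℝ) * URank.ratio F ^ k :=
      (URank.card_pow_le_prod_mul_ratio_pow (by omega) k).trans
        (mul_le_mul_of_nonneg_right (Nat.cast_le.2 hdim)
          (pow_nonneg (zero_le_one.trans URank.one_le_ratio) _))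
    have hk1 : URank.HasRank S.toRepresentation ψ k := by
      rcases k with _ | j
      · have := hS.1
        obtain ⟨v, hv⟩ := exists_ne (0 : S.toSubmodule)
        exact URank.hasRank_zero hv
      · by_contra h
        have h1 := hS.finrank_le_of_not_hasRank hψ hq3 hcard h (by omega)
        have e : (j + 1) * (n - (j + 1)) + (j + 1).choose 2 =
            (j * (n - j) + j.choose 2) + (n - (j + 1)) := by
          obtain ⟨m, rfl⟩ : ∃ m, n = m + (j + 1) := ⟨n - (j + 1), by omega⟩
          rw [Nat.choose_succ_succ' j 1, Nat.choose_one_right, Nat.add_sub_cancel,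
            show m + (j + 1) - j = m + 1 by omega]
          ring
        rw [e, pow_add] at hdim'
        have h2 : (Fintype.card F : ℝ) ^ (j * (n - j) + j.choose 2) *
            (Fintype.card F : ℝ) ^ (n - (j + 1)) ≤
            (Fintype.card F : ℝ) ^ (j * (n - j) + j.choose 2) *
              URank.ratio F ^ ((n + n * n) + (j + 1)) := by
          refine hdim'.trans ((mul_le_mul_of_nonneg_right h1
            (pow_nonneg (zero_le_one.trans URank.one_le_ratio) _)).trans_eq ?_)
          rw [pow_add _ (n + n * n), mul_assoc]
        have h3 := (le_of_mul_le_mul_left h2 (by positivity)).trans (hr' _ (by omega))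
        have h4 : (Fintype.card F : ℝ) ≤ (Fintype.card F : ℝ) ^ (n - (j + 1)) :=
          le_self_pow₀ URank.one_lt_card.le (by omega)
        linarith
    exact ⟨FDRep.of S.toRepresentation, (URank.simple_iff_irr _).2 hS,
      (URank.hasURank_iff hψ _ hk).2 ⟨hk1, hk2⟩,
      URank.one_sub_mul_le hε (by positivity) (Nat.cast_nonneg _) hdim' (hr' _ (by omega))⟩
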